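/- Let d < 0 be a fundamental discriminant (i.e. d is the discriminant of an imaginary quadratic number field K = ℚ(√d)) with at least 32 genera, i.e. ω(|d|) ≥ 6, and let P be the largest prime factor of |d|. If P ≥ 5·10^15 · |d|^{1/2} · (log|d|)^5 · log log|d|, then d has at least two classes of binary quadratic forms in each genus; equivalently, the class number h(d) of ℚ(√d) satisfies h(d) ≥ 2^{ω(|d|)}. -/

import Mathlib

open Real

namespace TwoClassesPerGenus

/-- Newton's expansion of the Cauchy kernel. -/
lemma newton_kernel (z : ℕ → ℂ) (w ζ : ℂ) (hw : ζ ≠ w) (M : ℕ) (hζ : ∀ i < M, ζ ≠ z i) :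
    ∑ n ∈ Finset.range M, (∏ i ∈ Finset.range n, (w - z i)) /
        (∏ i ∈ Finset.range (n + 1), (ζ - z i)) =
      (ζ - w)⁻¹ * (1 - (∏ i ∈ Finset.range M, (w - z i)) / ∏ i ∈ Finset.range M, (ζ - z i)) := by
  induction M with
  | zero => simp
  | succ M ih =>
    rw [Finset.sum_range_succ, ih fun i hi => hζ i (by omega), Finset.prod_range_succ,
      Finset.prod_range_succ]
    have h1 : ζ - z M ≠ 0 := sub_ne_zero.2 (hζ M (by omega))
    have h2 : ζ - w ≠ 0 := sub_ne_zero.2 hw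
    have h3 : ∏ i ∈ Finset.range M, (ζ - z i) ≠ 0 :=
      Finset.prod_ne_zero_iff.2 fun i hi =>
        sub_ne_zero.2 (hζ i (by have := Finset.mem_range.1 hi; omega))
    field_simp
    ring

/-- The determinant of the values of `N` entire functions at `N` points of a disc is small. -/
lemma norm_det_interpolation_le {N : ℕ} (f : Fin N → ℂ → ℂ) (hf : ∀ j, Differentiable ℂ (f j))
    (z : ℕ → ℂ) {ρ M : ℝ} (hρ : 0 < ρ) (hz : ∀ i, ‖z i‖ ≤ ρ) (hM : 0 ≤ M)
    (hfM : ∀ j ζ, ‖ζ‖ = 7 * ρ → ‖f j ζ‖ ≤ M) :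
    ‖(Matrix.of fun j c : Fin N => f j (z c)).det‖ ≤
      N.factorial * (2 * M) ^ N * (1 / 3) ^ (N * (N - 1) / 2) := by
  set D : Matrix (Fin N) (Fin N) ℂ := Matrix.of fun j n =>
    (2 * π * Complex.I : ℂ)⁻¹ •
      ∮ ζ in C(0, 7 * ρ), f j ζ / ∏ i ∈ Finset.range ((n : ℕ) + 1), (ζ - z i) with hD
  set T : Matrix (Fin N) (Fin N) ℂ := Matrix.of fun n c =>
    ∏ i ∈ Finset.range (n : ℕ), (z c - z i) with hT
  have hR : 0 < 7 * ρ := by positivity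
  have hne : ∀ ζ ∈ Metric.sphere (0 : ℂ) (7 * ρ), ∀ i, ζ ≠ z i := by
    rintro ζ hζ i rfl
    have h1 : ‖z i‖ = 7 * ρ := by simpa using hζ
    have := hz i
    linarith
  have hprod : ∀ ζ ∈ Metric.sphere (0 : ℂ) (7 * ρ), ∀ n : ℕ,
      ∏ i ∈ Finset.range n, (ζ - z i) ≠ 0 := fun ζ hζ n =>
    Finset.prod_ne_zero_iff.2 fun i _ => sub_ne_zero.2 (hne ζ hζ i)
  have hmul : (Matrix.of fun j c : Fin N => f j (z c)) = D * T := by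
    ext j c
    have hc : z c ∈ Metric.ball (0 : ℂ) (7 * ρ) := by
      have := hz c
      simp only [Metric.mem_ball, dist_zero_right]
      linarith
    have hcau := (hf j).diffContOnCl (s := Metric.ball (0 : ℂ) (7 * ρ))
      |>.two_pi_i_inv_smul_circleIntegral_sub_inv_smul hc
    simp only [Matrix.mul_apply, Matrix.of_apply, hD, hT]
    rw [← hcau]
    have hintegral : ∀ n ∈ (Finset.univ : Finset (Fin N)), CircleIntegrable (fun ζ =>
        (f j ζ / ∏ i ∈ Finset.range ((n : ℕ) + 1), (ζ - z i)) *
          ∏ i ∈ Finset.range (n : ℕ), (z c - z i)) 0 (7 * ρ) := by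
      intro n _
      apply ContinuousOn.circleIntegrable hR.le
      refine ContinuousOn.mul (ContinuousOn.div (hf j).continuous.continuousOn ?_ ?_)
        continuousOn_const
      · exact (continuous_finsetProd _ fun i _ => by fun_prop).continuousOn
      · exact fun ζ hζ => hprod ζ hζ _
    have hsum : ∀ n : Fin N, ((2 * π * Complex.I : ℂ)⁻¹ •
        ∮ ζ in C(0, 7 * ρ), f j ζ / ∏ i ∈ Finset.range ((n : ℕ) + 1), (ζ - z i)) *
          ∏ i ∈ Finset.range (n : ℕ), (z c - z i) =
        (2 * π * Complex.I : ℂ)⁻¹ • ∮ ζ in C(0, 7 * ρ),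
          (f j ζ / ∏ i ∈ Finset.range ((n : ℕ) + 1), (ζ - z i)) *
            ∏ i ∈ Finset.range (n : ℕ), (z c - z i) := by
      intro n
      rw [smul_mul_assoc]
      congr 1
      have := circleIntegral.integral_const_mul (∏ i ∈ Finset.range (n : ℕ), (z c - z i))
        (fun ζ => f j ζ / ∏ i ∈ Finset.range ((n : ℕ) + 1), (ζ - z i)) 0 (7 * ρ)
      rw [mul_comm, ← this]
      congr 1
      ext ζ
      ring
    rw [Finset.sum_congr rfl fun n _ => hsum n, ← Finset.smul_sum,
      ← circleIntegral.integral_fun_sum hintegral]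
    congr 1
    apply circleIntegral.integral_congr hR.le
    intro ζ hζ
    have hk := newton_kernel z (z c) ζ (hne ζ hζ c) N fun i _ => hne ζ hζ i
    have hzero : ∏ i ∈ Finset.range N, (z c - z i) = 0 :=
      Finset.prod_eq_zero (Finset.mem_range.2 c.2) (sub_self _)
    rw [hzero, zero_div, sub_zero, mul_one] at hk
    simp only [smul_eq_mul]
    rw [← hk, ← Fin.sum_univ_eq_sum_range (fun n => (∏ i ∈ Finset.range n, (z c - z i)) /
        (∏ i ∈ Finset.range (n + 1), (ζ - z i))), Finset.sum_mul]
    refine Finset.sum_congr rfl fun n _ => ?_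
    ring
  have hdetT : T.det = ∏ c : Fin N, ∏ i ∈ Finset.range (c : ℕ), (z c - z i) := by
    rw [Matrix.det_of_isUpperTriangular]
    · simp [hT]
    · intro n c hcn
      simp only [hT, Matrix.of_apply]
      exact Finset.prod_eq_zero (Finset.mem_range.2 hcn) (sub_self _)
  have hTn : ‖T.det‖ ≤ ∏ c : Fin N, (2 * ρ) ^ (c : ℕ) := by
    rw [hdetT, norm_prod]
    refine Finset.prod_le_prod (fun _ _ => norm_nonneg _) fun c _ => ?_
    rw [norm_prod]
    calc _ ≤ ∏ i ∈ Finset.range (c : ℕ), (2 * ρ) :=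
          Finset.prod_le_prod (fun _ _ => norm_nonneg _) fun i _ => by
            have := norm_sub_le (z c) (z i)
            linarith [hz c, hz i]
      _ = _ := by simp
  have hDe : ∀ j n : Fin N, ‖D j n‖ ≤ 2 * M * (1 / (6 * ρ)) ^ (n : ℕ) := by
    intro j n
    have hb : ∀ ζ ∈ Metric.sphere (0 : ℂ) (7 * ρ),
        ‖f j ζ / ∏ i ∈ Finset.range ((n : ℕ) + 1), (ζ - z i)‖ ≤
          M * (1 / (6 * ρ)) ^ ((n : ℕ) + 1) := by
      intro ζ hζ
      have hζ' : ‖ζ‖ = 7 * ρ := by simpa using hζ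
      rw [norm_div, norm_prod, div_eq_mul_inv, one_div, inv_pow]
      refine mul_le_mul (hfM j ζ hζ') ?_ (by positivity) hM
      refine inv_anti₀ (by positivity) ?_
      calc (6 * ρ) ^ ((n : ℕ) + 1) = ∏ i ∈ Finset.range ((n : ℕ) + 1), (6 * ρ) := by simp
        _ ≤ _ := Finset.prod_le_prod (fun _ _ => by positivity) fun i _ => by
            have := norm_sub_norm_le ζ (z i)
            linarith [hz i]
    have h1 := circleIntegral.norm_two_pi_i_inv_smul_integral_le_of_norm_le_const hR.le hb
    simp only [hD, Matrix.of_apply]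
    refine h1.trans ?_
    rw [pow_succ]
    have : 7 * ρ * (M * ((1 / (6 * ρ)) ^ (n : ℕ) * (1 / (6 * ρ)))) =
      (7 / 6) * M * (1 / (6 * ρ)) ^ (n : ℕ) := by field_simp
    rw [this]
    gcongr
    norm_num
  have hDn : ‖D.det‖ ≤ N.factorial * ∏ n : Fin N, (2 * M * (1 / (6 * ρ)) ^ (n : ℕ)) := by
    rw [Matrix.det_apply]
    refine (norm_sum_le _ _).trans ?_
    calc _ ≤ ∑ σ : Equiv.Perm (Fin N), ∏ n : Fin N, (2 * M * (1 / (6 * ρ)) ^ (n : ℕ)) := by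
          refine Finset.sum_le_sum fun σ _ => ?_
          rw [Units.smul_def, zsmul_eq_mul, norm_mul, norm_prod]
          have hs : ‖(((Equiv.Perm.sign σ : ℤˣ) : ℤ) : ℂ)‖ = 1 := by
            rcases Int.units_eq_one_or (Equiv.Perm.sign σ) with h | h <;> simp [h]
          rw [hs, one_mul]
          exact Finset.prod_le_prod (fun _ _ => norm_nonneg _) fun n _ => hDe _ n
      _ = _ := by
          rw [Finset.sum_const, nsmul_eq_mul, Finset.card_univ, Fintype.card_perm, Fintype.card_fin]
  rw [hmul, Matrix.det_mul, norm_mul]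
  calc ‖D.det‖ * ‖T.det‖ ≤ (N.factorial * ∏ n : Fin N, (2 * M * (1 / (6 * ρ)) ^ (n : ℕ))) *
        ∏ c : Fin N, (2 * ρ) ^ (c : ℕ) := by gcongr
    _ = N.factorial * ∏ n : Fin N, (2 * M * (1 / 3) ^ (n : ℕ)) := by
        rw [mul_assoc, ← Finset.prod_mul_distrib]
        congr 1
        refine Finset.prod_congr rfl fun n _ => ?_
        rw [mul_assoc, ← mul_pow]
        congr 2
        field_simp
        norm_num
    _ = _ := by
        rw [Finset.prod_mul_distrib, Finset.prod_const, Finset.card_univ, Fintype.card_fin,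
          Finset.prod_pow_eq_pow_sum, Fin.sum_univ_eq_sum_range (fun n => n), Finset.sum_range_id,
          mul_assoc]

end TwoClassesPerGenus

namespace TwoClassesPerGenus

open Polynomial in
/-- The coefficient of a product of polynomials in the top degree allowed by degree bounds. -/
lemma coeff_prod_sum_of_natDegree_le {ι : Type*} (s : Finset ι) (f : ι → ℂ[X]) (n : ι → ℕ)
    (h : ∀ i ∈ s, (f i).natDegree ≤ n i) :
    (∏ i ∈ s, f i).coeff (∑ i ∈ s, n i) = ∏ i ∈ s, (f i).coeff (n i) := by
  classical
  induction s using Finset.induction_on with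
  | empty => simp
  | insert a s ha ih =>
    rw [Finset.prod_insert ha, Finset.sum_insert ha, Finset.prod_insert ha,
      coeff_mul_add_eq_of_natDegree_le (h a (Finset.mem_insert_self a s)),
      ih fun i hi => h i (Finset.mem_insert_of_mem hi)]
    exact (natDegree_prod_le _ _).trans
      (Finset.sum_le_sum fun i hi => h i (Finset.mem_insert_of_mem hi))

open Polynomial in
/-- A determinant of translates of nonzero polynomials weighted by distinct exponentials is
nonzero. -/
lemma det_translates_ne_zero {M : ℕ} (A : Fin M → ℂ[X]) (hA : ∀ l, A l ≠ 0) (x : Fin M → ℂ)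
    (hx : Function.Injective x) (a : ℂ) :
    (Matrix.of fun l g : Fin M => C (x l ^ (g : ℕ)) * (A l).comp (X + C ((g : ℕ) * a))).det
      ≠ 0 := by
  intro h
  have hcoeff := congrArg (fun p : ℂ[X] => p.coeff (∑ l, (A l).natDegree)) h
  have hdeg : ∀ l g : Fin M, (C (x l ^ (g : ℕ)) * (A l).comp (X + C ((g : ℕ) * a))).natDegree ≤
      (A l).natDegree := fun l g => by
    refine (natDegree_C_mul_le _ _).trans ?_
    rw [natDegree_comp, natDegree_X_add_C, mul_one]
  have hlead : ∀ l g : Fin M,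
      (C (x l ^ (g : ℕ)) * (A l).comp (X + C ((g : ℕ) * a))).coeff (A l).natDegree =
        (A l).leadingCoeff * x l ^ (g : ℕ) := fun l g => by
    rw [coeff_C_mul]
    have h1 : ((A l).comp (X + C ((g : ℕ) * a))).natDegree = (A l).natDegree := by
      rw [natDegree_comp, natDegree_X_add_C, mul_one]
    have h2 : ((A l).comp (X + C ((g : ℕ) * a))).leadingCoeff = (A l).leadingCoeff := by
      rw [leadingCoeff_comp (by rw [natDegree_X_add_C]; exact one_ne_zero), leadingCoeff_X_add_C,
        one_pow, mul_one]
    rw [← h2, leadingCoeff, h1, mul_comm]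
  rw [← Matrix.det_transpose, Matrix.det_apply] at hcoeff
  simp only [finsetSum_coeff, coeff_smul, coeff_zero, Matrix.transpose_apply,
    Matrix.of_apply] at hcoeff
  simp_rw [coeff_prod_sum_of_natDegree_le Finset.univ _ _ (fun i _ => hdeg i _), hlead] at hcoeff
  have hv : (Matrix.of fun l g : Fin M => (A l).leadingCoeff * x l ^ (g : ℕ)).det = 0 := by
    rw [← Matrix.det_transpose, Matrix.det_apply, ← hcoeff]
    rfl
  have hv2 : (Matrix.of fun l g : Fin M => (A l).leadingCoeff * x l ^ (g : ℕ)).det =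
      (∏ l, (A l).leadingCoeff) * (Matrix.vandermonde x).det := by
    rw [← Matrix.det_mul_column]
    rfl
  rw [hv2, mul_eq_zero] at hv
  rcases hv with hv | hv
  · rw [Finset.prod_eq_zero_iff] at hv
    obtain ⟨l, -, hl⟩ := hv
    exact hA l (leadingCoeff_eq_zero.1 hl)
  · exact Matrix.det_vandermonde_ne_zero_iff.2 hx hv

open Polynomial in
/-- Zero estimate for exponential polynomials at the points `r a + s b`. -/
lemma zero_estimate {K L R S : ℕ} (p : Fin K → Fin L → ℂ) (a b α : ℂ) (hα : α ≠ 0)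
    (hinj : Function.Injective fun n : ℕ => α ^ n)
    (hdist : ∀ r r' s s' : ℕ, (r * a + s * b : ℂ) = r' * a + s' * b → r = r' ∧ s = s')
    (hKL : K * L ≤ R * S)
    (hzero : ∀ r < R + L, ∀ s < S, ∑ i, ∑ l, p i l * ((r * a + s * b : ℂ) ^ (i : ℕ) *
      (α ^ r * (-1) ^ s) ^ (l : ℕ)) = 0) : p = 0 := by
  classical
  let A : Fin L → ℂ[X] := fun l => ∑ i : Fin K, C (p i l) * X ^ (i : ℕ)
  have hAeval : ∀ l x, (A l).eval x = ∑ i, p i l * x ^ (i : ℕ) := fun l x => by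
    simp [A, eval_finsetSum]
  have hAcoeff : ∀ l (i : Fin K), (A l).coeff i = p i l := fun l i => by
    simp only [A, finsetSum_coeff, coeff_C_mul, coeff_X_pow]
    rw [Finset.sum_eq_single i] <;> simp +contextual [Fin.ext_iff, eq_comm]
  by_contra hp
  let I : Finset (Fin L) := Finset.univ.filter fun l => A l ≠ 0
  have hI : I.Nonempty := by
    by_contra hI
    apply hp
    funext i l
    rw [← hAcoeff]
    have : A l = 0 := by
      by_contra h
      exact hI ⟨l, by simp [I, h]⟩
    simp [this]
  set M := I.card with hM
  have hMpos : 0 < M := hI.card_pos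
  have hML : M ≤ L := by simpa using Finset.card_le_univ I
  let e : Fin M ≃o I := I.orderIsoOfFin rfl
  let ι : Fin M → Fin L := fun m => (e m : Fin L)
  have hι : Function.Injective ι := fun m m' h => e.injective (Subtype.ext h)
  have hιA : ∀ m, A (ι m) ≠ 0 := fun m => (Finset.mem_filter.1 (e m).2).2
  have hKpos : 0 < K := by
    rcases Nat.eq_zero_or_pos K with h | h
    · subst h
      exact absurd (by simp [A]) (hιA ⟨0, hMpos⟩)
    · exact h
  have hAdeg : ∀ l, (A l).natDegree ≤ K - 1 := fun l => by
    refine natDegree_sum_le_of_forall_le _ _ fun i _ => ?_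
    exact (natDegree_C_mul_X_pow_le _ _).trans (by have := i.2; omega)
  set G := (Matrix.of fun l g : Fin M =>
    C ((α ^ (ι l : ℕ)) ^ (g : ℕ)) * (A (ι l)).comp (X + C ((g : ℕ) * a))) with hG
  have hne : G.det ≠ 0 := det_translates_ne_zero (fun l => A (ι l)) hιA (fun l => α ^ (ι l : ℕ))
    (fun m m' h => hι (Fin.ext (hinj h))) a
  have hdeg : G.det.natDegree ≤ M * (K - 1) := by
    rw [Matrix.det_apply]
    refine natDegree_sum_le_of_forall_le _ _ fun σ _ => ?_
    refine (natDegree_smul_le _ _).trans ((natDegree_prod_le _ _).trans ?_)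
    refine (Finset.sum_le_card_nsmul _ _ (K - 1) fun i _ => ?_).trans (by simp)
    simp only [hG, Matrix.of_apply]
    refine (natDegree_C_mul_le _ _).trans ?_
    rw [natDegree_comp, natDegree_X_add_C, mul_one]
    exact hAdeg _
  have hroot : ∀ r < R, ∀ s < S, G.det.eval (r * a + s * b : ℂ) = 0 := fun r hr s hs => by
    rw [← coe_evalRingHom, RingHom.map_det]
    refine Matrix.exists_vecMul_eq_zero_iff.1 ⟨fun l => (α ^ r * (-1) ^ s) ^ (ι l : ℕ), ?_, ?_⟩
    · intro h
      have := congrFun h ⟨0, hMpos⟩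
      simp [hα] at this
    · funext g
      have h1 := hzero (r + g) (by have := g.2; omega) s hs
      rw [Finset.sum_comm] at h1
      have h2 : ∀ l : Fin L, ∑ i, p i l * (((r + g : ℕ) * a + s * b : ℂ) ^ (i : ℕ) *
          (α ^ (r + g : ℕ) * (-1) ^ s) ^ (l : ℕ)) = (α ^ (r + g : ℕ) * (-1) ^ s) ^ (l : ℕ) *
          (A l).eval ((r + g : ℕ) * a + s * b : ℂ) := fun l => by
        rw [hAeval, Finset.mul_sum]
        exact Finset.sum_congr rfl fun i _ => by ring
      simp_rw [h2] at h1
      rw [← Finset.sum_subset (Finset.subset_univ I) fun l _ hl => by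
        have : A l = 0 := by
          by_contra h
          exact hl (by simp [I, h])
        simp [this]] at h1
      rw [← Finset.sum_coe_sort, ← e.toEquiv.sum_comp] at h1
      simp only [Matrix.vecMul, dotProduct, Pi.zero_apply]
      rw [← h1]
      refine Finset.sum_congr rfl fun l _ => ?_
      simp only [hG, RingHom.mapMatrix_apply, Matrix.map_apply, Matrix.of_apply, coe_evalRingHom,
        eval_mul, eval_C, eval_comp, eval_add, eval_X]
      change _ = (α ^ (r + g : ℕ) * (-1) ^ s) ^ (ι l : ℕ) *
          (A (ι l)).eval ((r + g : ℕ) * a + s * b : ℂ)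
      have : (r * a + s * b + (g : ℕ) * a : ℂ) = (r + g : ℕ) * a + s * b := by push_cast; ring
      rw [this, pow_add, mul_pow, mul_pow, mul_pow]
      ring
  let pts : Finset ℂ := (Finset.range R ×ˢ Finset.range S).image fun q => (q.1 * a + q.2 * b : ℂ)
  have hpts : pts.card = R * S := by
    rw [Finset.card_image_of_injective _ fun q q' h => by
      have := hdist _ _ _ _ h; exact Prod.ext this.1 this.2]
    simp
  refine hne (eq_zero_of_natDegree_lt_card_of_eval_eq_zero' _ pts ?_ ?_)
  · intro x hx
    simp only [pts, Finset.mem_image, Finset.mem_product, Finset.mem_range] at hx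
    obtain ⟨q, ⟨hq1, hq2⟩, rfl⟩ := hx
    exact hroot _ hq1 _ hq2
  · rw [hpts]
    refine hdeg.trans_lt (lt_of_lt_of_le ?_ hKL)
    calc M * (K - 1) < M * K := Nat.mul_lt_mul_of_pos_left (by omega) hMpos
      _ ≤ L * K := Nat.mul_le_mul_right _ hML
      _ = K * L := mul_comm _ _

/-- A matrix with independent rows has a nonzero maximal minor. -/
lemma exists_minor_ne_zero {m n : Type*} [Fintype m] [DecidableEq m] [Fintype n]
    (A : Matrix m n ℂ) (hA : ∀ v : m → ℂ, Matrix.vecMul v A = 0 → v = 0) :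
    ∃ c : m → n, (A.submatrix id c).det ≠ 0 := by
  classical
  have hli : LinearIndependent ℂ A.row := by
    rw [← Matrix.vecMul_injective_iff]
    intro v w h
    have := hA (v - w) (by rw [Matrix.sub_vecMul]; exact sub_eq_zero.2 h)
    exact sub_eq_zero.1 this
  obtain ⟨κ, f, hf, hsp, hli2⟩ := exists_linearIndependent' ℂ A.col
  have hr := hli.rank_matrix
  have : Finite κ := Finite.of_injective f hf
  have := Fintype.ofFinite κ
  have hcard : Fintype.card κ = Fintype.card m := by
    rw [← hr, Matrix.rank_eq_finrank_span_cols, ← hsp, finrank_span_eq_card hli2]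
  let e : m ≃ κ := Fintype.equivOfCardEq hcard.symm
  refine ⟨f ∘ e, ?_⟩
  rw [← isUnit_iff_ne_zero, ← Matrix.isUnit_iff_isUnit_det,
    ← Matrix.linearIndependent_cols_iff_isUnit]
  exact hli2.comp e e.injective

end TwoClassesPerGenus

namespace TwoClassesPerGenus

/-- The embedding of `ℤ√d`, `d < 0`, in the upper half plane orientation. -/
noncomputable def zsqrtdToComplex (d : ℤ) (hd : d < 0) : ℤ√d →+* ℂ :=
  Zsqrtd.lift ⟨Complex.I * (√(-d : ℝ) : ℝ), by
    have h : ((√(-d : ℝ) : ℝ) : ℂ) * (√(-d : ℝ) : ℝ) = -(d : ℂ) := by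
      rw [← Complex.ofReal_mul, Real.mul_self_sqrt]
      · push_cast; ring
      · have : (d : ℝ) < 0 := by exact_mod_cast hd
        linarith
    calc Complex.I * (√(-d : ℝ) : ℝ) * (Complex.I * (√(-d : ℝ) : ℝ))
        = (Complex.I * Complex.I) * ((√(-d : ℝ) : ℝ) * (√(-d : ℝ) : ℝ)) := by ring
      _ = d := by rw [h, Complex.I_mul_I]; ring⟩

lemma zsqrtdToComplex_apply (d : ℤ) (hd : d < 0) (x : ℤ√d) :
    zsqrtdToComplex d hd x = x.re + x.im * (Complex.I * (√(-d : ℝ) : ℝ)) := rfl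

lemma re_zsqrtdToComplex (d : ℤ) (hd : d < 0) (x : ℤ√d) :
    (zsqrtdToComplex d hd x).re = x.re := by
  simp [zsqrtdToComplex_apply]

lemma im_zsqrtdToComplex (d : ℤ) (hd : d < 0) (x : ℤ√d) :
    (zsqrtdToComplex d hd x).im = x.im * √(-d : ℝ) := by
  simp [zsqrtdToComplex_apply]

lemma one_le_norm_zsqrtdToComplex (d : ℤ) (hd : d < 0) {x : ℤ√d} (hx : x ≠ 0) :
    1 ≤ ‖zsqrtdToComplex d hd x‖ := by
  have hd' : (d : ℝ) < 0 := by exact_mod_cast hd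
  have h1 : ‖zsqrtdToComplex d hd x‖ ^ 2 = (x.norm : ℝ) := by
    rw [Complex.sq_norm, Complex.normSq_apply, re_zsqrtdToComplex, im_zsqrtdToComplex,
      Zsqrtd.norm_def]
    have := Real.mul_self_sqrt (show (0 : ℝ) ≤ -d by linarith)
    push_cast
    linear_combination (x.im : ℝ) ^ 2 * this
  have h2 : 0 ≤ x.norm := Zsqrtd.norm_nonneg hd.le x
  have h3 : x.norm ≠ 0 := fun h => hx ((Zsqrtd.norm_eq_zero_iff hd x).1 h)
  have h4 : (1 : ℝ) ≤ x.norm := by exact_mod_cast (by omega : 1 ≤ x.norm)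
  nlinarith [norm_nonneg (zsqrtdToComplex d hd x)]

/-- A real number `α > 1` with `α + α⁻¹` an integer is irrational. -/
lemma irrational_of_add_inv {α : ℝ} (hα : 1 < α) {t : ℤ} (ht : α + α⁻¹ = t) : Irrational α := by
  rintro ⟨q, rfl⟩
  have hq : (1 : ℚ) < q := by exact_mod_cast hα
  have ht' : q + q⁻¹ = t := by exact_mod_cast ht
  have hintegral : IsIntegral ℤ q := by
    refine ⟨Polynomial.X ^ 2 - Polynomial.C t * Polynomial.X + 1, by monicity!, ?_⟩
    simp only [Polynomial.eval₂_add, Polynomial.eval₂_sub, Polynomial.eval₂_pow,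
      Polynomial.eval₂_X, Polynomial.eval₂_mul, Polynomial.eval₂_C, Polynomial.eval₂_one]
    rw [algebraMap_int_eq, eq_intCast, ← ht']
    field_simp
    ring
  obtain ⟨m, hm⟩ := IsIntegrallyClosed.isIntegral_iff.1 hintegral
  simp only [algebraMap_int_eq, eq_intCast] at hm
  have h0 : q * (t - q) = 1 := by rw [← ht']; field_simp; ring
  rw [← hm] at h0 hq
  have h1 : m * (t - m) = 1 := by exact_mod_cast h0
  have h2 : 1 < m := by exact_mod_cast hq
  rcases Int.eq_one_or_neg_one_of_mul_eq_one h1 with h | h <;> omega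

open Polynomial in
/-- Liouville's inequality in `ℤ[√d, α]` for a quadratic unit `α` of norm one. -/
lemma one_le_norm_mul_norm_conj (d : ℤ) (hd : d < 0) {α : ℝ} (hα : 1 < α) {t : ℤ}
    (ht : α + α⁻¹ = t) (F : (ℤ√d)[X]) (hF : F.eval₂ (zsqrtdToComplex d hd) (α : ℂ) ≠ 0) :
    1 ≤ ‖F.eval₂ (zsqrtdToComplex d hd) (α : ℂ)‖ *
      ‖F.eval₂ (zsqrtdToComplex d hd) ((α⁻¹ : ℝ) : ℂ)‖ := by
  set φ := zsqrtdToComplex d hd with hφ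
  set m : (ℤ√d)[X] := X ^ 2 - C (t : ℤ√d) * X + 1 with hm
  have hmonic : m.Monic := by rw [hm]; monicity!
  have hnat : m.natDegree = 2 := by rw [hm]; compute_degree!
  have hα0 : α ≠ 0 := by linarith
  have hroot : ∀ β : ℝ, β + β⁻¹ = t → β ≠ 0 → m.eval₂ φ (β : ℂ) = 0 := fun β hβ hβ0 => by
    have h1 : (t : ℂ) = (β : ℂ) + (β : ℂ)⁻¹ := by exact_mod_cast hβ.symm
    have h2 : (β : ℂ) ≠ 0 := by exact_mod_cast hβ0
    simp only [hm, eval₂_add, eval₂_sub, eval₂_pow, eval₂_X, eval₂_mul, eval₂_C, eval₂_one]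
    rw [map_intCast, h1]
    field_simp
    ring
  obtain ⟨x, y, hxy⟩ : ∃ x y : ℤ√d, F %ₘ m = C y * X + C x := by
    have hdeg : (F %ₘ m).natDegree ≤ 1 := by
      have := natDegree_modByMonic_lt F hmonic (fun h => by rw [h] at hnat; simp at hnat)
      omega
    exact ⟨_, _, eq_X_add_C_of_natDegree_le_one hdeg⟩
  have hval : ∀ β : ℝ, β + β⁻¹ = t → β ≠ 0 → F.eval₂ φ (β : ℂ) = φ y * β + φ x :=
    fun β hβ hβ0 => by
    conv_lhs => rw [← modByMonic_add_div F m]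
    rw [eval₂_add, eval₂_mul, hroot β hβ hβ0, hxy]
    simp
  have ht' : α⁻¹ + α⁻¹⁻¹ = t := by rw [inv_inv, add_comm, ht]
  rw [hval α ht hα0] at hF ⊢
  rw [hval α⁻¹ ht' (inv_ne_zero hα0), ← norm_mul]
  have hprod : (φ y * (α : ℂ) + φ x) * (φ y * ((α⁻¹ : ℝ) : ℂ) + φ x) =
      φ (y ^ 2 + t * (x * y) + x ^ 2) := by
    have h1 : (t : ℂ) = (α : ℂ) + (α : ℂ)⁻¹ := by exact_mod_cast ht.symm
    have h2 : (α : ℂ) ≠ 0 := by exact_mod_cast hα0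
    simp only [map_add, map_mul, map_pow, map_intCast, h1, Complex.ofReal_inv]
    field_simp
    ring
  rw [hprod]
  refine one_le_norm_zsqrtdToComplex d hd fun h0 => ?_
  rw [h0, map_zero, mul_eq_zero] at hprod
  have hzero := hprod.resolve_left hF
  have hirr : Irrational α⁻¹ := (irrational_of_add_inv hα ht).inv
  by_cases hy : y = 0
  · subst hy
    simp only [map_zero, zero_mul, zero_add] at hzero hF
    exact hF hzero
  · have h1 := congrArg Complex.re (congrArg (starRingEnd ℂ (φ y) * ·) hzero)
    have hd' : (d : ℝ) < 0 := by exact_mod_cast hd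
    have hs := Real.mul_self_sqrt (show (0 : ℝ) ≤ -d by linarith)
    simp only [mul_add, Complex.add_re, Complex.mul_re, Complex.conj_re, Complex.conj_im,
      Complex.ofReal_re, Complex.ofReal_im, Complex.mul_im, mul_zero, Complex.zero_re,
      sub_zero, hφ,
      re_zsqrtdToComplex, im_zsqrtdToComplex] at h1
    have h2 : α⁻¹ * (y.norm : ℤ) = ((- (y.re * x.re - d * y.im * x.im) : ℤ) : ℝ) := by
      rw [Zsqrtd.norm_def]
      push_cast
      linear_combination h1 + (-α⁻¹ * y.im ^ 2 - y.im * x.im) * hs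
    have hn : y.norm ≠ 0 := fun h => hy ((Zsqrtd.norm_eq_zero_iff hd y).1 h)
    exact (hirr.mul_intCast hn).ne_int _ h2

/-- Telescoping bound for the difference of two products. -/
lemma norm_prod_sub_prod_le {ι : Type*} (s : Finset ι) (x y : ι → ℂ) {M ε : ℝ} (hM : 0 ≤ M)
    (hε : 0 ≤ ε) (hx : ∀ i ∈ s, ‖x i‖ ≤ M) (hy : ∀ i ∈ s, ‖y i‖ ≤ M)
    (hxy : ∀ i ∈ s, ‖x i - y i‖ ≤ M * ε) :
    ‖∏ i ∈ s, x i - ∏ i ∈ s, y i‖ ≤ s.card * M ^ s.card * ε := by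
  classical
  induction s using Finset.induction_on with
  | empty => simp
  | insert a s ha ih =>
    rw [Finset.prod_insert ha, Finset.prod_insert ha, Finset.card_insert_of_notMem ha]
    have h1 : x a * ∏ i ∈ s, x i - y a * ∏ i ∈ s, y i =
        (x a - y a) * ∏ i ∈ s, x i + y a * (∏ i ∈ s, x i - ∏ i ∈ s, y i) := by ring
    have h2 : ‖∏ i ∈ s, x i‖ ≤ M ^ s.card := by
      rw [norm_prod]
      refine (Finset.prod_le_prod (fun i _ => norm_nonneg _) fun i hi =>
        hx i (Finset.mem_insert_of_mem hi)).trans ?_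
      simp
    have h3 := ih (fun i hi => hx i (Finset.mem_insert_of_mem hi))
      (fun i hi => hy i (Finset.mem_insert_of_mem hi))
      (fun i hi => hxy i (Finset.mem_insert_of_mem hi))
    rw [h1]
    refine (norm_add_le _ _).trans ?_
    rw [norm_mul, norm_mul]
    calc _ ≤ M * ε * M ^ s.card + M * (s.card * M ^ s.card * ε) := by
          gcongr
          · exact hxy a (Finset.mem_insert_self a s)
          · exact hy a (Finset.mem_insert_self a s)
      _ = _ := by push_cast; ring

/-- Determinants of two entrywise close matrices are close. -/
lemma norm_det_sub_det_le {N : ℕ} (P Q : Matrix (Fin N) (Fin N) ℂ) {M ε : ℝ} (hM : 0 ≤ M)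
    (hε : 0 ≤ ε) (hP : ∀ i j, ‖P i j‖ ≤ M) (hQ : ∀ i j, ‖Q i j‖ ≤ M)
    (hPQ : ∀ i j, ‖P i j - Q i j‖ ≤ M * ε) :
    ‖P.det - Q.det‖ ≤ N.factorial * (N * M ^ N * ε) := by
  rw [Matrix.det_apply', Matrix.det_apply', ← Finset.sum_sub_distrib]
  refine (norm_sum_le _ _).trans ((Finset.sum_le_card_nsmul _ _ (N * M ^ N * ε) ?_).trans ?_)
  · intro σ _
    rw [← mul_sub, norm_mul]
    have h1 : ‖((Equiv.Perm.sign σ : ℤ) : ℂ)‖ = 1 := by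
      rcases Int.units_eq_one_or (Equiv.Perm.sign σ) with h | h <;> simp [h]
    rw [h1, one_mul]
    simpa using norm_prod_sub_prod_le Finset.univ (fun i => P (σ i) i) (fun i => Q (σ i) i) hM hε
      (fun i _ => hP _ _) (fun i _ => hQ _ _) (fun i _ => hPQ _ _)
  · simp [Fintype.card_perm]

lemma norm_det_le_factorial {N : ℕ} (P : Matrix (Fin N) (Fin N) ℂ) {M : ℝ}
    (hP : ∀ i j, ‖P i j‖ ≤ M) : ‖P.det‖ ≤ N.factorial * M ^ N := by
  rw [Matrix.det_apply']
  refine (norm_sum_le _ _).trans ((Finset.sum_le_card_nsmul _ _ (M ^ N) ?_).trans ?_)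
  · intro σ _
    rw [norm_mul]
    have h1 : ‖((Equiv.Perm.sign σ : ℤ) : ℂ)‖ = 1 := by
      rcases Int.units_eq_one_or (Equiv.Perm.sign σ) with h | h <;> simp [h]
    rw [h1, one_mul, norm_prod]
    refine (Finset.prod_le_prod (fun i _ => norm_nonneg _) fun i _ => hP (σ i) i).trans ?_
    simp
  · simp [Fintype.card_perm]

end TwoClassesPerGenus

namespace TwoClassesPerGenus

/-- Interpolation determinants: the basic inequality for a linear form in `log α` and `π`. -/
lemma interpolation_inequality (d : ℤ) (hd : d < 0) {α : ℝ} (hα : 1 < α) {t : ℤ}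
    (ht : α + α⁻¹ = t) {A B K L R S : ℕ} (hA : 0 < A)
    (hKL : K * L ≤ R * S) {b ρ : ℝ} (hb : b = B * √(-d : ℝ)) (hb1 : 1 ≤ b) (hρ1 : 1 ≤ ρ)
    (hρ : (R + L : ℕ) + S * (A / b) ≤ ρ) :
    1 ≤ ((K * L).factorial * ((b * ρ) ^ K) ^ (K * L)) *
      ((K * L).factorial * (2 * ((7 * b * ρ) ^ K * exp (7 * L * log α * ρ))) ^ (K * L) *
        (1 / 3) ^ (K * L * (K * L - 1) / 2) +
      (K * L).factorial * ((K * L : ℕ) * ((7 * b * ρ) ^ K * exp (7 * L * log α * ρ)) ^ (K * L) *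
        (L * S * |A * log α - b * π|))) := by
  classical
  set lam := log α with hlam
  have hlam0 : 0 < lam := log_pos hα
  have hα0 : 0 < α := by linarith
  have hexp : exp lam = α := exp_log hα0
  set N := K * L with hN
  let e : Fin N ≃ Fin K × Fin L := finProdFinEquiv.symm
  set φ := zsqrtdToComplex d hd with hφ
  have hsq : 0 < √(-d : ℝ) := by
    have : (d : ℝ) < 0 := by exact_mod_cast hd
    exact Real.sqrt_pos.2 (by linarith)
  have hb0 : 0 < b := by linarith
  have hρ0 : 0 < ρ := by linarith
  set a : ℂ := -(Complex.I * b) with ha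
  have ha0 : a ≠ 0 := by simp [ha, hb0.ne']
  have hna : ‖a‖ = b := by simp [ha, abs_of_pos hb0]
  -- the algebraic matrix
  let ent : Fin N → Fin (R + L) × Fin S → Polynomial (ℤ√d) := fun j q =>
    Polynomial.C ((⟨A * (q.2 : ℕ), -((q.1 : ℕ) * B)⟩ : ℤ√d) ^ ((e j).1 : ℕ)) *
      (Polynomial.X ^ (q.1 : ℕ) * (-1) ^ (q.2 : ℕ)) ^ ((e j).2 : ℕ)
  have hφx : ∀ r s : ℕ, φ (⟨A * s, -(r * B)⟩ : ℤ√d) = r * a + s * (A : ℂ) := fun r s => by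
    rw [hφ, zsqrtdToComplex_apply, ha, hb]
    push_cast
    ring
  have hent : ∀ j q (β : ℂ), (ent j q).eval₂ φ β =
      ((q.1 : ℕ) * a + (q.2 : ℕ) * (A : ℂ)) ^ ((e j).1 : ℕ) *
        (β ^ (q.1 : ℕ) * (-1) ^ (q.2 : ℕ)) ^ ((e j).2 : ℕ) := fun j q β => by
    simp only [ent, Polynomial.eval₂_mul, Polynomial.eval₂_C, Polynomial.eval₂_pow,
      Polynomial.eval₂_X, Polynomial.eval₂_neg, Polynomial.eval₂_one, map_pow, hφx]
  have hαc : (α : ℂ) ≠ 0 := by exact_mod_cast hα0.ne'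
  obtain ⟨c, hc⟩ := exists_minor_ne_zero
    (Matrix.of fun (j : Fin N) q => (ent j q).eval₂ φ (α : ℂ)) (fun v hv => by
      have h0 := zero_estimate (K := K) (L := L) (R := R) (S := S)
        (fun i l => v (e.symm (i, l))) a A α hαc (fun m n h => by
          have h' : (α : ℂ) ^ m = (α : ℂ) ^ n := h
          exact pow_right_injective₀ hα0 hα.ne' (by exact_mod_cast h')) (by
          intro r r' s s' h
          have him := congrArg Complex.im h
          have hre := congrArg Complex.re h
          simp [ha, hb0.ne', hA.ne'] at him hre
          exact ⟨him, hre⟩) hKL (fun r hr s hs => by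
          have h1 := congrFun hv (⟨r, hr⟩, ⟨s, hs⟩)
          simp only [Matrix.vecMul, dotProduct, Matrix.of_apply, hent, Pi.zero_apply] at h1
          rw [← e.symm.sum_comp, Fintype.sum_prod_type] at h1
          simpa using h1)
      funext j
      have := congrFun (congrFun h0 (e j).1) (e j).2
      simpa using this)
  let Fm : Matrix (Fin N) (Fin N) (Polynomial (ℤ√d)) := Matrix.of fun j j' => ent j (c j')
  have hdet : ∀ β : ℂ, Fm.det.eval₂ φ β =
      (Matrix.of fun j j' => (ent j (c j')).eval₂ φ β : Matrix (Fin N) (Fin N) ℂ).det :=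
    fun β => by
    rw [← Polynomial.coe_eval₂RingHom, RingHom.map_det]
    rfl
  have hliou := one_le_norm_mul_norm_conj d hd hα ht Fm.det (by rw [hdet]; exact hc)
  rw [hdet, hdet, mul_comm] at hliou
  -- sizes of the points
  let pt : Fin (R + L) × Fin S → ℂ := fun q => (q.1 : ℕ) + (q.2 : ℕ) * (Complex.I * (A / b : ℝ))
  have hpt : ∀ q, ‖pt q‖ ≤ ρ := fun q => by
    refine le_trans ((norm_add_le _ _).trans ?_) hρ
    rw [norm_mul, norm_mul, Complex.norm_natCast, Complex.norm_natCast, Complex.norm_I, one_mul,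
      Complex.norm_real, Real.norm_of_nonneg (by positivity)]
    have h1 : ((q.1 : ℕ) : ℝ) ≤ (R + L : ℕ) := by exact_mod_cast q.1.2.le
    have h2 : ((q.2 : ℕ) : ℝ) ≤ S := by exact_mod_cast q.2.2.le
    gcongr
  have hptX : ∀ q : Fin (R + L) × Fin S, ((q.1 : ℕ) * a + (q.2 : ℕ) * (A : ℂ)) = a * pt q :=
    fun q => by
    have hbc : (b : ℂ) ≠ 0 := by exact_mod_cast hb0.ne'
    simp only [pt, ha, Complex.ofReal_div, Complex.ofReal_natCast]
    field_simp
    linear_combination ((q.2 : ℂ) * A) * Complex.I_sq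
  set M := (7 * b * ρ) ^ K * exp (7 * L * lam * ρ) with hM
  have hM0 : 0 ≤ M := by positivity
  have hbρ : 1 ≤ b * ρ := one_le_mul_of_one_le_of_one_le hb1 hρ1
  -- the conjugate determinant
  have hconj : ‖(Matrix.of fun j j' => (ent j (c j')).eval₂ φ ((α⁻¹ : ℝ) : ℂ) :
      Matrix (Fin N) (Fin N) ℂ).det‖ ≤ N.factorial * ((b * ρ) ^ K) ^ N := by
    refine norm_det_le_factorial _ fun j j' => ?_
    simp only [Matrix.of_apply, hent, hptX]
    rw [norm_mul, norm_pow, norm_pow, norm_mul, norm_mul, norm_pow, norm_pow, hna, norm_neg,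
      norm_one, one_pow, mul_one, Complex.norm_real, Real.norm_of_nonneg (by positivity)]
    have h1 : (α⁻¹ ^ ((c j').1 : ℕ)) ^ ((e j).2 : ℕ) ≤ 1 :=
      pow_le_one₀ (by positivity) (pow_le_one₀ (by positivity) (inv_le_one_of_one_le₀ hα.le))
    calc (b * ‖pt (c j')‖) ^ ((e j).1 : ℕ) * (α⁻¹ ^ ((c j').1 : ℕ)) ^ ((e j).2 : ℕ)
        ≤ (b * ρ) ^ ((e j).1 : ℕ) * 1 := by
          gcongr
          exact hpt _
      _ ≤ (b * ρ) ^ K := by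
          rw [mul_one]
          exact pow_le_pow_right₀ hbρ (e j).1.2.le
  -- the analytic determinant
  let f : Fin N → ℂ → ℂ := fun j ζ => (a * ζ) ^ ((e j).1 : ℕ) *
    Complex.exp (((e j).2 : ℕ) * (lam : ℂ) * ζ)
  let z : ℕ → ℂ := fun n => if h : n < N then pt (c ⟨n, h⟩) else 0
  have hz : ∀ j : Fin N, z j = pt (c j) := fun j => by simp [z]
  have hfbound : ∀ (j : Fin N) (ζ : ℂ) (r : ℝ), 1 ≤ b * r → ‖ζ‖ ≤ r →
      ‖f j ζ‖ ≤ (b * r) ^ K * exp (L * lam * r) := fun j ζ r hr hζ => by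
    have hr0 : 0 ≤ r := (norm_nonneg ζ).trans hζ
    simp only [f]
    rw [norm_mul, norm_pow, norm_mul, hna]
    have h1 : (b * ‖ζ‖) ^ ((e j).1 : ℕ) ≤ (b * r) ^ K :=
      (pow_le_pow_left₀ (by positivity) (by gcongr) _).trans
        (pow_le_pow_right₀ hr (e j).1.2.le)
    have h2 : ‖Complex.exp (((e j).2 : ℕ) * (lam : ℂ) * ζ)‖ ≤ exp (L * lam * r) := by
      refine (Complex.norm_exp_le_exp_norm _).trans (exp_le_exp.2 ?_)
      rw [norm_mul, norm_mul, Complex.norm_natCast, Complex.norm_real,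
        Real.norm_of_nonneg hlam0.le]
      have : (((e j).2 : ℕ) : ℝ) ≤ L := by exact_mod_cast (e j).2.2.le
      gcongr
    gcongr
  have han : ‖(Matrix.of fun j j' : Fin N => f j (z j')).det‖ ≤
      N.factorial * (2 * M) ^ N * (1 / 3) ^ (N * (N - 1) / 2) := by
    refine norm_det_interpolation_le f (fun j => by fun_prop) z hρ0 (fun n => ?_) hM0
      fun j ζ hζ => ?_
    · by_cases h : n < N
      · simp only [z, h, dif_pos]; exact hpt _
      · simp only [z, h, dif_neg, not_false_iff, norm_zero]; exact hρ0.le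
    · refine (hfbound j ζ (7 * ρ) (by nlinarith) hζ.le).trans (le_of_eq ?_)
      rw [hM]
      ring_nf
  -- comparison
  set Λ := A * lam - b * π with hΛ
  have hM1 : (b * ρ) ^ K * exp (L * lam * ρ) ≤ M := by
    rw [hM]
    have : 0 ≤ L * lam * ρ := by positivity
    gcongr <;> nlinarith
  have hfz : ∀ j j' : Fin N, f j (z j') = (ent j (c j')).eval₂ φ (α : ℂ) *
      Complex.exp (Complex.I * ((((e j).2 : ℕ) * ((c j').2 : ℕ) * (Λ / b) : ℝ) : ℂ)) :=
    fun j j' => by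
    have h0 : (α : ℂ) = Complex.exp (lam : ℂ) := by rw [← hexp, Complex.ofReal_exp]
    have h1 : (-1 : ℂ) = Complex.exp (π * Complex.I) := Complex.exp_pi_mul_I.symm
    rw [hent, hz, hptX]
    simp only [f]
    rw [h1, h0, ← Complex.exp_nat_mul, ← Complex.exp_nat_mul, ← Complex.exp_add,
      ← Complex.exp_nat_mul, mul_assoc ((a * pt (c j')) ^ ((e j).1 : ℕ)), ← Complex.exp_add]
    congr 2
    have hbc : (b : ℂ) ≠ 0 := by exact_mod_cast hb0.ne'
    simp only [pt, hΛ]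
    push_cast
    field_simp
    ring
  have hnorm1 : ∀ j j' : Fin N, ‖f j (z j')‖ = ‖(ent j (c j')).eval₂ φ (α : ℂ)‖ := fun j j' => by
    rw [hfz, norm_mul, mul_comm Complex.I, Complex.norm_exp_ofReal_mul_I, mul_one]
  have hfM : ∀ j j' : Fin N, ‖f j (z j')‖ ≤ M := fun j j' => by
    rw [hz]
    exact (hfbound j _ ρ hbρ (hpt _)).trans hM1
  have hcomp : ‖(Matrix.of fun j j' => (ent j (c j')).eval₂ φ (α : ℂ) :
      Matrix (Fin N) (Fin N) ℂ).det - (Matrix.of fun j j' : Fin N => f j (z j')).det‖ ≤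
      N.factorial * (N * M ^ N * (L * S * |Λ|)) := by
    refine norm_det_sub_det_le _ _ hM0 (by positivity) (fun j j' => ?_) (fun j j' => hfM j j')
      fun j j' => ?_
    · rw [Matrix.of_apply, ← hnorm1]; exact hfM j j'
    · simp only [Matrix.of_apply]
      set E := Complex.I * ((((e j).2 : ℕ) * ((c j').2 : ℕ) * (Λ / b) : ℝ) : ℂ) with hE
      have h1 : (ent j (c j')).eval₂ φ (α : ℂ) - f j (z j') =
          -((ent j (c j')).eval₂ φ (α : ℂ) * (Complex.exp E - 1)) := by
        rw [hfz]; ring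
      rw [h1, norm_neg, norm_mul, ← hnorm1]
      have h2 : ‖Complex.exp E - 1‖ ≤ L * S * |Λ| := by
        rw [hE]
        refine (Real.norm_exp_I_mul_ofReal_sub_one_le).trans ?_
        rw [Real.norm_eq_abs, abs_mul, abs_mul, abs_div, Nat.abs_cast, Nat.abs_cast,
          abs_of_pos hb0]
        have h3 : (((e j).2 : ℕ) : ℝ) ≤ L := by exact_mod_cast (e j).2.2.le
        have h4 : (((c j').2 : ℕ) : ℝ) ≤ S := by exact_mod_cast (c j').2.2.le
        have h5 : |Λ| / b ≤ |Λ| := div_le_self (abs_nonneg _) hb1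
        gcongr
      exact mul_le_mul (hfM j j') h2 (norm_nonneg _) hM0
  refine hliou.trans (mul_le_mul hconj ?_ (norm_nonneg _) (by positivity))
  calc _ = ‖(Matrix.of fun j j' : Fin N => f j (z j')).det +
        ((Matrix.of fun j j' => (ent j (c j')).eval₂ φ (α : ℂ) :
        Matrix (Fin N) (Fin N) ℂ).det - (Matrix.of fun j j' : Fin N => f j (z j')).det)‖ := by
        congr 1; ring
    _ ≤ _ := (norm_add_le _ _).trans (add_le_add han hcomp)

end TwoClassesPerGenus

namespace TwoClassesPerGenus

lemma log_three_gt : 1.09 < log 3 := by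
  have h : log (2 ^ 19) ≤ log (3 ^ 12) := log_le_log (by norm_num) (by norm_num)
  rw [log_pow, log_pow] at h
  have := log_two_gt_d9
  push_cast at h
  linarith

lemma log_three_lt : log 3 < 1.1 := by
  have h : log (3 ^ 29) ≤ log (2 ^ 46) := log_le_log (by norm_num) (by norm_num)
  rw [log_pow, log_pow] at h
  have := log_two_lt_d9
  push_cast at h
  linarith

lemma log_two_pow_mul_le {n : ℝ} (hn : 100 ≤ n) (k : ℕ) (c : ℝ) (hc0 : 0 < c) (hc : c ≤ 2 ^ k) :
    log (c * n) ≤ k * 0.6932 + 3.853 + n / 100 := by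
  have h1 : log c ≤ k * 0.6932 := by
    refine (log_le_log hc0 hc).trans ?_
    rw [log_pow]
    have := log_two_lt_d9
    gcongr
    linarith
  have h2 : log n ≤ 3.853 + n / 100 := by
    have h3 : log (n / 128) ≤ n / 128 - 1 := log_le_sub_one_of_pos (by positivity)
    rw [log_div (by positivity) (by norm_num), show (128 : ℝ) = 2 ^ 7 by norm_num, log_pow] at h3
    have := log_two_lt_d9
    push_cast at h3
    linarith
  rw [log_mul (by positivity) (by positivity)]
  linarith

/-- Final step of the method of interpolation determinants. -/
lemma lower_bound_of_interpolation {N : ℕ} (hN : 10 ≤ N) {M M' ε Λ : ℝ} (hM : 0 ≤ M) (hM' : 0 ≤ M')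
    (hΛ : 0 ≤ Λ) (hε : ε ≤ N)
    (hX : (4 * N ^ 2 * (M * M')) ^ 2 ≤ 3 ^ (N - 1))
    (h : 1 ≤ (N.factorial * M' ^ N) * (N.factorial * (2 * M) ^ N * (1 / 3) ^ (N * (N - 1) / 2) +
      N.factorial * (N * M ^ N * (ε * Λ)))) :
    1 ≤ 3 ^ (N * (N - 1) / 2) * Λ := by
  set X := 4 * N ^ 2 * (M * M') with hXdef
  have hX0 : 0 ≤ X := by positivity
  set H := N * (N - 1) / 2 with hH
  have hHH : H * 2 = N * (N - 1) := Nat.div_mul_cancel (Nat.even_mul_pred_self N).two_dvd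
  have hXN : X ^ N ≤ 3 ^ H := by
    refine (pow_le_pow_iff_left₀ (by positivity) (by positivity) two_ne_zero).1 ?_
    calc (X ^ N) ^ 2 = (X ^ 2) ^ N := pow_right_comm _ _ _
      _ ≤ (3 ^ (N - 1)) ^ N := by gcongr
      _ = (3 ^ H) ^ 2 := by rw [← pow_mul, ← pow_mul, hHH, mul_comm]
  have hfac : (N.factorial : ℝ) ≤ N ^ N := by exact_mod_cast Nat.factorial_le_pow N
  have hN0 : (0 : ℝ) ≤ N := by positivity
  have hfac2 : (N.factorial : ℝ) * N.factorial * (M * M') ^ N * 4 ^ N ≤ X ^ N := by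
    calc (N.factorial : ℝ) * N.factorial * (M * M') ^ N * 4 ^ N
        ≤ N ^ N * N ^ N * (M * M') ^ N * 4 ^ N := by gcongr
      _ = X ^ N := by rw [hXdef, sq]; simp only [mul_pow]; ring
  set Y := (N.factorial : ℝ) * N.factorial * (M * M') ^ N with hY
  have hY0 : 0 ≤ Y := by positivity
  have h2N : (2 : ℝ) ^ 1 ≤ 2 ^ N := pow_le_pow_right₀ (by norm_num) (by omega)
  have hN2 : (2 : ℝ) * N ^ 2 ≤ 4 ^ N := by
    have h1 : (N : ℝ) < 2 ^ N := by exact_mod_cast Nat.lt_two_pow_self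
    have h2 : N * 2 ≤ 2 ^ N := by
      obtain ⟨m, rfl⟩ := Nat.exists_eq_add_of_le' (show 1 ≤ N by omega)
      rw [pow_succ]
      exact Nat.mul_le_mul_right _ Nat.lt_two_pow_self
    have h2' : (N : ℝ) * 2 ≤ 2 ^ N := by exact_mod_cast h2
    have h4 : (4 : ℝ) ^ N = 2 ^ N * 2 ^ N := by rw [← mul_pow]; norm_num
    rw [h4]
    nlinarith
  have hfirst : Y * 2 ^ N * (1 / 3) ^ H ≤ 1 / 2 := by
    have h3H : (0 : ℝ) < 3 ^ H := by positivity
    rw [one_div_pow, mul_one_div, div_le_iff₀ h3H]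
    have h4 : (4 : ℝ) ^ N = 2 ^ N * 2 ^ N := by rw [← mul_pow]; norm_num
    have h5 : Y * 2 ^ N * 2 ≤ Y * 4 ^ N := by
      rw [h4, ← mul_assoc]
      have : 0 ≤ Y * 2 ^ N := by positivity
      nlinarith
    linarith
  have hsecond : Y * (N * (ε * Λ)) ≤ 3 ^ H * Λ / 2 := by
    calc Y * (N * (ε * Λ)) ≤ Y * (N * (N * Λ)) := by gcongr
      _ = Y * (2 * N ^ 2) * Λ / 2 := by ring
      _ ≤ Y * 4 ^ N * Λ / 2 := by gcongr
      _ ≤ 3 ^ H * Λ / 2 := by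
        have := hfac2.trans hXN
        gcongr
  have hsplit : (N.factorial * M' ^ N) * (N.factorial * (2 * M) ^ N * (1 / 3) ^ H +
      N.factorial * (N * M ^ N * (ε * Λ))) = Y * 2 ^ N * (1 / 3) ^ H + Y * (N * (ε * Λ)) := by
    rw [hY, mul_pow, mul_pow]; ring
  rw [hsplit] at h
  linarith

/-- The analytic estimate for the chosen parameters. -/
lemma interpolation_size {n N K L : ℕ} {b lam ρ : ℝ} (hn : 100 ≤ n) (hb1 : 1 ≤ b)
    (hbn : log b ≤ 2 * n) (hlam : lam ≤ 6) (hN : N = K * L) (hK : K = 512000 * L)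
    (hL : L = 16 * n) (hρ : ρ = 3201 * L) :
    (4 * (N : ℝ) ^ 2 * ((7 * b * ρ) ^ K * exp (7 * L * lam * ρ) * (b * ρ) ^ K)) ^ 2 ≤
      3 ^ (N - 1) := by
  have hn' : (100 : ℝ) ≤ n := by exact_mod_cast hn
  have hn0 : (0 : ℝ) < n := by linarith
  have hn2 : 100 * (n : ℝ) ≤ n ^ 2 := by rw [sq]; gcongr
  have hb0 : 0 < b := by linarith
  have hNval : (N : ℝ) = 131072000 * n ^ 2 := by
    rw [hN, hK, hL]; push_cast; ring
  have hLr : (L : ℝ) = 16 * n := by rw [hL]; push_cast; ring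
  have hρ0 : 0 < ρ := by rw [hρ, hLr]; positivity
  have hNpos : (0 : ℝ) < N := by rw [hNval]; positivity
  rw [← log_le_log_iff (by positivity) (by positivity), log_pow, log_pow]
  have hN1 : 1 ≤ N := by exact_mod_cast hNpos
  rw [Nat.cast_sub hN1, log_mul (by positivity) (by positivity), log_mul (by positivity)
    (by positivity), log_pow, log_mul (by positivity) (by positivity),
    log_mul (by positivity) (by positivity), log_exp, log_pow, log_pow,
    mul_assoc 7 b ρ, log_mul (x := 7) (by norm_num) (by positivity),
    log_mul (x := b) (by positivity) (by positivity)]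
  have hlogρ : log ρ ≤ 0.16 * n := by
    have := log_two_pow_mul_le hn' 16 51216 (by norm_num) (by norm_num)
    have h2 : ρ = 51216 * n := by rw [hρ, hLr]; ring
    rw [h2]
    push_cast at this
    linarith
  have hlogN : log N ≤ 3 * n := by
    have h1 := log_two_pow_mul_le hn' 27 131072000 (by norm_num) (by norm_num)
    have h2 := log_two_pow_mul_le hn' 0 1 (by norm_num) (by norm_num)
    rw [one_mul] at h2
    have h3 : (N : ℝ) = (131072000 * n) * n := by rw [hNval]; ring
    rw [h3, log_mul (by positivity) (by positivity)]
    push_cast at h1 h2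
    linarith
  have hlog7 : log 7 ≤ 0.021 * n := by
    have h1 : log 7 ≤ log (2 ^ 3) := log_le_log (by norm_num) (by norm_num)
    rw [log_pow] at h1
    have := log_two_lt_d9
    push_cast at h1
    linarith
  have hlog4 : log 4 ≤ n := by
    have := log_le_sub_one_of_pos (show (0 : ℝ) < 4 by norm_num)
    linarith
  have hl3 := log_three_gt
  have hKr : (K : ℝ) = 8192000 * n := by rw [hK, hL]; push_cast; ring
  have hT : 7 * (L : ℝ) * lam * ρ ≤ 7 * L * 6 * ρ := by gcongr
  have hT2 : 7 * (L : ℝ) * 6 * ρ = 34417152 * n ^ 2 := by rw [hρ, hLr]; ring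
  have hK1 : (K : ℝ) * (log 7 + (log b + log ρ)) ≤ 8192000 * n * (2.181 * n) := by
    rw [hKr]; gcongr; linarith
  have hK2 : (K : ℝ) * (log b + log ρ) ≤ 8192000 * n * (2.16 * n) := by
    rw [hKr]; gcongr; linarith
  have hR : (131072000 * (n : ℝ) ^ 2 - 1) * 1.09 ≤ (N - (1 : ℕ)) * log 3 := by
    rw [hNval]
    push_cast
    have : 0 ≤ 131072000 * (n : ℝ) ^ 2 - 1 := by linarith
    gcongr
  refine le_trans ?_ hR
  push_cast
  rw [hT2] at hT
  have e1 : 8192000 * (n : ℝ) * (2.181 * n) = 17866752 * n ^ 2 := by ring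
  have e2 : 8192000 * (n : ℝ) * (2.16 * n) = 17694720 * n ^ 2 := by ring
  rw [e1] at hK1
  rw [e2] at hK2
  linarith

/-- Lower bound for a linear form in `log α` and `π`, `α` a real quadratic unit. -/
theorem linear_form_lower_bound (d : ℤ) (hd : d < 0) {α : ℝ} (hα : 1 < α) {t : ℤ}
    (ht : α + α⁻¹ = t) (hlog : log α ≤ 6) {A B n : ℕ} (hA : 0 < A) {b : ℝ}
    (hb : b = B * √(-d : ℝ)) (hb1 : 1 ≤ b) (hn : 100 ≤ n) (hbn : log b ≤ 2 * n) :
    exp (-(10 ^ 16 * (n : ℝ) ^ 4)) ≤ |A * log α - b * π| := by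
  by_contra! hcon
  have hn' : (100 : ℝ) ≤ n := by exact_mod_cast hn
  have hn0 : (0 : ℝ) < n := by linarith
  have hb0 : 0 < b := by linarith
  have hsmall : |A * log α - b * π| < 1 := hcon.trans_le (exp_le_one_iff.2 (by
    have : 0 ≤ (10 : ℝ) ^ 16 * (n : ℝ) ^ 4 := by positivity
    linarith))
  have hα25 : 2.5 ≤ α := by
    by_contra! h
    have h1 : α + α⁻¹ < 3 := by
      have h3 : α * α⁻¹ = 1 := mul_inv_cancel₀ (by linarith)
      have h4 : 0 < α⁻¹ := by positivity
      nlinarith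
    have h2 : 2 < α + α⁻¹ := by
      have h3 : α * α⁻¹ = 1 := mul_inv_cancel₀ (by linarith)
      have h4 : 0 < α⁻¹ := by positivity
      nlinarith [sq_nonneg (α - 1), mul_pos h4 (mul_pos (sub_pos.2 hα) (sub_pos.2 hα))]
    rw [ht] at h1 h2
    have h5 : t < 3 := by exact_mod_cast h1
    have h6 : 2 < t := by exact_mod_cast h2
    omega
  have hlogα : 0.85 ≤ log α := by
    have h1 : log 2.5 ≤ log α := log_le_log (by norm_num) hα25
    have h2 : log (2.5 : ℝ) = log 2 + log 1.25 := by rw [← log_mul] <;> norm_num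
    have h3 := one_sub_inv_le_log_of_pos (show (0 : ℝ) < 1.25 by norm_num)
    have := log_two_gt_d9
    norm_num at h3
    linarith
  have hAb : A / b ≤ 5 := by
    rw [div_le_iff₀ hb0]
    have h1 := (abs_lt.1 hsmall).2
    have h2 := pi_lt_d2
    have h3 : (0 : ℝ) ≤ A := by positivity
    nlinarith
  set L : ℕ := 16 * n with hL
  set K : ℕ := 512000 * L with hK
  set N : ℕ := K * L with hN
  have hNval : (N : ℝ) = 131072000 * n ^ 2 := by
    rw [hN, hK, hL]; push_cast; ring
  have hLr : (L : ℝ) = 16 * n := by rw [hL]; push_cast; ring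
  set ρ : ℝ := 3201 * L with hρ
  have hρ1 : 1 ≤ ρ := by rw [hρ, hLr]; linarith
  have hineq := interpolation_inequality d hd hα ht (A := A) (B := B) (K := K) (L := L)
    (R := 5 * (320 * L)) (S := 320 * L) hA (by rw [hK]; ring_nf; exact le_refl _) hb hb1 hρ1 (by
      push_cast
      have h1 : (320 * (L : ℝ)) * (A / b) ≤ 320 * L * 5 := by gcongr
      rw [hρ]
      linarith)
  set M := (7 * b * ρ) ^ K * exp (7 * L * log α * ρ) with hM
  set M' := (b * ρ) ^ K with hM'
  have hX := interpolation_size hn hb1 hbn hlog hN hK hL hρ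
  have hNbig : 10 ≤ N := by
    have : (10 : ℝ) ≤ N := by rw [hNval]; nlinarith
    exact_mod_cast this
  have hfin := lower_bound_of_interpolation hNbig (M := M) (M' := M')
    (ε := L * (320 * L : ℕ)) (Λ := |A * log α - b * π|) (by positivity) (by positivity)
    (abs_nonneg _) (by rw [hNval, hL]; push_cast; nlinarith) hX hineq
  have h3 : (3 : ℝ) ^ (N * (N - 1) / 2) ≤ exp (10 ^ 16 * (n : ℝ) ^ 4) := by
    rw [← log_le_iff_le_exp (by positivity), log_pow]
    have h1 : ((N * (N - 1) / 2 : ℕ) : ℝ) ≤ N * N / 2 := by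
      refine Nat.cast_div_le.trans ?_
      push_cast
      gcongr
      exact Nat.sub_le _ _
    calc ((N * (N - 1) / 2 : ℕ) : ℝ) * log 3 ≤ N * N / 2 * 1.1 := by
          gcongr
          exact log_three_lt.le
      _ ≤ 10 ^ 16 * (n : ℝ) ^ 4 := by
        rw [hNval]
        have : (0 : ℝ) ≤ (n : ℝ) ^ 4 := by positivity
        nlinarith
  have h4 : 3 ^ (N * (N - 1) / 2) * |A * log α - b * π| < 1 := by
    calc 3 ^ (N * (N - 1) / 2) * |A * log α - b * π|
        ≤ exp (10 ^ 16 * (n : ℝ) ^ 4) * |A * log α - b * π| := by gcongr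
      _ < exp (10 ^ 16 * (n : ℝ) ^ 4) * exp (-(10 ^ 16 * (n : ℝ) ^ 4)) := by
        gcongr
      _ = 1 := by rw [← exp_add, add_neg_cancel, exp_zero]
  linarith

end TwoClassesPerGenus

namespace TwoClassesPerGenus

open MeasureTheory Filter Topology

lemma summable_int_sq_add_one_rpow {s : ℝ} (hs : 1 / 2 < s) :
    Summable fun n : ℤ => ((n : ℝ) ^ 2 + 1) ^ (-s) := by
  have h := ((Real.summable_one_div_int_add_rpow (1 / 2) (2 * s)).2 (by linarith)).mul_left (2 ^ s)
  refine h.of_nonneg_of_le (fun n => by positivity) fun n => ?_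
  have h0 : (0 : ℝ) < |(n : ℝ) + 1 / 2| := by
    rw [abs_pos]
    intro h
    have h2 : ((2 * n + 1 : ℤ) : ℝ) = 0 := by push_cast; linarith
    have h3 : 2 * n + 1 = 0 := by exact_mod_cast h2
    omega
  have h1 : |(n : ℝ) + 1 / 2| ^ 2 / 2 ≤ (n : ℝ) ^ 2 + 1 := by
    rw [sq_abs]
    nlinarith [sq_nonneg ((n : ℝ) - 1 / 2)]
  calc ((n : ℝ) ^ 2 + 1) ^ (-s) ≤ (|(n : ℝ) + 1 / 2| ^ 2 / 2) ^ (-s) :=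
        rpow_le_rpow_of_nonpos (by positivity) h1 (by linarith)
    _ = 2 ^ s * (1 / |(n : ℝ) + 1 / 2| ^ (2 * s)) := by
        rw [div_rpow (by positivity) (by norm_num), ← rpow_natCast, ← rpow_mul (by positivity),
          rpow_neg (by norm_num : (0 : ℝ) ≤ 2)]
        push_cast
        rw [mul_neg, rpow_neg (by positivity)]
        field_simp

/-- The kernel `(x² + τ²)^(-s)`. -/
noncomputable def kern (s τ x : ℝ) : ℝ := (x ^ 2 + τ ^ 2) ^ (-s)

lemma kern_nonneg (s τ x : ℝ) : 0 ≤ kern s τ x := by unfold kern; positivity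

lemma hasDerivAt_kern {s τ : ℝ} (hτ : 1 ≤ τ) (x : ℝ) :
    HasDerivAt (kern s τ) (2 * x * (-s) * (x ^ 2 + τ ^ 2) ^ (-s - 1)) x := by
  have h : HasDerivAt (fun x : ℝ => x ^ 2 + τ ^ 2) (2 * x) x := by
    simpa using (hasDerivAt_pow 2 x).add_const (τ ^ 2)
  exact h.rpow_const (Or.inl (by positivity))

lemma continuous_kern {s τ : ℝ} (hτ : 1 ≤ τ) : Continuous (kern s τ) :=
  continuous_iff_continuousAt.2 fun x => (hasDerivAt_kern hτ x).continuousAt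

lemma sq_add_one_le_of_abs_le {n : ℤ} {x τ : ℝ} (hτ : 1 ≤ τ) (hx : |x| ≤ 2) :
    ((n : ℝ) ^ 2 + 1) ≤ 9 * ((n + x) ^ 2 + τ ^ 2) := by
  have := abs_le.1 hx
  nlinarith [sq_nonneg ((n : ℝ) + 2 * x), sq_nonneg (n + x),
    mul_nonneg (sub_nonneg.2 this.2) (by linarith : 0 ≤ x + 2)]

lemma kern_le {s τ : ℝ} (hs : 1 ≤ s) (hτ : 1 ≤ τ) (x : ℝ) : kern s τ x ≤ kern 1 τ x := by
  unfold kern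
  exact rpow_le_rpow_of_exponent_le (by nlinarith) (by linarith)

lemma kern_int_le {τ x : ℝ} (hτ : 1 ≤ τ) (hx : |x| ≤ 2) (n : ℤ) :
    kern 1 τ (n + x) ≤ 9 * ((n : ℝ) ^ 2 + 1) ^ (-1 : ℝ) := by
  have h := sq_add_one_le_of_abs_le (n := n) hτ hx
  unfold kern
  rw [rpow_neg_one, rpow_neg_one, ← div_eq_mul_inv, le_div_iff₀ (by positivity),
    inv_mul_le_iff₀ (by positivity)]
  linarith

lemma summable_kern {s τ : ℝ} (hs : 1 ≤ s) (hτ : 1 ≤ τ) (β : ℝ) :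
    Summable fun n : ℤ => kern s τ (n + β) := by
  have h1 : Summable fun n : ℤ => kern s τ (n + Int.fract β) := by
    refine ((summable_int_sq_add_one_rpow (s := 1) (by norm_num)).mul_left 9).of_nonneg_of_le
      (fun n => kern_nonneg _ _ _) fun n => (kern_le hs hτ _).trans (kern_int_le hτ ?_ n)
    rw [abs_of_nonneg (Int.fract_nonneg β)]
    linarith [Int.fract_lt_one β]
  have h2 := (Equiv.addRight ⌊β⌋).summable_iff.2 h1
  refine h2.congr fun n => ?_
  simp only [Function.comp, Equiv.coe_addRight]
  congr 1
  push_cast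
  linarith [Int.floor_add_fract β]

lemma integrable_kern {s τ : ℝ} (hs : 1 ≤ s) (hτ : 1 ≤ τ) : Integrable (kern s τ) := by
  refine (integrable_inv_one_add_sq).mono' (continuous_kern hτ).aestronglyMeasurable
    (Eventually.of_forall fun x => ?_)
  rw [Real.norm_of_nonneg (kern_nonneg _ _ _)]
  refine (kern_le hs hτ x).trans ?_
  unfold kern
  rw [rpow_neg_one]
  refine inv_anti₀ (by positivity) ?_
  nlinarith

/-- Difference between the sum of the kernel over a translate of `ℤ` and its integral. -/
noncomputable def kernErr (s β τ : ℝ) : ℝ := ∑' n : ℤ, kern s τ (n + β) - ∫ x, kern s τ x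

lemma kernErr_add_int (s β τ : ℝ) (m : ℤ) : kernErr s (β + m) τ = kernErr s β τ := by
  unfold kernErr
  congr 1
  rw [← (Equiv.addRight m).tsum_eq fun n : ℤ => kern s τ (n + β)]
  refine tsum_congr fun n => ?_
  simp only [Equiv.coe_addRight]
  congr 1
  push_cast
  ring

lemma abs_kern_sub_kern_le {s τ : ℝ} (hs : 1 ≤ s) (hs2 : s ≤ 2) (hτ : 1 ≤ τ) {β t : ℝ}
    (hβ0 : 0 ≤ β) (hβ1 : β ≤ 1) (ht0 : 0 ≤ t) (ht1 : t ≤ 1) (n : ℤ) :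
    |kern s τ (n + β) - kern s τ (t + n + β)| ≤
      4 * (9 ^ (3 / 4 : ℝ) * ((n : ℝ) ^ 2 + 1) ^ (-(3 / 4) : ℝ) * τ ^ (-(3 / 2) : ℝ)) := by
  have hbound : ∀ ξ ∈ Set.Icc (n + β) (n + β + 1),
      ‖2 * ξ * (-s) * (ξ ^ 2 + τ ^ 2) ^ (-s - 1)‖ ≤
        4 * (9 ^ (3 / 4 : ℝ) * ((n : ℝ) ^ 2 + 1) ^ (-(3 / 4) : ℝ) * τ ^ (-(3 / 2) : ℝ)) := by
    intro ξ hξ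
    have hw1 : 1 ≤ ξ ^ 2 + τ ^ 2 := by nlinarith
    have hw0 : 0 < ξ ^ 2 + τ ^ 2 := by linarith
    have h1 : |ξ| ≤ (ξ ^ 2 + τ ^ 2) ^ (1 / 2 : ℝ) := by
      rw [← sqrt_eq_rpow]
      exact abs_le_sqrt (by nlinarith)
    rw [norm_mul, norm_mul, norm_mul, norm_neg, Real.norm_of_nonneg (by positivity),
      Real.norm_of_nonneg (by linarith : 0 ≤ s), Real.norm_eq_abs,
      Real.norm_of_nonneg (by positivity)]
    calc 2 * |ξ| * s * (ξ ^ 2 + τ ^ 2) ^ (-s - 1)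
        ≤ 2 * (ξ ^ 2 + τ ^ 2) ^ (1 / 2 : ℝ) * 2 * (ξ ^ 2 + τ ^ 2) ^ (-1 - 1 : ℝ) := by
          gcongr
      _ = 4 * (ξ ^ 2 + τ ^ 2) ^ (-(3 / 2) : ℝ) := by
          rw [show (-(3 / 2) : ℝ) = 1 / 2 + (-1 - 1) by norm_num, rpow_add hw0]
          ring
      _ ≤ _ := by
          gcongr
          rw [show (-(3 / 2) : ℝ) = -(3 / 4) + -(3 / 4) by norm_num, rpow_add hw0]
          have h2 : ((n : ℝ) ^ 2 + 1) / 9 ≤ ξ ^ 2 + τ ^ 2 := by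
            have := sq_add_one_le_of_abs_le (n := n) (x := ξ - n) hτ
              (abs_le.2 ⟨by linarith [hξ.1], by linarith [hξ.2]⟩)
            rw [add_sub_cancel] at this
            linarith
          have h3 : (ξ ^ 2 + τ ^ 2) ^ (-(3 / 4) : ℝ) ≤ (((n : ℝ) ^ 2 + 1) / 9) ^ (-(3 / 4) : ℝ) :=
            rpow_le_rpow_of_nonpos (by positivity) h2 (by norm_num)
          have h4 : (ξ ^ 2 + τ ^ 2) ^ (-(3 / 4) : ℝ) ≤ (τ ^ 2) ^ (-(3 / 4) : ℝ) :=
            rpow_le_rpow_of_nonpos (by positivity) (by nlinarith) (by norm_num)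
          have h5 : (((n : ℝ) ^ 2 + 1) / 9) ^ (-(3 / 4) : ℝ) =
              9 ^ (3 / 4 : ℝ) * ((n : ℝ) ^ 2 + 1) ^ (-(3 / 4) : ℝ) := by
            rw [div_rpow (by positivity) (by norm_num), rpow_neg (by norm_num : (0 : ℝ) ≤ 9),
              div_inv_eq_mul, mul_comm]
          have h6 : (τ ^ 2) ^ (-(3 / 4) : ℝ) = τ ^ (-(3 / 4) + -(3 / 4) : ℝ) := by
            rw [← rpow_natCast, ← rpow_mul (by positivity)]
            norm_num
          rw [h5] at h3
          rw [h6] at h4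
          exact mul_le_mul h3 h4 (by positivity) (by positivity)
  have := (convex_Icc (n + β) (n + β + 1)).norm_image_sub_le_of_norm_hasDerivWithin_le
    (f := kern s τ) (fun ξ _ => (hasDerivAt_kern hτ ξ).hasDerivWithinAt) hbound
    (x := t + n + β) (y := n + β) ⟨by linarith, by linarith⟩ ⟨le_refl _, by linarith⟩
  rw [Real.norm_eq_abs] at this
  refine this.trans ?_
  have h7 : ‖(n + β : ℝ) - (t + n + β)‖ ≤ 1 := by
    rw [Real.norm_eq_abs, abs_le]
    constructor <;> linarith
  exact mul_le_of_le_one_right (by positivity) h7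

/-- Uniform bound for the difference of sum and integral. -/
lemma exists_abs_kernErr_le : ∃ C : ℝ, 0 ≤ C ∧ ∀ s β τ : ℝ, 1 ≤ s → s ≤ 2 → 1 ≤ τ →
    |kernErr s β τ| ≤ C * τ ^ (-(3 / 2) : ℝ) := by
  have hsum := summable_int_sq_add_one_rpow (s := 3 / 4) (by norm_num)
  refine ⟨4 * 9 ^ (3 / 4 : ℝ) * ∑' n : ℤ, ((n : ℝ) ^ 2 + 1) ^ (-(3 / 4) : ℝ),
    mul_nonneg (by positivity) (tsum_nonneg fun n => by positivity), fun s β τ hs hs2 hτ => ?_⟩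
  have hβ : kernErr s β τ = kernErr s (Int.fract β) τ := by
    conv_lhs => rw [← Int.fract_add_floor β]
    exact kernErr_add_int _ _ _ _
  rw [hβ]
  set γ := Int.fract β
  have hγ0 : 0 ≤ γ := Int.fract_nonneg β
  have hγ1 : γ ≤ 1 := (Int.fract_lt_one β).le
  have hintegral : HasSum (fun n : ℤ => ∫ x in (0 : ℝ)..1, kern s τ (x + n + γ))
      (∫ x, kern s τ x) := by
    have := ((integrable_kern hs hτ).comp_add_right γ).hasSum_intervalIntegral_comp_add_int
    rwa [integral_add_right_eq_self (kern s τ) γ] at this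
  have hterm : ∀ n : ℤ, ‖kern s τ (n + γ) - ∫ x in (0 : ℝ)..1, kern s τ (x + n + γ)‖ ≤
      4 * 9 ^ (3 / 4 : ℝ) * τ ^ (-(3 / 2) : ℝ) * ((n : ℝ) ^ 2 + 1) ^ (-(3 / 4) : ℝ) := fun n => by
    have hc : Continuous fun x : ℝ => kern s τ (x + n + γ) :=
      (continuous_kern hτ).comp (by fun_prop)
    have h1 : kern s τ (n + γ) - ∫ x in (0 : ℝ)..1, kern s τ (x + n + γ) =
        ∫ x in (0 : ℝ)..1, (kern s τ (n + γ) - kern s τ (x + n + γ)) := by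
      rw [intervalIntegral.integral_sub (by simp) (hc.intervalIntegrable _ _)]
      simp
    rw [h1]
    refine (intervalIntegral.norm_integral_le_of_norm_le_const (C := 4 * (9 ^ (3 / 4 : ℝ) *
      ((n : ℝ) ^ 2 + 1) ^ (-(3 / 4) : ℝ) * τ ^ (-(3 / 2) : ℝ))) fun x hx => ?_).trans
      (le_of_eq ?_)
    · rw [Set.uIoc_of_le zero_le_one] at hx
      exact abs_kern_sub_kern_le hs hs2 hτ hγ0 hγ1 hx.1.le hx.2 n
    · simp; ring
  have hdiff := (summable_kern hs hτ γ).hasSum.sub hintegral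
  have : kernErr s γ τ = ∑' n : ℤ, (kern s τ (n + γ) - ∫ x in (0 : ℝ)..1, kern s τ (x + n + γ)) :=
    hdiff.tsum_eq.symm
  rw [this, ← Real.norm_eq_abs]
  refine (tsum_of_norm_bounded (hsum.mul_left _).hasSum hterm).trans (le_of_eq ?_)
  rw [tsum_mul_left]
  ring

end TwoClassesPerGenus

namespace TwoClassesPerGenus

open MeasureTheory Filter Topology

lemma tendsto_kern {τ : ℝ} (hτ : 1 ≤ τ) (x : ℝ) :
    Tendsto (fun s => kern s τ x) (𝓝[>] 1) (𝓝 (kern 1 τ x)) := by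
  have hc : Continuous fun s => kern s τ x := by
    unfold kern
    exact Continuous.rpow continuous_const continuous_neg fun s => Or.inl (by positivity)
  exact (hc.tendsto 1).mono_left nhdsWithin_le_nhds

lemma tendsto_kernErr {τ : ℝ} (hτ : 1 ≤ τ) (β : ℝ) :
    Tendsto (fun s => kernErr s β τ) (𝓝[>] 1) (𝓝 (kernErr 1 β τ)) := by
  have hev : ∀ᶠ s : ℝ in 𝓝[>] 1, 1 ≤ s := by
    filter_upwards [self_mem_nhdsWithin] with s hs using le_of_lt hs
  refine Tendsto.sub ?_ ?_
  · refine tendsto_tsum_of_dominated_convergence (summable_kern le_rfl hτ β)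
      (fun n => tendsto_kern hτ _) ?_
    filter_upwards [hev] with s hs n
    rw [Real.norm_of_nonneg (kern_nonneg _ _ _)]
    exact kern_le hs hτ _
  · refine tendsto_integral_filter_of_dominated_convergence (kern 1 τ) ?_ ?_
      (integrable_kern le_rfl hτ) (Eventually.of_forall fun x => tendsto_kern hτ x)
    · exact Eventually.of_forall fun s => (continuous_kern hτ).aestronglyMeasurable
    · filter_upwards [hev] with s hs
      refine Eventually.of_forall fun x => ?_
      rw [Real.norm_of_nonneg (kern_nonneg _ _ _)]
      exact kern_le hs hτ _

lemma integral_kern {τ : ℝ} (hτ : 1 ≤ τ) (s : ℝ) :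
    ∫ x, kern s τ x = τ ^ (1 - 2 * s) * ∫ x, kern s 1 x := by
  have hτ0 : 0 < τ := by linarith
  have h1 := Measure.integral_comp_mul_left (kern s τ) τ
  have h2 : ∀ x, kern s τ (τ * x) = τ ^ (-(2 * s)) * kern s 1 x := fun x => by
    unfold kern
    rw [show (τ * x) ^ 2 + τ ^ 2 = τ ^ 2 * (x ^ 2 + 1 ^ 2) by ring,
      mul_rpow (by positivity) (by positivity), ← rpow_natCast τ 2, ← rpow_mul hτ0.le]
    congr 2
    push_cast
    ring
  simp only [h2, integral_const_mul] at h1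
  rw [abs_of_pos (by positivity), smul_eq_mul] at h1
  rw [sub_eq_add_neg, rpow_add hτ0, rpow_one, mul_assoc, h1]
  field_simp

lemma integral_kern_one_one : ∫ x, kern 1 1 x = π := by
  rw [← integral_univ_inv_one_add_sq]
  refine integral_congr_ae (Eventually.of_forall fun x => ?_)
  simp [kern, rpow_neg_one, add_comm]

lemma integral_kern_one {τ : ℝ} (hτ : 1 ≤ τ) : ∫ x, kern 1 τ x = π / τ := by
  rw [integral_kern hτ, integral_kern_one_one]
  norm_num [rpow_neg_one]
  field_simp

lemma tendsto_integral_kern_one :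
    Tendsto (fun s => ∫ x, kern s 1 x) (𝓝[>] 1) (𝓝 π) := by
  rw [← integral_kern_one_one]
  refine tendsto_integral_filter_of_dominated_convergence (kern 1 1) ?_ ?_
      (integrable_kern le_rfl le_rfl) (Eventually.of_forall fun x => tendsto_kern le_rfl x)
  · exact Eventually.of_forall fun s => (continuous_kern le_rfl).aestronglyMeasurable
  · filter_upwards [self_mem_nhdsWithin] with s hs
    refine Eventually.of_forall fun x => ?_
    rw [Real.norm_of_nonneg (kern_nonneg _ _ _)]
    exact kern_le (le_of_lt hs) le_rfl _

lemma tsum_kern_one_eq_cot {τ : ℝ} (hτ : 1 ≤ τ) (β : ℝ) :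
    ∑' n : ℤ, kern 1 τ (n + β) =
      -(π * Complex.cot (π * (β + τ * Complex.I))).im / τ := by
  have hτ0 : 0 < τ := by linarith
  set z : ℂ := β + τ * Complex.I with hz
  have hzim : z.im = τ := by simp [hz]
  have hzre : z.re = β := by simp [hz]
  have hzc : z ∈ Complex.integerComplement := by
    rintro ⟨n, hn⟩
    rw [← hn] at hzim
    simp at hzim
    linarith
  have him : ∀ n : ℤ, (1 / (z + n)).im = -τ * kern 1 τ (n + β) := fun n => by
    rw [one_div, Complex.inv_im, Complex.normSq_apply]
    simp only [Complex.add_re, Complex.add_im, hzre, hzim, Complex.intCast_re, Complex.intCast_im,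
      kern, rpow_neg_one]
    rw [add_zero, div_eq_mul_inv]
    congr 2
    ring
  have hs := summable_kern (s := 1) le_rfl hτ β
  have hs1 : Summable fun n : ℕ => kern 1 τ (((n + 1 : ℤ) : ℝ) + β) :=
    hs.comp_injective (i := fun n : ℕ => (n + 1 : ℤ)) fun a b h => by simpa using h
  have hs2 : Summable fun n : ℕ => kern 1 τ (((-(n + 1) : ℤ) : ℝ) + β) :=
    hs.comp_injective (i := fun n : ℕ => (-(n + 1) : ℤ)) fun a b h => by simpa using h
  have hsum := HasSum.of_add_one_of_neg_add_one (f := fun n : ℤ => kern 1 τ (n + β))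
    hs1.hasSum hs2.hasSum
  rw [hsum.tsum_eq]
  have hcot := congrArg Complex.im (cot_series_rep' hzc)
  have hsummable : Summable fun n : ℕ => (1 / (z - (n + 1)) + 1 / (z + (n + 1))) := by
    have := summable_cotTerm hzc
    exact this
  rw [Complex.im_tsum hsummable, Complex.sub_im] at hcot
  have h0 := him 0
  have h3 : ∀ n : ℕ, (1 / (z - (n + 1)) + 1 / (z + (n + 1))).im =
      -τ * (kern 1 τ (((-(n + 1) : ℤ) : ℝ) + β) + kern 1 τ (((n + 1 : ℤ) : ℝ) + β)) := fun n => by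
    have e1 := him (-(n + 1))
    have e2 := him (n + 1)
    push_cast at e1 e2 ⊢
    rw [Complex.add_im, e2, show z - (n + 1) = z + (-1 + -n) by ring, mul_add, ← e1]
    ring_nf
  rw [tsum_congr h3, tsum_mul_left, hs2.tsum_add hs1] at hcot
  simp only [Int.cast_zero, add_zero] at h0
  rw [h0] at hcot
  rw [eq_div_iff hτ0.ne']
  simp only [Int.cast_zero] at hcot ⊢
  linarith

lemma abs_kernErr_one_le {τ : ℝ} (hτ : 1 ≤ τ) (β : ℝ) :
    |kernErr 1 β τ| ≤ 4 * π / τ * exp (-(2 * π * τ)) := by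
  have hτ0 : 0 < τ := by linarith
  unfold kernErr
  rw [tsum_kern_one_eq_cot hτ, integral_kern_one hτ, Complex.cot_pi_eq_exp_ratio]
  set w := Complex.exp (2 * π * Complex.I * (β + τ * Complex.I)) with hw
  have hnw : ‖w‖ = exp (-(2 * π * τ)) := by
    rw [hw, Complex.norm_exp]
    congr 1
    simp
  have hw2 : ‖w‖ ≤ 1 / 2 := by
    rw [hnw]
    calc exp (-(2 * π * τ)) ≤ exp (-1) := by
          apply exp_le_exp.2
          nlinarith [pi_gt_three]
      _ ≤ 1 / 2 := by
          rw [exp_neg]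
          have := add_one_le_exp (1 : ℝ)
          rw [one_div]
          exact inv_anti₀ (by norm_num) (by linarith)
  have h1w : 1 / 2 ≤ ‖1 - w‖ := by
    have := norm_sub_norm_le (1 : ℂ) w
    rw [norm_one] at this
    linarith
  have h1w0 : 1 - w ≠ 0 := norm_pos_iff.1 (by linarith)
  have hid : (π : ℂ) * ((w + 1) / (Complex.I * (1 - w))) =
      -(π * Complex.I) - 2 * π * Complex.I * (w / (1 - w)) := by
    have : Complex.I ≠ 0 := Complex.I_ne_zero
    field_simp
    ring_nf
    rw [Complex.I_sq]
    ring
  rw [hid]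
  have hre : -(-(π * Complex.I) - 2 * π * Complex.I * (w / (1 - w)) : ℂ).im / τ - π / τ =
      2 * π * (w / (1 - w)).re / τ := by
    simp [Complex.mul_im, Complex.mul_re]
    ring
  rw [hre, abs_div, abs_mul, abs_of_pos (by positivity : (0 : ℝ) < 2 * π), abs_of_pos hτ0]
  have hb : |(w / (1 - w)).re| ≤ 2 * exp (-(2 * π * τ)) := by
    refine (Complex.abs_re_le_norm _).trans ?_
    rw [norm_div, hnw, div_le_iff₀ (by linarith)]
    nlinarith [exp_pos (-(2 * π * τ))]
  rw [div_mul_eq_mul_div]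
  refine div_le_div_of_nonneg_right ?_ hτ0.le
  nlinarith [pi_pos]

end TwoClassesPerGenus

namespace TwoClassesPerGenus

open NumberField

/-- `1, θ` is a `ℤ`-basis of the ring `R`, and `θ ^ 2 = t * θ - n`. -/
structure IsQuadBasis {R : Type*} [CommRing R] (θ : R) (t n : ℤ) : Prop where
  sq : θ ^ 2 = t * θ - n
  exists_eq : ∀ x : R, ∃ a b : ℤ, x = a + b * θ
  eq_zero : ∀ a b : ℤ, (a + b * θ : R) = 0 → a = 0 ∧ b = 0

namespace IsQuadBasis

section ring

variable {R : Type*} [CommRing R] {θ : R} {t n : ℤ}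

lemma ext_iff (h : IsQuadBasis θ t n) (a b a' b' : ℤ) :
    (a + b * θ : R) = a' + b' * θ ↔ a = a' ∧ b = b' := by
  constructor
  · intro he
    have := h.eq_zero (a - a') (b - b') (by push_cast; linear_combination he)
    omega
  · rintro ⟨rfl, rfl⟩
    rfl

lemma shift (h : IsQuadBasis θ t n) (r : ℤ) :
    IsQuadBasis (θ - r) (t - 2 * r) (r ^ 2 - t * r + n) where
  sq := by
    push_cast
    linear_combination h.sq
  exists_eq x := by
    obtain ⟨a, b, rfl⟩ := h.exists_eq x
    exact ⟨a + b * r, b, by push_cast; ring⟩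
  eq_zero a b hab := by
    have := h.eq_zero (a - b * r) b (by push_cast; linear_combination hab)
    obtain ⟨h1, rfl⟩ := this
    exact ⟨by simpa using h1, rfl⟩

/-- The basis `1, θ`. -/
noncomputable def basis (h : IsQuadBasis θ t n) : Module.Basis (Fin 2) ℤ R :=
  Module.Basis.mk (v := ![1, θ])
    (LinearIndependent.pair_iff.2 fun a b hab => h.eq_zero a b (by simpa using hab))
    (fun x _ => by
      obtain ⟨a, b, rfl⟩ := h.exists_eq x
      rw [show (a + b * θ : R) = a • (1 : R) + b • θ by simp]
      exact Submodule.add_mem _ (Submodule.smul_mem _ _ (Submodule.subset_span ⟨0, rfl⟩))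
        (Submodule.smul_mem _ _ (Submodule.subset_span ⟨1, rfl⟩)))

lemma basis_zero (h : IsQuadBasis θ t n) : h.basis 0 = 1 := by simp [basis]
lemma basis_one (h : IsQuadBasis θ t n) : h.basis 1 = θ := by simp [basis]

lemma repr_eq (h : IsQuadBasis θ t n) (a b : ℤ) :
    h.basis.repr (a + b * θ) = Finsupp.equivFunOnFinite.symm ![a, b] := by
  rw [← h.basis.repr.apply_symm_apply (Finsupp.equivFunOnFinite.symm ![a, b])]
  congr 1
  rw [Module.Basis.repr_symm_apply, Finsupp.linearCombination_apply,
    Finsupp.sum_fintype _ _ (by simp)]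
  simp [h.basis_zero, h.basis_one]

lemma leftMulMatrix_eq (h : IsQuadBasis θ t n) (a b : ℤ) :
    Algebra.leftMulMatrix h.basis (a + b * θ) = !![a, -n * b; b, a + t * b] := by
  have h0 : (a + b * θ : R) * h.basis 0 = (a : R) + (b : R) * θ := by rw [h.basis_zero, mul_one]
  have h1 : (a + b * θ : R) * h.basis 1 = ((-n * b : ℤ) : R) + ((a + t * b : ℤ) : R) * θ := by
    rw [h.basis_one]
    push_cast
    linear_combination (b : R) * h.sq
  ext i j
  rw [Algebra.leftMulMatrix_eq_repr_mul]
  fin_cases j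
  · simp only [Fin.zero_eta]
    rw [h0, h.repr_eq]
    fin_cases i <;> simp
  · simp only [Fin.mk_one]
    rw [h1, h.repr_eq]
    fin_cases i <;> simp

lemma norm_eq (h : IsQuadBasis θ t n) (a b : ℤ) :
    Algebra.norm ℤ (a + b * θ : R) = a ^ 2 + t * a * b + n * b ^ 2 := by
  rw [Algebra.norm_eq_matrix_det h.basis, h.leftMulMatrix_eq, Matrix.det_fin_two_of]
  ring

lemma trace_eq (h : IsQuadBasis θ t n) (a b : ℤ) :
    Algebra.trace ℤ R (a + b * θ : R) = 2 * a + t * b := by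
  rw [Algebra.trace_eq_matrix_trace h.basis, h.leftMulMatrix_eq, Matrix.trace_fin_two_of]
  ring

lemma discr_basis (h : IsQuadBasis θ t n) : Algebra.discr ℤ h.basis = t ^ 2 - 4 * n := by
  have e00 : Algebra.trace ℤ R (h.basis 0 * h.basis 0) = 2 := by
    have := h.trace_eq 1 0
    rw [h.basis_zero]
    simpa using this
  have e01 : Algebra.trace ℤ R (h.basis 0 * h.basis 1) = t := by
    have := h.trace_eq 0 1
    rw [h.basis_zero, h.basis_one]
    simpa using this
  have e11 : Algebra.trace ℤ R (h.basis 1 * h.basis 1) = t ^ 2 - 2 * n := by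
    have := h.trace_eq (-n) t
    rw [h.basis_one, ← pow_two, h.sq,
      show (t * θ - n : R) = ((-n : ℤ) : R) + t * θ by push_cast; ring,
      this]
    ring
  rw [Algebra.discr_def, Matrix.det_fin_two]
  simp only [Algebra.traceMatrix_apply, Algebra.traceForm_apply]
  rw [mul_comm (h.basis 1) (h.basis 0), e00, e01, e11]
  ring

end ring

section field

variable {F : Type*} [Field F] [NumberField F] {θ : 𝓞 F} {t n : ℤ}

lemma discr_eq (h : IsQuadBasis θ t n) : discr F = t ^ 2 - 4 * n := by
  rw [← discr_eq_discr F h.basis, h.discr_basis]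

lemma absNorm_span (h : IsQuadBasis θ t n) (a b : ℤ) :
    Ideal.absNorm (Ideal.span {(a + b * θ : 𝓞 F)}) = (a ^ 2 + t * a * b + n * b ^ 2).natAbs := by
  rw [Ideal.absNorm_span_singleton, h.norm_eq]

end field

end IsQuadBasis

/-- The ring of integers of a quadratic field has a basis of the form `1, θ`. -/
lemma exists_isQuadBasis (F : Type*) [Field F] [NumberField F] (hF : Module.finrank ℚ F = 2) :
    ∃ (θ : 𝓞 F) (t n : ℤ), IsQuadBasis θ t n := by
  have hrank : Module.finrank ℤ (𝓞 F) = 2 := by rw [RingOfIntegers.rank, hF]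
  let v : Module.Basis (Fin 2) ℤ (𝓞 F) := Module.finBasisOfFinrankEq ℤ (𝓞 F) hrank
  have hrepr : ∀ x : 𝓞 F, x = (v.repr x 0 : 𝓞 F) * v 0 + (v.repr x 1 : 𝓞 F) * v 1 := fun x => by
    conv_lhs => rw [← v.sum_repr x]
    simp [Fin.sum_univ_two]
  set a := v.repr 1 0 with ha
  set c := v.repr 1 1 with hc
  have h1 : (1 : 𝓞 F) = a * v 0 + c * v 1 := hrepr 1
  have hgcd : Int.gcd a c = 1 := by
    obtain ⟨a', ha'⟩ := Int.gcd_dvd_left (a := a) (b := c)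
    obtain ⟨c', hc'⟩ := Int.gcd_dvd_right (a := a) (b := c)
    have hu : (1 : 𝓞 F) = ((Int.gcd a c : ℤ) : 𝓞 F) * (a' * v 0 + c' * v 1) := by
      have ea := congrArg (Int.cast : ℤ → 𝓞 F) ha'
      have ec := congrArg (Int.cast : ℤ → 𝓞 F) hc'
      push_cast at ea ec ⊢
      linear_combination h1 + v 0 * ea + v 1 * ec
    have hn := congrArg (Algebra.norm ℤ) hu
    rw [map_one, map_mul, ← eq_intCast (algebraMap ℤ (𝓞 F)), Algebra.norm_algebraMap, hrank] at hn
    have := Int.isUnit_iff.1 (IsUnit.of_mul_eq_one _ hn.symm)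
    have hnn : (0 : ℤ) ≤ Int.gcd a c := by positivity
    rcases this with h | h <;> [skip; nlinarith [sq_nonneg (Int.gcd a c : ℤ)]]
    have : (Int.gcd a c : ℤ) = 1 := by nlinarith
    exact_mod_cast this
  have hbez := Int.gcd_eq_gcd_ab a c
  rw [hgcd] at hbez
  set p := Int.gcdA a c
  set q := Int.gcdB a c
  have hbez' : (1 : 𝓞 F) = a * p + c * q := by exact_mod_cast congrArg (Int.cast : ℤ → 𝓞 F) hbez
  set θ : 𝓞 F := -q * v 0 + p * v 1 with hθ
  have e0 : v 0 = p - c * θ := by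
    rw [hθ]
    linear_combination (v 0) * hbez' - p * h1
  have e1 : v 1 = q + a * θ := by
    rw [hθ]
    linear_combination (v 1) * hbez' - q * h1
  have hex : ∀ x : 𝓞 F, ∃ a b : ℤ, x = a + b * θ := fun x => by
    refine ⟨v.repr x 0 * p + v.repr x 1 * q, -v.repr x 0 * c + v.repr x 1 * a, ?_⟩
    conv_lhs => rw [hrepr x, e0, e1]
    push_cast
    ring
  have hzero : ∀ x y : ℤ, (x + y * θ : 𝓞 F) = 0 → x = 0 ∧ y = 0 := fun x y hxy => by
    have h2 : (x * a - y * q) • v 0 + (x * c + y * p) • v 1 = 0 := by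
      simp only [zsmul_eq_mul]
      push_cast
      rw [← hxy, hθ]
      linear_combination -(x : 𝓞 F) * h1
    have h3 : x * a - y * q = 0 ∧ x * c + y * p = 0 := by
      have e0 := congrArg (fun z => v.repr z 0) h2
      have e1 := congrArg (fun z => v.repr z 1) h2
      simp only [map_add, map_zsmul, Module.Basis.repr_self, Finsupp.add_apply, Finsupp.smul_apply,
        map_zero, Finsupp.zero_apply, Finsupp.single_apply] at e0 e1
      exact ⟨by simpa using e0, by simpa using e1⟩
    constructor
    · linear_combination p * h3.1 + q * h3.2 + x * hbez
    · linear_combination -c * h3.1 + a * h3.2 + y * hbez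
  obtain ⟨m, t, hm⟩ := hex (θ ^ 2)
  exact ⟨θ, t, -m, by rw [hm, Int.cast_neg]; ring, hex, hzero⟩

end TwoClassesPerGenus

namespace TwoClassesPerGenus

open NumberField

/-- `D ≡ 0, 1 mod 4` and no quotient of `D` by the square of a prime is such a number. -/
def IsFund (D : ℤ) : Prop :=
  (D % 4 = 0 ∨ D % 4 = 1) ∧ ∀ q : ℕ, q.Prime → ∀ m : ℤ, D = q ^ 2 * m → ¬(m % 4 = 0 ∨ m % 4 = 1)

lemma sq_sub_four_mul_emod (t n : ℤ) : (t ^ 2 - 4 * n) % 4 = 0 ∨ (t ^ 2 - 4 * n) % 4 = 1 := by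
  rcases Int.even_or_odd' t with ⟨k, rfl | rfl⟩ <;> ring_nf <;> omega

/-- The Kronecker symbol at a prime. -/
def kron (D : ℤ) (p : ℕ) : ℤ := if p = 2 then ZMod.χ₈ (D : ZMod 8) else jacobiSym D p

lemma kron_two (D : ℤ) : kron D 2 = ZMod.χ₈ (D : ZMod 8) := if_pos rfl

lemma kron_of_ne_two (D : ℤ) {p : ℕ} (hp : p ≠ 2) : kron D p = jacobiSym D p := if_neg hp

lemma kron_mul (D E : ℤ) (p : ℕ) : kron (D * E) p = kron D p * kron E p := by
  unfold kron
  split_ifs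
  · push_cast
    exact map_mul _ _ _
  · exact jacobiSym.mul_left _ _ _

lemma kron_eq_zero_iff {D : ℤ} {p : ℕ} (hp : p.Prime) : kron D p = 0 ↔ (p : ℤ) ∣ D := by
  rcases eq_or_ne p 2 with rfl | h2
  · rw [kron_two]
    have hdec : ∀ z : ZMod 8, ZMod.χ₈ z = 0 ↔ z.val % 2 = 0 := by decide
    rw [hdec, ← Int.natCast_inj]
    have := ZMod.val_intCast (n := 8) D
    push_cast at this ⊢
    rw [this]
    omega
  · have := Fact.mk hp
    rw [kron_of_ne_two _ h2, ← jacobiSym.legendreSym.to_jacobiSym, legendreSym.eq_zero_iff,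
      ZMod.intCast_zmod_eq_zero_iff_dvd]

lemma kron_trichotomy (D : ℤ) {p : ℕ} (hp : p.Prime) :
    kron D p = 0 ∨ kron D p = 1 ∨ kron D p = -1 := by
  rcases eq_or_ne p 2 with rfl | h2
  · rw [kron_two]
    have hdec : ∀ z : ZMod 8, ZMod.χ₈ z = 0 ∨ ZMod.χ₈ z = 1 ∨ ZMod.χ₈ z = -1 := by decide
    exact hdec _
  · rw [kron_of_ne_two _ h2]
    exact jacobiSym.trichotomy D p

/-- `kron (t² - 4n) p ≠ -1` iff `X² - tX + n` has a root modulo `p`. -/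
lemma kron_ne_neg_one_iff {t n : ℤ} {p : ℕ} (hp : p.Prime) :
    kron (t ^ 2 - 4 * n) p ≠ -1 ↔ ∃ r : ℤ, (p : ℤ) ∣ r ^ 2 - t * r + n := by
  rcases eq_or_ne p 2 with rfl | h2
  · rw [kron_two]
    have hdec : ∀ t n : ZMod 8, ZMod.χ₈ (t ^ 2 - 4 * n) ≠ -1 ↔ (t.val % 2 = 0 ∨ n.val % 2 = 0) := by
      decide
    have := hdec t n
    have ht := ZMod.val_intCast (n := 8) t
    have hn := ZMod.val_intCast (n := 8) n
    push_cast at this ht hn ⊢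
    rw [this]
    constructor
    · rintro (h | h)
      · refine ⟨n, ?_⟩
        have ht2 : (2 : ℤ) ∣ t := by omega
        have : (2 : ℤ) ∣ n * (n + 1) := (Int.even_mul_succ_self n).two_dvd
        rw [show n ^ 2 - t * n + n = n * (n + 1) - t * n by ring]
        exact dvd_sub this (ht2.mul_right n)
      · exact ⟨0, by simp; omega⟩
    · rintro ⟨r, hr⟩
      by_contra hcon
      have h1 : t % 2 = 1 := by omega
      have h3 : n % 2 = 1 := by omega
      have h4 : (r ^ 2 - t * r + n) % 2 = 1 := by
        rcases Int.emod_two_eq_zero_or_one r with h | h <;>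
          simp [Int.add_emod, Int.sub_emod, Int.mul_emod, pow_two, h, h1, h3]
      omega
  · have := Fact.mk hp
    rw [kron_of_ne_two _ h2, ← jacobiSym.legendreSym.to_jacobiSym, Ne, legendreSym.eq_neg_one_iff,
      not_not]
    have hodd : Odd p := hp.odd_of_ne_two h2
    constructor
    · rintro ⟨z, hz⟩
      obtain ⟨k, hk⟩ := hodd
      refine ⟨(t + z.cast) * (k + 1), ?_⟩
      have h4 : IsCoprime (p : ℤ) 4 := by
        rw [Int.isCoprime_iff_gcd_eq_one]
        have : Nat.Coprime p 4 := by
          rw [show 4 = 2 ^ 2 by norm_num]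
          exact Nat.Coprime.pow_right _ ((Nat.coprime_primes hp Nat.prime_two).2 h2)
        exact_mod_cast this
      refine h4.dvd_of_dvd_mul_left ?_
      rw [← ZMod.intCast_zmod_eq_zero_iff_dvd]
      have hk' : (2 * k + 1 : ZMod p) = 0 := by
        have : ((2 * k + 1 : ℕ) : ZMod p) = 0 := by rw [← hk]; simp
        exact_mod_cast this
      push_cast at hz ⊢
      linear_combination (-(1 : ZMod p)) * hz + ((t + z) ^ 2 * (2 * k + 3) - 2 * t * (t + z)) * hk'
    · rintro ⟨r, hr⟩
      rw [← ZMod.intCast_zmod_eq_zero_iff_dvd] at hr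
      refine ⟨2 * r - t, ?_⟩
      push_cast at hr ⊢
      linear_combination (-4 : ZMod p) * hr

/-- The ideal generated by an integer `u` and `θ`. -/
def quadIdeal {R : Type*} [CommRing R] (θ : R) (u : ℤ) : Ideal R := Ideal.span {(u : R), θ}

namespace IsQuadBasis

section ring

variable {R : Type*} [CommRing R] {θ : R} {t n : ℤ}

lemma conj (h : IsQuadBasis θ t n) : IsQuadBasis (t - θ) t n where
  sq := by linear_combination h.sq
  exists_eq x := by
    obtain ⟨a, b, rfl⟩ := h.exists_eq x
    exact ⟨a + b * t, -b, by push_cast; ring⟩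
  eq_zero a b hab := by
    have := h.eq_zero (a + b * t) (-b) (by push_cast; linear_combination hab)
    obtain ⟨h1, h2⟩ := this
    obtain rfl : b = 0 := by omega
    exact ⟨by simpa using h1, rfl⟩

lemma mem_quadIdeal (h : IsQuadBasis θ t n) {u : ℤ} (hu : u ∣ n) (a b : ℤ) :
    (a + b * θ : R) ∈ quadIdeal θ u ↔ u ∣ a := by
  unfold quadIdeal
  constructor
  · intro hmem
    obtain ⟨x, y, hxy⟩ := Ideal.mem_span_pair.1 hmem
    obtain ⟨x1, x2, rfl⟩ := h.exists_eq x
    obtain ⟨y1, y2, rfl⟩ := h.exists_eq y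
    have := (h.ext_iff (u * x1 - n * y2) (u * x2 + y1 + t * y2) a b).1 (by
      rw [← hxy]
      push_cast
      linear_combination (-(y2 : R)) * h.sq)
    rw [← this.1]
    exact dvd_sub (dvd_mul_right _ _) (hu.mul_right _)
  · rintro ⟨c, rfl⟩
    exact Ideal.mem_span_pair.2 ⟨c, b, by push_cast; ring⟩

lemma quadIdeal_one : quadIdeal θ 1 = ⊤ := by
  rw [Ideal.eq_top_iff_one]
  exact Ideal.subset_span (by simp)

lemma quadIdeal_ne_top (h : IsQuadBasis θ t n) {p : ℕ} (hp : p.Prime) (hpn : (p : ℤ) ∣ n) :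
    quadIdeal θ p ≠ ⊤ := by
  rw [Ne, Ideal.eq_top_iff_one]
  intro h1
  have := (h.mem_quadIdeal hpn 1 0).1 (by simpa using h1)
  have h2 : (p : ℤ) ∣ ((1 : ℕ) : ℤ) := by simpa using this
  exact hp.one_lt.ne' (Nat.dvd_one.1 (Int.natCast_dvd_natCast.1 h2))

/-- Product of ideals generated by `θ` and a divisor of the norm of `θ`. -/
lemma quadIdeal_mul (h : IsQuadBasis θ t n) {g u v m : ℤ} (hn : n = g * u * v * m) (hg : g ∣ t)
    (huv : IsCoprime u v) (hgm : IsCoprime g m) :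
    quadIdeal θ (g * u) * quadIdeal θ (g * v) = Ideal.span {(g : R)} * quadIdeal θ (u * v) := by
  obtain ⟨t', rfl⟩ := hg
  obtain ⟨x, y, hxy⟩ := huv
  obtain ⟨a, b, hab⟩ := hgm
  have hsq := h.sq
  have hn' := congrArg (Int.cast : ℤ → R) hn
  have hxy' := congrArg (Int.cast : ℤ → R) hxy
  have hab' := congrArg (Int.cast : ℤ → R) hab
  push_cast at hsq hn' hxy' hab'
  unfold quadIdeal
  rw [Ideal.span_pair_mul_span_pair]
  apply le_antisymm
  · rw [Ideal.span_le]
    have key : ∀ z w : R, (g : R) * (z * (u * v : ℤ) + w * θ) ∈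
        Ideal.span {(g : R)} * Ideal.span {((u * v : ℤ) : R), θ} := fun z w =>
      Ideal.mul_mem_mul (Ideal.mem_span_singleton_self _) (Ideal.mem_span_pair.2 ⟨z, w, rfl⟩)
    rintro z (rfl | rfl | rfl | rfl)
    · rw [SetLike.mem_coe]
      convert key g 0 using 1
      push_cast
      ring
    · rw [SetLike.mem_coe]
      convert key 0 u using 1
      push_cast
      ring
    · rw [SetLike.mem_coe]
      convert key 0 v using 1
      push_cast
      ring
    · rw [SetLike.mem_coe]
      convert key (-m) t' using 1
      push_cast
      linear_combination hsq - hn'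
  · rw [Ideal.mul_le]
    intro r hr s hs
    obtain ⟨r', rfl⟩ := Ideal.mem_span_singleton.1 hr
    obtain ⟨z, w, rfl⟩ := Ideal.mem_span_pair.1 hs
    set J := Ideal.span {(((g * u : ℤ) : R)) * ((g * v : ℤ) : R), ((g * u : ℤ) : R) * θ,
      θ * ((g * v : ℤ) : R), θ * θ} with hJ
    have m1 : (((g * u : ℤ) : R)) * ((g * v : ℤ) : R) ∈ J := Ideal.subset_span (by simp)
    have m2 : ((g * u : ℤ) : R) * θ ∈ J := Ideal.subset_span (by simp)
    have m3 : θ * ((g * v : ℤ) : R) ∈ J := Ideal.subset_span (by simp)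
    have m4 : θ * θ ∈ J := Ideal.subset_span (by simp)
    have k1 : (g : R) * θ ∈ J := by
      have := add_mem (J.mul_mem_left (x : R) m2) (J.mul_mem_left (y : R) m3)
      convert this using 1
      push_cast
      linear_combination (-(g * θ : R)) * hxy'
    have k2 : (g : R) * (u * v) ∈ J := by
      have := add_mem (J.mul_mem_left (a : R) m1)
        (J.mul_mem_left (b : R) (sub_mem (J.mul_mem_left (t' : R) k1) m4))
      convert this using 1
      push_cast
      linear_combination (-(g * u * v : R)) * hab' - b * hn' + b * hsq
    have := add_mem (J.mul_mem_left (r' * z) k2) (J.mul_mem_left (r' * w) k1)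
    convert this using 1
    push_cast
    ring

lemma quadIdeal_mul_conj (h : IsQuadBasis θ t n) {p m a b c : ℤ} (hn : n = p * m)
    (habc : a * p + b * t + c * m = 1) :
    quadIdeal θ p * quadIdeal (t - θ) p = Ideal.span {(p : R)} := by
  have hsq := h.sq
  have hn' := congrArg (Int.cast : ℤ → R) hn
  have habc' := congrArg (Int.cast : ℤ → R) habc
  push_cast at hsq hn' habc'
  unfold quadIdeal
  rw [Ideal.span_pair_mul_span_pair]
  apply le_antisymm
  · rw [Ideal.span_le]
    have key : ∀ z : R, (p : R) * z ∈ Ideal.span {(p : R)} := fun z =>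
      Ideal.mem_span_singleton.2 (dvd_mul_right _ _)
    rintro z (rfl | rfl | rfl | rfl)
    · exact key _
    · exact key _
    · rw [mul_comm]
      exact key _
    · rw [SetLike.mem_coe]
      convert key m using 1
      linear_combination hn' - hsq
  · rw [Ideal.span_singleton_le_iff_mem]
    set J := Ideal.span {(p : R) * p, (p : R) * (t - θ), θ * p, θ * (t - θ)} with hJ
    have m1 : (p : R) * p ∈ J := Ideal.subset_span (by simp)
    have m2 : (p : R) * (t - θ) ∈ J := Ideal.subset_span (by simp)
    have m3 : θ * p ∈ J := Ideal.subset_span (by simp)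
    have m4 : θ * (t - θ) ∈ J := Ideal.subset_span (by simp)
    have := add_mem (add_mem (J.mul_mem_left (a : R) m1) (J.mul_mem_left (b : R) (add_mem m2 m3)))
      (J.mul_mem_left (c : R) m4)
    convert this using 1
    linear_combination (-(p : R)) * habc' - c * hn' + c * hsq

lemma quadIdeal_conj (h : IsQuadBasis θ t n) {p : ℤ} (hp : p ∣ t) :
    quadIdeal (t - θ) p = quadIdeal θ p := by
  obtain ⟨k, rfl⟩ := hp
  unfold quadIdeal
  apply le_antisymm
  · rw [Ideal.span_le]
    rintro z (rfl | rfl)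
    · exact Ideal.subset_span (by simp)
    · exact Ideal.mem_span_pair.2 ⟨k, -1, by push_cast; ring⟩
  · rw [Ideal.span_le]
    rintro z (rfl | rfl)
    · exact Ideal.subset_span (by simp)
    · exact Ideal.mem_span_pair.2 ⟨k, -1, by push_cast; ring⟩

end ring

section field

variable {F : Type*} [Field F] [NumberField F] {θ : 𝓞 F} {t n : ℤ}

lemma isFund (h : IsQuadBasis θ t n) : IsFund (t ^ 2 - 4 * n) := by
  refine ⟨sq_sub_four_mul_emod t n, fun q hq m hm hm4 => ?_⟩
  have hq0 : (q : F) ≠ 0 := by exact_mod_cast hq.ne_zero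
  obtain ⟨k, hk⟩ : ∃ k : ℤ, m ^ 2 - m = 4 * k := by
    rcases hm4 with h0 | h0
    · obtain ⟨j, rfl⟩ : ∃ j, m = 4 * j := ⟨m / 4, by omega⟩
      exact ⟨4 * j ^ 2 - j, by ring⟩
    · obtain ⟨j, rfl⟩ : ∃ j, m = 4 * j + 1 := ⟨m / 4, by omega⟩
      exact ⟨(4 * j + 1) * j, by ring⟩
  set γ : F := ((2 * (θ : F) - t) / q + m) / 2 with hγ
  have hsqF : (θ : F) ^ 2 = t * θ - n := by
    have := congrArg (algebraMap (𝓞 F) F) h.sq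
    simpa using this
  have hδ : ((2 * (θ : F) - t) / q) ^ 2 = m := by
    have hm' := congrArg (Int.cast : ℤ → F) hm
    push_cast at hm'
    rw [div_pow, div_eq_iff (by positivity)]
    linear_combination 4 * hsqF + hm'
  have hroot : γ ^ 2 - m * γ + k = 0 := by
    have hk' := congrArg (Int.cast : ℤ → F) hk
    push_cast at hk'
    rw [hγ]
    linear_combination (1 / 4) * hδ - (1 / 4) * hk'
  have hintegral : IsIntegral ℤ γ := by
    refine ⟨Polynomial.X ^ 2 - Polynomial.C m * Polynomial.X + Polynomial.C k, ?_, ?_⟩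
    · monicity!
    · simp only [Polynomial.eval₂_add, Polynomial.eval₂_sub, Polynomial.eval₂_mul,
        Polynomial.eval₂_pow, Polynomial.eval₂_X, Polynomial.eval₂_C]
      simpa using hroot
  obtain ⟨a, b, hab⟩ := h.exists_eq ⟨γ, hintegral⟩
  have hab' : γ = a + b * (θ : F) := by
    have := congrArg (algebraMap (𝓞 F) F) hab
    rwa [map_add, map_mul, map_intCast, map_intCast] at this
  have h2 : (q * m - t : ℤ) + (2 : ℤ) * (θ : F) = (2 * q * a : ℤ) + (2 * q * b : ℤ) * (θ : F) := by
    have : 2 * q * γ = 2 * θ - t + q * m := by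
      rw [hγ]
      field_simp
    push_cast
    rw [hab'] at this
    linear_combination -this
  have h3 := (h.ext_iff (q * m - t) 2 (2 * q * a) (2 * q * b)).1
    (RingOfIntegers.coe_injective (by
      rw [map_add, map_mul, map_intCast, map_intCast, map_add, map_mul, map_intCast, map_intCast]
      exact h2))
  have h4 : (q : ℤ) ∣ 1 := ⟨b, by linarith [h3.2]⟩
  exact hq.one_lt.ne' (Nat.dvd_one.1 (by exact_mod_cast h4))

lemma not_sq_dvd (h : IsQuadBasis θ t n) {p : ℕ} (hp : p.Prime) (ht : (p : ℤ) ∣ t) :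
    ¬ (p : ℤ) ^ 2 ∣ n := by
  rintro ⟨m, rfl⟩
  obtain ⟨s, rfl⟩ := ht
  exact h.isFund.2 p hp (s ^ 2 - 4 * m) (by ring) (sq_sub_four_mul_emod s m)

end field

end IsQuadBasis

end TwoClassesPerGenus

namespace TwoClassesPerGenus

open NumberField Ideal

lemma mul_sup_span_eq {R : Type*} [CommRing R] {m n : ℕ} (hmn : m.Coprime n) {I J : Ideal R}
    (hI : (m : R) ∈ I) (hJ : (n : R) ∈ J) : I * J ⊔ span {(m : R)} = I := by
  obtain ⟨a, b, hab⟩ := Nat.isCoprime_iff_coprime.2 hmn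
  have hab' := congrArg (Int.cast : ℤ → R) hab
  push_cast at hab'
  refine le_antisymm (sup_le Ideal.mul_le_left ?_) fun x hx => ?_
  · rwa [Ideal.span_singleton_le_iff_mem]
  · rw [show x = (a * x) * m + b * (x * n) by linear_combination (-x) * hab']
    exact Ideal.add_mem _
      (Ideal.mul_mem_left _ _ (Ideal.mem_sup_right (Ideal.mem_span_singleton_self _)))
      (Ideal.mul_mem_left _ _ (Ideal.mem_sup_left (Ideal.mul_mem_mul hx hJ)))

lemma sup_span_mul_sup_span {R : Type*} [CommRing R] {m n : ℕ} (hmn : m.Coprime n) {I : Ideal R}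
    (hI : ((m * n : ℕ) : R) ∈ I) : (I ⊔ span {(m : R)}) * (I ⊔ span {(n : R)}) = I := by
  obtain ⟨a, b, hab⟩ := Nat.isCoprime_iff_coprime.2 hmn
  have hab' := congrArg (Int.cast : ℤ → R) hab
  push_cast at hab' hI
  apply le_antisymm
  · rw [Ideal.sup_mul, Ideal.mul_sup, Ideal.mul_sup, Ideal.span_singleton_mul_span_singleton]
    refine sup_le (sup_le Ideal.mul_le_left Ideal.mul_le_left) (sup_le Ideal.mul_le_right ?_)
    rwa [Ideal.span_singleton_le_iff_mem]
  · intro x hx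
    rw [show x = a * (m * x) + b * (x * n) by linear_combination (-x) * hab']
    exact Ideal.add_mem _
      (Ideal.mul_mem_left _ _ (Ideal.mul_mem_mul
        (Ideal.mem_sup_right (Ideal.mem_span_singleton_self _)) (Ideal.mem_sup_left hx)))
      (Ideal.mul_mem_left _ _ (Ideal.mul_mem_mul (Ideal.mem_sup_left hx)
        (Ideal.mem_sup_right (Ideal.mem_span_singleton_self _))))

section idealCount

variable (F : Type*) [Field F] [NumberField F]

/-- The number of integral ideals of norm `m`. -/
noncomputable def idealCount (m : ℕ) : ℕ := Nat.card {I : Ideal (𝓞 F) // absNorm I = m}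

variable {F}

lemma finite_absNorm_eq (m : ℕ) : Finite {I : Ideal (𝓞 F) // absNorm I = m} :=
  (Ideal.finite_setOfPred_absNorm_eq m).to_subtype

lemma idealCount_one : idealCount F 1 = 1 := by
  rw [idealCount, Nat.card_eq_one_iff_unique]
  refine ⟨⟨fun I J => Subtype.ext ?_⟩, ⟨⟨⊤, Ideal.absNorm_top⟩⟩⟩
  rw [Ideal.absNorm_eq_one_iff.1 I.2, Ideal.absNorm_eq_one_iff.1 J.2]

lemma card_mul_left {p : Ideal (𝓞 F)} (hp : p ≠ 0) (m : ℕ) :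
    Nat.card {I : Ideal (𝓞 F) // absNorm I = absNorm p * m ∧ p ∣ I} = idealCount F m := by
  refine (Nat.card_congr (Equiv.ofBijective
    (fun J : {J : Ideal (𝓞 F) // absNorm J = m} =>
      (⟨p * J.1, by rw [map_mul, J.2], dvd_mul_right _ _⟩ :
        {I : Ideal (𝓞 F) // absNorm I = absNorm p * m ∧ p ∣ I})) ⟨?_, ?_⟩)).symm
  · intro I J hIJ
    exact Subtype.ext (mul_left_cancel₀ hp (congrArg Subtype.val hIJ))
  · rintro ⟨I, hI, J, rfl⟩
    refine ⟨⟨J, ?_⟩, rfl⟩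
    rw [map_mul] at hI
    exact Nat.eq_of_mul_eq_mul_left
      (Nat.pos_of_ne_zero fun h => hp (Ideal.absNorm_eq_zero_iff.1 h)) hI

/-- Ideals of coprime norm combine bijectively. -/
lemma idealCount_mul {m n : ℕ} (hmn : m.Coprime n) :
    idealCount F (m * n) = idealCount F m * idealCount F n := by
  rw [idealCount, idealCount, idealCount, ← Nat.card_prod]
  refine (Nat.card_congr (Equiv.ofBijective
    (fun x : {I : Ideal (𝓞 F) // absNorm I = m} × {I : Ideal (𝓞 F) // absNorm I = n} =>
      (⟨x.1.1 * x.2.1, by rw [map_mul, x.1.2, x.2.2]⟩ :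
        {I : Ideal (𝓞 F) // absNorm I = m * n})) ⟨?_, ?_⟩)).symm
  · rintro ⟨⟨I, hI⟩, ⟨J, hJ⟩⟩ ⟨⟨I', hI'⟩, ⟨J', hJ'⟩⟩ hx
    have hx' : I * J = I' * J' := congrArg Subtype.val hx
    have hmem : ∀ {L : Ideal (𝓞 F)} {k : ℕ}, absNorm L = k → (k : 𝓞 F) ∈ L :=
      fun h => h ▸ Ideal.absNorm_mem _
    have e1 : I = I' := by
      rw [← mul_sup_span_eq hmn (hmem hI) (hmem hJ),
        ← mul_sup_span_eq hmn (hmem hI') (hmem hJ'), hx']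
    have e2 : J = J' := by
      rw [← mul_sup_span_eq hmn.symm (hmem hJ) (hmem hI),
        ← mul_sup_span_eq hmn.symm (hmem hJ') (hmem hI'), mul_comm, hx', mul_comm]
    subst e1 e2
    rfl
  · rintro ⟨L, hL⟩
    have hprod := sup_span_mul_sup_span hmn (I := L) (by rw [← hL]; exact Ideal.absNorm_mem L)
    have h1 : ∀ k l : ℕ, k.Coprime l → absNorm (L ⊔ span {(k : 𝓞 F)}) ∣ k * l →
        absNorm (L ⊔ span {(k : 𝓞 F)}) ∣ k := by
      intro k l hkl h
      have h2 : absNorm (L ⊔ span {(k : 𝓞 F)}) ∣ k ^ Module.finrank ℤ (𝓞 F) := by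
        rw [← Ideal.absNorm_span_natCast]
        exact Ideal.absNorm_dvd_absNorm_of_le le_sup_right
      exact (Nat.Coprime.coprime_dvd_left h2 (hkl.pow_left _)).dvd_of_dvd_mul_right h
    have hN := congrArg absNorm hprod
    rw [map_mul, hL] at hN
    have h2 := h1 m n hmn (hN ▸ dvd_mul_right _ _)
    have h3 := h1 n m hmn.symm (by rw [mul_comm n m, ← hN]; exact dvd_mul_left _ _)
    rcases Nat.eq_zero_or_pos (m * n) with h0 | h0
    · have : m = 1 ∨ n = 1 := by
        rcases Nat.mul_eq_zero.1 h0 with rfl | rfl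
        · right; simpa using hmn
        · left; simpa using hmn
      rcases this with rfl | rfl
      · exact ⟨⟨⟨⊤, Ideal.absNorm_top⟩, ⟨L, by simpa using hL⟩⟩, by simp⟩
      · exact ⟨⟨⟨L, by simpa using hL⟩, ⟨⊤, Ideal.absNorm_top⟩⟩, by simp⟩
    · have hm : 0 < m := Nat.pos_of_mul_pos_right h0
      have hn : 0 < n := Nat.pos_of_mul_pos_left h0
      have l1 := Nat.le_of_dvd hm h2
      have l2 := Nat.le_of_dvd hn h3
      have e1 : absNorm (L ⊔ span {(m : 𝓞 F)}) = m := by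
        refine le_antisymm l1 (Nat.le_of_mul_le_mul_right ?_ hn)
        rw [← hN]
        exact Nat.mul_le_mul_left _ l2
      have e2 : absNorm (L ⊔ span {(n : 𝓞 F)}) = n := by
        rw [e1] at hN
        exact Nat.eq_of_mul_eq_mul_left hm hN
      exact ⟨⟨⟨_, e1⟩, ⟨_, e2⟩⟩, Subtype.ext hprod⟩

/-- Every ideal of norm `p ^ (e + 1)` is divisible by a prime factor of `(p)`. -/
lemma exists_prime_dvd {p : ℕ} (hp : p.Prime) {e : ℕ} {I : Ideal (𝓞 F)}
    (hI : absNorm I = p ^ (e + 1)) :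
    ∃ Q : Ideal (𝓞 F), Prime Q ∧ Q ∣ I ∧ Q ∣ span {(p : 𝓞 F)} := by
  obtain ⟨Q, hQ, hQp, hQI⟩ := Ideal.exists_isMaximal_dvd_of_dvd_absNorm
    (Nat.prime_iff_prime_int.1 hp) I (by rw [hI]; push_cast; exact dvd_pow_self _ (by simp))
  have hmem : (p : 𝓞 F) ∈ Q := by
    have : (p : ℤ) ∈ Q.under ℤ := by rw [hQp]; exact Ideal.mem_span_singleton_self _
    simpa [Ideal.under, Ideal.mem_comap] using this
  refine ⟨Q, ?_, hQI, ?_⟩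
  · refine Ideal.prime_of_isPrime ?_ hQ.isPrime
    rintro rfl
    exact hp.ne_zero (by exact_mod_cast (Ideal.mem_bot.1 hmem))
  · rwa [Ideal.dvd_iff_le, Ideal.span_singleton_le_iff_mem]

lemma idealCount_mul_of_forall_dvd {P : Ideal (𝓞 F)} (hP : P ≠ 0) {m : ℕ}
    (h : ∀ I : Ideal (𝓞 F), absNorm I = absNorm P * m → P ∣ I) :
    idealCount F (absNorm P * m) = idealCount F m := by
  rw [← card_mul_left hP m, idealCount]
  exact Nat.card_congr (Equiv.subtypeEquivRight fun I => ⟨fun hI => ⟨hI, h I hI⟩, fun hI => hI.1⟩)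

lemma idealCount_pow_of_ramified {p : ℕ} (hp : p.Prime) {P : Ideal (𝓞 F)} (hP : absNorm P = p)
    (hsq : P * P = span {(p : 𝓞 F)}) (e : ℕ) : idealCount F (p ^ e) = 1 := by
  have hPp : Prime P := (Ideal.irreducible_of_irreducible_absNorm (hP ▸ hp)).prime
  induction e with
  | zero => rw [pow_zero, idealCount_one]
  | succ e ih =>
    rw [pow_succ', ← hP, idealCount_mul_of_forall_dvd hPp.ne_zero, hP, ih]
    intro I hI
    rw [hP, ← pow_succ'] at hI
    obtain ⟨Q, hQ, hQI, hQp⟩ := exists_prime_dvd hp hI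
    rw [← hsq] at hQp
    have : Q ∣ P := (hQ.dvd_or_dvd hQp).elim id id
    have := associated_iff_eq.1 (hQ.associated_of_dvd hPp this)
    exact this ▸ hQI

lemma idealCount_pow_of_split {p : ℕ} (hp : p.Prime) {P Q : Ideal (𝓞 F)} (hP : absNorm P = p)
    (hQ : absNorm Q = p) (hPQ : P * Q = span {(p : 𝓞 F)}) (hne : P ≠ Q) (e : ℕ) :
    idealCount F (p ^ e) = e + 1 := by
  have hPp : Prime P := (Ideal.irreducible_of_irreducible_absNorm (hP ▸ hp)).prime
  have hQp : Prime Q := (Ideal.irreducible_of_irreducible_absNorm (hQ ▸ hp)).prime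
  have hdiv : ∀ (e : ℕ) (I : Ideal (𝓞 F)), absNorm I = p ^ e → ¬ P ∣ I → I = Q ^ e := by
    intro e
    induction e with
    | zero =>
      intro I hI _
      rw [pow_zero] at hI
      rw [pow_zero, Ideal.one_eq_top, Ideal.absNorm_eq_one_iff.1 hI]
    | succ e ih =>
      intro I hI hPI
      obtain ⟨R, hR, hRI, hRp⟩ := exists_prime_dvd hp hI
      rw [← hPQ] at hRp
      rcases hR.dvd_or_dvd hRp with h | h
      · exact absurd (associated_iff_eq.1 (hR.associated_of_dvd hPp h) ▸ hRI) hPI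
      · obtain ⟨J, rfl⟩ := associated_iff_eq.1 (hR.associated_of_dvd hQp h) ▸ hRI
        rw [map_mul, hQ, pow_succ'] at hI
        rw [ih J (Nat.eq_of_mul_eq_mul_left hp.pos hI) fun h => hPI (h.mul_left _), pow_succ']
  have hPQe : ∀ e, ¬ P ∣ Q ^ e := fun e h =>
    hne (associated_iff_eq.1 (hPp.associated_of_dvd hQp (hPp.dvd_of_dvd_pow h)))
  induction e with
  | zero => rw [pow_zero, idealCount_one]
  | succ e ih =>
    have hfin := finite_absNorm_eq (F := F) (p ^ (e + 1))
    have h1 := card_mul_left hPp.ne_zero (p ^ e)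
    rw [hP, ← pow_succ', ih] at h1
    have hset : {I : Ideal (𝓞 F) | absNorm I = p ^ (e + 1)} =
        insert (Q ^ (e + 1)) {I : Ideal (𝓞 F) | absNorm I = p ^ (e + 1) ∧ P ∣ I} := by
      ext I
      simp only [Set.mem_ofPred_eq, Set.mem_insert_iff]
      constructor
      · intro hI
        by_cases h : P ∣ I
        · exact Or.inr ⟨hI, h⟩
        · exact Or.inl (hdiv _ _ hI h)
      · rintro (rfl | h)
        · rw [map_pow, hQ]
        · exact h.1
    have h2 : idealCount F (p ^ (e + 1)) =
        Set.ncard {I : Ideal (𝓞 F) | absNorm I = p ^ (e + 1)} := rfl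
    rw [h2, hset, Set.ncard_insert_of_notMem (fun h => hPQe _ h.2)
      ((Ideal.finite_setOfPred_absNorm_eq (S := 𝓞 F) (p ^ (e + 1))).subset fun I hI => hI.1)]
    exact congrArg (· + 1) h1

lemma idealCount_pow_of_inert (hF : Module.finrank ℚ F = 2) {p : ℕ} (hp : p.Prime)
    (hnone : ∀ I : Ideal (𝓞 F), absNorm I ≠ p) (e : ℕ) :
    idealCount F (p ^ (2 * e)) = 1 ∧ idealCount F (p ^ (2 * e + 1)) = 0 := by
  have hN : absNorm (span {(p : 𝓞 F)}) = p ^ 2 := by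
    rw [Ideal.absNorm_span_natCast, RingOfIntegers.rank, hF]
  have hpp : Prime (span {(p : 𝓞 F)}) := by
    obtain ⟨Q, hQ, -, hQp⟩ := exists_prime_dvd (e := 1) hp hN
    have h1 : absNorm Q ∣ p ^ 2 := hN ▸ Ideal.absNorm_dvd_absNorm_of_le (Ideal.dvd_iff_le.1 hQp)
    obtain ⟨J, hJ⟩ := hQp
    have h2 := congrArg absNorm hJ
    rw [hN, map_mul] at h2
    rcases (Nat.dvd_prime_pow hp).1 h1 with ⟨i, hi, hQi⟩
    interval_cases i
    · rw [pow_zero, Ideal.absNorm_eq_one_iff] at hQi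
      exact absurd hQ (by rw [hQi, ← Ideal.one_eq_top]; exact not_prime_one)
    · exact absurd (by simpa using hQi) (hnone Q)
    · rw [hQi] at h2
      have : absNorm J = 1 := Nat.eq_of_mul_eq_mul_left (pow_pos hp.pos 2) (by rw [← h2, mul_one])
      rw [Ideal.absNorm_eq_one_iff.1 this, Ideal.mul_top] at hJ
      rwa [hJ]
  have hstep : ∀ e, idealCount F (p ^ (e + 2)) = idealCount F (p ^ e) := by
    intro e
    rw [pow_add, mul_comm, ← hN, idealCount_mul_of_forall_dvd hpp.ne_zero]
    intro I hI
    rw [hN, ← pow_add, add_comm] at hI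
    obtain ⟨Q, hQ, hQI, hQp⟩ := exists_prime_dvd hp hI
    exact associated_iff_eq.1 (hQ.associated_of_dvd hpp hQp) ▸ hQI
  induction e with
  | zero =>
    rw [mul_zero, pow_zero, idealCount_one, zero_add, pow_one]
    refine ⟨rfl, ?_⟩
    have : IsEmpty {I : Ideal (𝓞 F) // absNorm I = p} := ⟨fun I => hnone I.1 I.2⟩
    exact Nat.card_of_isEmpty
  | succ e ih => exact ⟨(hstep (2 * e)).trans ih.1, (hstep (2 * e + 1)).trans ih.2⟩

lemma absNorm_of_mul_eq_span (hF : Module.finrank ℚ F = 2) {p : ℕ} (hp : p.Prime)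
    {P Q : Ideal (𝓞 F)} (hP : P ≠ ⊤) (hQ : Q ≠ ⊤) (h : P * Q = span {(p : 𝓞 F)}) :
    absNorm P = p ∧ absNorm Q = p := by
  have h1 := congrArg absNorm h
  rw [map_mul, Ideal.absNorm_span_natCast, RingOfIntegers.rank, hF] at h1
  exact (Nat.Prime.mul_eq_prime_sq_iff hp (by rwa [Ne, Ideal.absNorm_eq_one_iff])
    (by rwa [Ne, Ideal.absNorm_eq_one_iff])).1 h1

variable {θ : 𝓞 F} {t n : ℤ}

lemma IsQuadBasis.finrank_eq (h : IsQuadBasis θ t n) : Module.finrank ℚ F = 2 := by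
  rw [← RingOfIntegers.rank, Module.finrank_eq_card_basis h.basis, Fintype.card_fin]

lemma IsQuadBasis.idealCount_prime_pow (h : IsQuadBasis θ t n) {p : ℕ} (hp : p.Prime) (e : ℕ) :
    (idealCount F (p ^ e) : ℤ) = ∑ i ∈ Finset.range (e + 1), kron (discr F) p ^ i := by
  by_cases hk : kron (discr F) p = -1
  · have hnone : ∀ I : Ideal (𝓞 F), absNorm I ≠ p := by
      intro I hI
      rw [h.discr_eq] at hk
      refine (kron_ne_neg_one_iff hp).2 ?_ hk
      have hcard : Nat.card (𝓞 F ⧸ I) = p := hI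
      have hpI : (p : 𝓞 F) ∈ I := hI ▸ Ideal.absNorm_mem I
      have hI1 : (1 : 𝓞 F) ∉ I := fun h1 => hp.one_lt.ne' (by
        rw [← hI, Ideal.absNorm_eq_one_iff.2 ((Ideal.eq_top_iff_one _).2 h1)])
      have hchar : ∀ a : ℤ, (a : 𝓞 F) ∈ I → (p : ℤ) ∣ a := by
        intro a ha
        by_contra hcon
        obtain ⟨x, y, hxy⟩ := (((Nat.prime_iff_prime_int.1 hp).coprime_iff_not_dvd).2 hcon)
        refine hI1 ?_
        have hxy' := congrArg (Int.cast : ℤ → 𝓞 F) hxy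
        push_cast at hxy'
        rw [← hxy']
        exact I.add_mem (I.mul_mem_left _ hpI) (I.mul_mem_left _ ha)
      have hfin : Finite (𝓞 F ⧸ I) := Nat.finite_of_card_ne_zero (hcard ▸ hp.ne_zero)
      have hinj : Function.Injective fun i : Fin p => Ideal.Quotient.mk I ((i : ℕ) : 𝓞 F) := by
        intro i j hij
        have := Ideal.Quotient.eq.1 hij
        have h2 : ((i : ℕ) : 𝓞 F) - ((j : ℕ) : 𝓞 F) = (((i : ℕ) - (j : ℕ) : ℤ) : 𝓞 F) := by
          push_cast; rfl
        rw [h2] at this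
        have h3 := Int.eq_zero_of_abs_lt_dvd (hchar _ this) (by
          rw [abs_lt]; constructor <;> have := i.2 <;> have := j.2 <;> omega)
        exact Fin.ext (by omega)
      have hsurj := (hinj.bijective_of_nat_card_le (by simp [hcard])).2
      obtain ⟨r, hr⟩ := hsurj (Ideal.Quotient.mk I θ)
      have hr' := Ideal.Quotient.eq.1 hr
      refine ⟨(r : ℕ), hchar _ ?_⟩
      have : (((r : ℕ) : ℤ) ^ 2 - t * (r : ℕ) + n : ℤ) =
          (((r : ℕ) : 𝓞 F) - θ) * ((r : ℕ) + θ - t) := by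
        push_cast
        linear_combination h.sq
      rw [this]
      exact I.mul_mem_right _ hr'
    rw [hk]
    rcases Nat.even_or_odd' e with ⟨k, rfl | rfl⟩
    · rw [(idealCount_pow_of_inert h.finrank_eq hp hnone k).1, neg_one_geom_sum]
      simp
    · rw [(idealCount_pow_of_inert h.finrank_eq hp hnone k).2, neg_one_geom_sum]
      simp [Nat.even_add_one]
  · rw [h.discr_eq] at hk
    obtain ⟨r, m, hm⟩ := (kron_ne_neg_one_iff hp).1 hk
    have h' := h.shift r
    rw [hm] at h'
    generalize θ - r = θ' at h'
    generalize t - 2 * r = t' at h'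
    have hnt := h'.quadIdeal_ne_top hp ⟨m, rfl⟩
    have hnt' := h'.conj.quadIdeal_ne_top hp ⟨m, rfl⟩
    have hdisc := h'.discr_eq
    by_cases ht : (p : ℤ) ∣ t'
    · have hpm : ¬ (p : ℤ) ∣ m := fun ⟨m', hm'⟩ => h'.not_sq_dvd hp ht ⟨m', by rw [hm']; ring⟩
      obtain ⟨x, y, hxy⟩ := (((Nat.prime_iff_prime_int.1 hp).coprime_iff_not_dvd).2 hpm)
      have hmul := h'.quadIdeal_mul_conj (p := p) (a := x) (b := 0) (c := y) rfl
        (by linear_combination hxy)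
      rw [h'.quadIdeal_conj ht, Int.cast_natCast] at hmul
      have hk0 : kron (discr F) p = 0 := by
        rw [kron_eq_zero_iff hp, hdisc]
        exact dvd_sub (dvd_pow ht two_ne_zero) ⟨4 * m, by ring⟩
      rw [idealCount_pow_of_ramified hp (absNorm_of_mul_eq_span h.finrank_eq hp hnt hnt hmul).1
        hmul,
        hk0, Finset.sum_range_succ']
      simp
    · obtain ⟨x, y, hxy⟩ := (((Nat.prime_iff_prime_int.1 hp).coprime_iff_not_dvd).2 ht)
      have hmul := h'.quadIdeal_mul_conj (p := p) (a := x) (b := y) (c := 0) rfl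
        (by linear_combination hxy)
      rw [Int.cast_natCast] at hmul
      obtain ⟨hN1, hN2⟩ := absNorm_of_mul_eq_span h.finrank_eq hp hnt hnt' hmul
      have hne : quadIdeal θ' p ≠ quadIdeal (t' - θ') p := by
        intro heq
        have : ((t' : ℤ) + (-1 : ℤ) * θ' : 𝓞 F) ∈ quadIdeal θ' p := by
          rw [heq]
          exact Ideal.subset_span (by simp [sub_eq_add_neg])
        exact ht ((h'.mem_quadIdeal ⟨m, rfl⟩ _ _).1 this)
      have hk1 : kron (discr F) p = 1 := by
        rcases kron_trichotomy (discr F) hp with h0 | h1 | h1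
        · rw [kron_eq_zero_iff hp, hdisc] at h0
          have : (p : ℤ) ∣ t' ^ 2 := by
            have := dvd_add h0 (show (p : ℤ) ∣ 4 * (p * m) from ⟨4 * m, by ring⟩)
            rwa [sub_add_cancel] at this
          exact absurd ((Nat.prime_iff_prime_int.1 hp).dvd_of_dvd_pow this) ht
        · exact h1
        · exact absurd (h.discr_eq ▸ h1) hk
      rw [idealCount_pow_of_split hp hN1 hN2 hmul hne, hk1]
      simp

end idealCount

end TwoClassesPerGenus

namespace TwoClassesPerGenus

open NumberField Ideal

/-- The completely multiplicative function with prescribed values at the primes. -/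
noncomputable def cmul (φ : ℕ → ℤ) : ArithmeticFunction ℤ :=
  ⟨fun n => if n = 0 then 0 else n.factorization.prod fun p e => φ p ^ e, if_pos rfl⟩

lemma cmul_apply (φ : ℕ → ℤ) {n : ℕ} (hn : n ≠ 0) :
    cmul φ n = n.factorization.prod fun p e => φ p ^ e := if_neg hn

lemma cmul_one (φ : ℕ → ℤ) : cmul φ 1 = 1 := by
  rw [cmul_apply _ one_ne_zero]
  simp

lemma cmul_mul (φ : ℕ → ℤ) (m n : ℕ) : cmul φ (m * n) = cmul φ m * cmul φ n := by
  rcases eq_or_ne m 0 with rfl | hm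
  · simp
  rcases eq_or_ne n 0 with rfl | hn
  · simp
  rw [cmul_apply _ (mul_ne_zero hm hn), cmul_apply _ hm, cmul_apply _ hn,
    Nat.factorization_mul hm hn, Finsupp.prod_add_index' (fun _ => pow_zero _)
      (fun _ _ _ => pow_add _ _ _)]

lemma cmul_pow (φ : ℕ → ℤ) (m e : ℕ) : cmul φ (m ^ e) = cmul φ m ^ e := by
  induction e with
  | zero => simp [cmul_one]
  | succ e ih => rw [pow_succ, cmul_mul, ih, pow_succ]

lemma cmul_prime (φ : ℕ → ℤ) {p : ℕ} (hp : p.Prime) : cmul φ p = φ p := by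
  rw [cmul_apply _ hp.ne_zero, hp.factorization,
    Finsupp.prod_single_index (h := fun p e => φ p ^ e) (pow_zero _), pow_one]

lemma isMultiplicative_cmul (φ : ℕ → ℤ) : (cmul φ).IsMultiplicative :=
  ⟨cmul_one φ, fun _ => cmul_mul φ _ _⟩

lemma abs_cmul_le {φ : ℕ → ℤ} (h : ∀ p, p.Prime → |φ p| ≤ 1) (n : ℕ) : |cmul φ n| ≤ 1 := by
  rcases eq_or_ne n 0 with rfl | hn
  · simp
  rw [cmul_apply _ hn, Finsupp.prod, Finset.abs_prod]
  refine Finset.prod_le_one (fun _ _ => abs_nonneg _) fun p hp => ?_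
  rw [abs_pow]
  exact pow_le_one₀ (abs_nonneg _) (h p (Nat.prime_of_mem_primeFactors hp))

/-- A completely multiplicative function is determined by its values at the primes. -/
lemma eq_cmul {φ : ℕ → ℤ} {f : ℕ → ℤ} (h1 : f 1 = 1)
    (hmul : ∀ m n, m ≠ 0 → n ≠ 0 → f (m * n) = f m * f n)
    (hp : ∀ p, p.Prime → f p = φ p) {n : ℕ} (hn : n ≠ 0) : f n = cmul φ n := by
  induction n using Nat.recOnMul with
  | zero => exact absurd rfl hn
  | one => rw [h1, cmul_one]
  | prime p hpp => rw [hp p hpp, cmul_prime _ hpp]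
  | mul a b ha hb =>
    have ha0 := left_ne_zero_of_mul hn
    have hb0 := right_ne_zero_of_mul hn
    rw [hmul a b ha0 hb0, cmul_mul, ha ha0, hb hb0]

lemma cmul_mul_cmul_prime_pow (φ ψ : ℕ → ℤ) {p : ℕ} (hp : p.Prime) (e : ℕ) :
    (cmul φ * cmul ψ) (p ^ e) = ∑ i ∈ Finset.range (e + 1), φ p ^ i * ψ p ^ (e - i) := by
  rw [ArithmeticFunction.mul_apply,
    Nat.sum_divisorsAntidiagonal (f := fun a b => cmul φ a * cmul ψ b),
    Nat.divisors_prime_pow hp, Finset.sum_map]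
  refine Finset.sum_congr rfl fun i hi => ?_
  have hi' : i ≤ e := Nat.lt_succ_iff.1 (Finset.mem_range.1 hi)
  simp only [Function.Embedding.coeFn_mk]
  rw [Nat.pow_div hi' hp.pos, cmul_pow, cmul_pow, cmul_prime _ hp, cmul_prime _ hp]

lemma cmul_mul_cmul_congr {φ ψ φ' ψ' : ℕ → ℤ}
    (h : ∀ p, p.Prime → (φ p = φ' p ∧ ψ p = ψ' p) ∨ (φ p = ψ' p ∧ ψ p = φ' p)) :
    cmul φ * cmul ψ = cmul φ' * cmul ψ' := by
  rw [((isMultiplicative_cmul φ).mul (isMultiplicative_cmul ψ)).eq_iff_eq_on_prime_powers _ _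
    ((isMultiplicative_cmul φ').mul (isMultiplicative_cmul ψ'))]
  intro p e hp
  rw [cmul_mul_cmul_prime_pow _ _ hp, cmul_mul_cmul_prime_pow _ _ hp]
  rcases h p hp with ⟨h1, h2⟩ | ⟨h1, h2⟩
  · rw [h1, h2]
  · rw [h1, h2, ← Finset.sum_range_reflect]
    refine Finset.sum_congr rfl fun i hi => ?_
    have hi' : i ≤ e := Nat.lt_succ_iff.1 (Finset.mem_range.1 hi)
    rw [show e + 1 - 1 - i = e - i by omega, Nat.sub_sub_self hi', mul_comm]

lemma pmul_cmul (γ φ : ℕ → ℤ) (a b : ArithmeticFunction ℤ) (ha : a = cmul φ) :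
    (cmul γ).pmul (a * b) = cmul (γ * φ) * (cmul γ).pmul b := by
  have h0 : cmul (γ * φ) = (cmul γ).pmul (cmul φ) := by
    ext n
    rcases eq_or_ne n 0 with rfl | hn
    · simp
    · refine (eq_cmul (f := fun n => (cmul γ).pmul (cmul φ) n) ?_ ?_ ?_ hn).symm
      · simp [cmul_one]
      · intro m n _ _
        simp only [ArithmeticFunction.pmul_apply, cmul_mul]
        ring
      · intro p hp
        simp [cmul_prime _ hp]
  rw [h0, ha]
  ext n
  rw [ArithmeticFunction.pmul_apply, ArithmeticFunction.mul_apply, ArithmeticFunction.mul_apply,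
    Finset.mul_sum]
  refine Finset.sum_congr rfl fun x hx => ?_
  rw [← (Nat.mem_divisorsAntidiagonal.1 hx).1, cmul_mul, ArithmeticFunction.pmul_apply,
    ArithmeticFunction.pmul_apply]
  ring

section

variable (F : Type*) [Field F] [NumberField F]

/-- The coefficients of the Dedekind zeta function. -/
noncomputable def idealFun : ArithmeticFunction ℤ :=
  ⟨fun n => if n = 0 then 0 else idealCount F n, if_pos rfl⟩

lemma idealFun_apply {n : ℕ} (hn : n ≠ 0) : idealFun F n = idealCount F n := if_neg hn

lemma idealFun_eq (hF : Module.finrank ℚ F = 2) : idealFun F = cmul 1 * cmul (kron (discr F)) := by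
  have hm : (idealFun F).IsMultiplicative := by
    rw [ArithmeticFunction.IsMultiplicative.iff_ne_zero]
    refine ⟨by rw [idealFun_apply F one_ne_zero, idealCount_one]; rfl, fun hm hn hmn => ?_⟩
    rw [idealFun_apply F (mul_ne_zero hm hn), idealFun_apply F hm, idealFun_apply F hn,
      idealCount_mul hmn]
    push_cast; rfl
  rw [hm.eq_iff_eq_on_prime_powers _ _ ((isMultiplicative_cmul _).mul (isMultiplicative_cmul _))]
  intro p e hp
  obtain ⟨θ, t, n, h⟩ := exists_isQuadBasis F hF
  rw [idealFun_apply F (pow_ne_zero _ hp.ne_zero), h.idealCount_prime_pow hp,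
    cmul_mul_cmul_prime_pow _ _ hp, ← Finset.sum_range_reflect]
  refine Finset.sum_congr rfl fun i hi => ?_
  simp

lemma lseries_idealFun (s : ℂ) : LSeries (fun n => (idealFun F n : ℂ)) s = dedekindZeta F s := by
  refine LSeries_congr (fun {n} hn => ?_) s
  rw [idealFun_apply F hn]
  push_cast; rfl

end

lemma lseriesSummable_cmul {φ : ℕ → ℤ} (h : ∀ p, p.Prime → |φ p| ≤ 1) {s : ℂ} (hs : 1 < s.re) :
    LSeriesSummable (fun n => (cmul φ n : ℂ)) s := by
  refine LSeriesSummable_of_bounded_of_one_lt_re (m := 1) (fun n _ => ?_) hs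
  have := abs_cmul_le h n
  rw [Complex.norm_intCast]
  exact_mod_cast this

lemma cmul_one_apply {n : ℕ} (hn : n ≠ 0) : cmul 1 n = 1 := by
  rw [cmul_apply _ hn]
  simp [Finsupp.prod]

lemma abs_kron_le (D : ℤ) {p : ℕ} (hp : p.Prime) : |kron D p| ≤ 1 := by
  rcases kron_trichotomy D hp with h | h | h <;> simp [h]

lemma lseries_mul_intCast (f g : ArithmeticFunction ℤ) {s : ℂ}
    (hf : LSeriesSummable (fun n => (f n : ℂ)) s) (hg : LSeriesSummable (fun n => (g n : ℂ)) s) :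
    LSeriesSummable (fun n => ((f * g) n : ℂ)) s ∧
    LSeries (fun n => ((f * g) n : ℂ)) s =
      LSeries (fun n => (f n : ℂ)) s * LSeries (fun n => (g n : ℂ)) s := by
  have e : (fun n => ((f * g) n : ℂ)) =
      LSeries.convolution (fun n => (f n : ℂ)) (fun n => (g n : ℂ)) := by
    ext n
    rw [ArithmeticFunction.mul_apply, LSeries.convolution_def]
    push_cast; rfl
  rw [e]
  exact ⟨hf.convolution hg, LSeries_convolution' hf hg⟩

/-- The values at the primes of the genus character attached to `k`. -/
def genusPrime (k D : ℤ) (q : ℕ) : ℤ := if (q : ℤ) ∣ k then kron D q else kron k q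

lemma abs_genusPrime_le (k D : ℤ) {p : ℕ} (hp : p.Prime) : |genusPrime k D p| ≤ 1 := by
  unfold genusPrime
  split_ifs <;> exact abs_kron_le _ hp

section

variable (K F₁ F₂ : Type*) [Field K] [NumberField K] [Field F₁] [NumberField F₁] [Field F₂]
  [NumberField F₂]

lemma idealFun_mul_idealFun (hK : Module.finrank ℚ K = 2) (h₁ : Module.finrank ℚ F₁ = 2)
    (h₂ : Module.finrank ℚ F₂ = 2) {k₀ k₁ d' : ℤ} (hdK : discr K = k₀ * d')
    (hd₁ : discr F₁ = k₀ * k₁) (hd₂ : discr F₂ = k₁ * d') :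
    idealFun F₁ * idealFun F₂ = cmul 1 * (cmul 1 *
      (cmul (genusPrime (k₀ * k₁) (k₁ * d'))).pmul (idealFun K)) := by
  rw [idealFun_eq F₁ h₁, idealFun_eq F₂ h₂, idealFun_eq K hK, hdK, hd₁, hd₂,
    pmul_cmul _ 1 _ _ rfl, ← mul_one (cmul (kron (k₀ * d'))), pmul_cmul _ _ _ _ rfl]
  have h1 : (cmul (genusPrime (k₀ * k₁) (k₁ * d'))).pmul 1 = 1 := by
    ext n
    rcases eq_or_ne n 1 with rfl | hn
    · simp [cmul_one]
    · simp [ArithmeticFunction.one_apply_ne hn]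
  rw [h1, mul_one, mul_one]
  have h2 : cmul (kron (k₀ * k₁)) * cmul (kron (k₁ * d')) =
      cmul (genusPrime (k₀ * k₁) (k₁ * d')) *
        cmul (genusPrime (k₀ * k₁) (k₁ * d') * kron (k₀ * d')) := by
    refine cmul_mul_cmul_congr fun p hp => ?_
    simp only [Pi.mul_apply, genusPrime]
    split_ifs with hpk
    · refine Or.inr ⟨?_, rfl⟩
      rw [(kron_eq_zero_iff hp).2 hpk]
      rw [kron_mul, kron_mul]
      rcases (Nat.prime_iff_prime_int.1 hp).dvd_or_dvd hpk with h | h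
      · simp [(kron_eq_zero_iff hp).2 h]
      · simp [(kron_eq_zero_iff hp).2 h]
    · refine Or.inl ⟨rfl, ?_⟩
      have hk0 : kron k₀ p = 1 ∨ kron k₀ p = -1 := by
        rcases kron_trichotomy k₀ hp with h | h
        · exact absurd (((kron_eq_zero_iff hp).1 h).mul_right _) hpk
        · exact h
      rw [kron_mul, kron_mul, kron_mul]
      rcases hk0 with h | h <;> rw [h] <;> ring
  calc _ = cmul 1 * (cmul 1 * (cmul (kron (k₀ * k₁)) * cmul (kron (k₁ * d')))) := by ring
    _ = _ := by rw [h2]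

/-- The genus `L`-series. -/
noncomputable def genusSeries (k D : ℤ) (s : ℝ) : ℝ :=
  ∑' n : ℕ, (cmul (genusPrime k D) n * idealFun K n : ℤ) * (n : ℝ) ^ (-s)

lemma lseriesSummable_idealFun (hK : Module.finrank ℚ K = 2) {s : ℂ} (hs : 1 < s.re) :
    LSeriesSummable (fun n => (idealFun K n : ℂ)) s := by
  rw [idealFun_eq K hK]
  exact (lseries_mul_intCast _ _ (lseriesSummable_cmul (fun p _ => by simp) hs)
    (lseriesSummable_cmul (fun p hp => abs_kron_le _ hp) hs)).1

lemma summable_idealFun (hK : Module.finrank ℚ K = 2) {s : ℝ} (hs : 1 < s) :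
    Summable fun n : ℕ => (idealFun K n : ℝ) * (n : ℝ) ^ (-s) := by
  have h := (lseriesSummable_idealFun K hK (s := s) (by simpa using hs)).norm
  refine h.congr fun n => ?_
  rcases eq_or_ne n 0 with rfl | hn
  · simp
  have h0 : 0 ≤ idealFun K n := by rw [idealFun_apply K hn]; positivity
  rw [LSeries.norm_term_eq, if_neg hn, Complex.norm_intCast, Complex.ofReal_re,
    rpow_neg (Nat.cast_nonneg n), abs_of_nonneg (by exact_mod_cast h0), div_eq_mul_inv]

lemma lseries_pmul (hK : Module.finrank ℚ K = 2) (k D : ℤ) {s : ℝ} (hs : 1 < s) :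
    LSeriesSummable (fun n => (((cmul (genusPrime k D)).pmul (idealFun K) n : ℤ) : ℂ)) s ∧
    LSeries (fun n => (((cmul (genusPrime k D)).pmul (idealFun K) n : ℤ) : ℂ)) s =
      genusSeries K k D s := by
  constructor
  · refine Summable.of_norm_bounded (summable_idealFun K hK hs) fun n => ?_
    rcases eq_or_ne n 0 with rfl | hn
    · simp
    have h0 : 0 ≤ idealFun K n := by rw [idealFun_apply K hn]; positivity
    rw [LSeries.norm_term_eq, if_neg hn, Complex.norm_intCast, Complex.ofReal_re,
      rpow_neg (Nat.cast_nonneg n), div_eq_mul_inv]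
    gcongr
    rw [ArithmeticFunction.pmul_apply]
    push_cast
    rw [abs_mul]
    have h1 : |(cmul (genusPrime k D) n : ℝ)| ≤ 1 := by
      exact_mod_cast abs_cmul_le (fun p hp => abs_genusPrime_le k D hp) n
    have h2 : (0 : ℝ) ≤ idealFun K n := by exact_mod_cast h0
    rw [abs_of_nonneg h2]
    nlinarith
  · rw [genusSeries, Complex.ofReal_tsum]
    refine tsum_congr fun n => ?_
    rcases eq_or_ne n 0 with rfl | hn
    · simp
    rw [LSeries.term_of_ne_zero hn, rpow_neg (Nat.cast_nonneg n), ArithmeticFunction.pmul_apply,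
      div_eq_mul_inv]
    push_cast
    rw [Complex.ofReal_cpow (Nat.cast_nonneg n)]
    simp

open Filter Topology in
/-- The value at `1` of the genus series. -/
lemma tendsto_genusSeries (hK : Module.finrank ℚ K = 2) (h₁ : Module.finrank ℚ F₁ = 2)
    (h₂ : Module.finrank ℚ F₂ = 2) {k₀ k₁ d' : ℤ} (hdK : discr K = k₀ * d')
    (hd₁ : discr F₁ = k₀ * k₁) (hd₂ : discr F₂ = k₁ * d') :
    Tendsto (genusSeries K (k₀ * k₁) (k₁ * d')) (𝓝[>] 1)
      (𝓝 (dedekindZeta_residue F₁ * dedekindZeta_residue F₂)) := by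
  have key : ∀ s : ℝ, 1 < s → dedekindZeta F₁ s * dedekindZeta F₂ s =
      riemannZeta s * (riemannZeta s * genusSeries K (k₀ * k₁) (k₁ * d') s) := by
    intro s hs
    have hs' : 1 < (s : ℂ).re := by simpa using hs
    have hone : LSeriesSummable (fun n => (cmul 1 n : ℂ)) s :=
      lseriesSummable_cmul (fun p _ => by simp) hs'
    have hζ : LSeries (fun n => (cmul 1 n : ℂ)) s = riemannZeta s := by
      rw [← LSeries_one_eq_riemannZeta hs']
      exact LSeries_congr (fun {n} hn => by rw [cmul_one_apply hn]; simp) _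
    have hp := lseries_pmul K hK (k₀ * k₁) (k₁ * d') hs
    have hm1 := lseries_mul_intCast _ _ hone hp.1
    have hm2 := lseries_mul_intCast _ _ hone hm1.1
    rw [← lseries_idealFun, ← lseries_idealFun, ← (lseries_mul_intCast _ _
      (lseriesSummable_idealFun F₁ h₁ hs') (lseriesSummable_idealFun F₂ h₂ hs')).2,
      idealFun_mul_idealFun K F₁ F₂ hK h₁ h₂ hdK hd₁ hd₂, hm2.2, hm1.2, hp.2, hζ]
  have hz : Tendsto (fun s : ℝ => ((s : ℂ) - 1) * riemannZeta s) (𝓝[>] 1) (𝓝 1) := by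
    refine riemannZeta_residue_one.comp ?_
    rw [tendsto_nhdsWithin_iff]
    refine ⟨?_, ?_⟩
    · have := (Complex.continuous_ofReal.tendsto (1 : ℝ))
      rw [Complex.ofReal_one] at this
      exact this.mono_left nhdsWithin_le_nhds
    · filter_upwards [self_mem_nhdsWithin] with s hs
      have hs' : (1 : ℝ) < s := hs
      simp only [Set.mem_compl_iff, Set.mem_singleton_iff]
      exact_mod_cast hs'.ne'
  have h1 := tendsto_sub_one_mul_dedekindZeta_nhdsGT F₁
  have h2 := tendsto_sub_one_mul_dedekindZeta_nhdsGT F₂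
  have h3 := (h1.mul h2).div (hz.mul hz) (by simp)
  have h4 : Tendsto (fun s : ℝ => (genusSeries K (k₀ * k₁) (k₁ * d') s : ℂ)) (𝓝[>] 1)
      (𝓝 ((dedekindZeta_residue F₁ * dedekindZeta_residue F₂ : ℝ) : ℂ)) := by
    rw [mul_one, div_one, ← Complex.ofReal_mul] at h3
    refine h3.congr' ?_
    filter_upwards [self_mem_nhdsWithin] with s hs
    have hs' : (1 : ℝ) < s := hs
    have hz0 : riemannZeta s ≠ 0 := riemannZeta_ne_zero_of_one_lt_re (by simpa using hs')
    have hs0 : (s : ℂ) - 1 ≠ 0 := by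
      rw [sub_ne_zero]; exact_mod_cast hs'.ne'
    have := key s hs'
    simp only [Pi.div_apply]
    rw [div_eq_iff (by positivity)]
    linear_combination ((s : ℂ) - 1) ^ 2 * this
  have h5 := (Complex.continuous_re.tendsto _).comp h4
  simpa only [Function.comp_def, Complex.ofReal_re] using h5

end

end TwoClassesPerGenus

namespace TwoClassesPerGenus

open NumberField

lemma IsFund.of_mul {p : ℕ} {D : ℤ} (hp4 : p % 4 = 1) (h : IsFund (p * D)) :
    IsFund D := by
  have key : ∀ m : ℤ, ((p * m) % 4 = 0 ∨ (p * m) % 4 = 1) ↔ (m % 4 = 0 ∨ m % 4 = 1) := by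
    intro m
    have : (p : ℤ) % 4 = 1 := by omega
    rw [Int.mul_emod, this, one_mul, Int.emod_emod]
  refine ⟨(key D).1 h.1, fun q hq m hm h4 => h.2 q hq (p * m) (by rw [hm]; ring) ((key m).2 h4)⟩

lemma IsFund.mul {p : ℕ} (hp : p.Prime) {D : ℤ} (hp4 : p % 4 = 1) (hpD : ¬ (p : ℤ) ∣ D)
    (h : IsFund D) : IsFund (p * D) := by
  have key : ∀ m : ℤ, ((p * m) % 4 = 0 ∨ (p * m) % 4 = 1) ↔ (m % 4 = 0 ∨ m % 4 = 1) := by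
    intro m
    have : (p : ℤ) % 4 = 1 := by omega
    rw [Int.mul_emod, this, one_mul, Int.emod_emod]
  refine ⟨(key D).2 h.1, fun q hq m hm h4 => ?_⟩
  have hp0 : (p : ℤ) ≠ 0 := by exact_mod_cast hp.ne_zero
  rcases eq_or_ne p q with rfl | hne
  · refine hpD ⟨m, mul_left_cancel₀ hp0 ?_⟩
    rw [hm]; ring
  · have hcop : IsCoprime (p : ℤ) ((q : ℤ) ^ 2) :=
      (Nat.isCoprime_iff_coprime.2 ((Nat.coprime_primes hp hq).2 hne)).pow_right
    obtain ⟨m', rfl⟩ := hcop.dvd_of_dvd_mul_left (⟨D, hm.symm⟩ : (p : ℤ) ∣ q ^ 2 * m)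
    exact h.2 q hq m' (mul_left_cancel₀ hp0 (by rw [hm]; ring)) ((key m').1 h4)

lemma isFund_one : IsFund 1 := by
  refine ⟨by norm_num, fun q hq m hm _ => ?_⟩
  have h1 : (q : ℤ) ∣ 1 := ⟨q * m, by rw [hm]; ring⟩
  have h2 : (q : ℤ) ∣ ((1 : ℕ) : ℤ) := by simpa using h1
  exact hq.one_lt.ne' (Nat.dvd_one.1 (Int.natCast_dvd_natCast.1 h2))

lemma discr_eq_of_sq_eq {F : Type*} [Field F] [NumberField F] (hF : Module.finrank ℚ F = 2) {D : ℤ}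
    (hD : IsFund D) (hsq : ¬ IsSquare D) {δ : F} (hδ : δ ^ 2 = D) : discr F = D := by
  obtain ⟨k, hk⟩ : ∃ k : ℤ, D ^ 2 - D = 4 * k := by
    rcases hD.1 with h0 | h0
    · obtain ⟨j, rfl⟩ : ∃ j, D = 4 * j := ⟨D / 4, by omega⟩
      exact ⟨4 * j ^ 2 - j, by ring⟩
    · obtain ⟨j, rfl⟩ : ∃ j, D = 4 * j + 1 := ⟨D / 4, by omega⟩
      exact ⟨4 * j ^ 2 + j, by ring⟩
  have hk' : (D : F) ^ 2 - D = 4 * k := by exact_mod_cast hk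
  have hξ : IsIntegral ℤ ((δ + D) / 2) := by
    refine ⟨Polynomial.X ^ 2 - Polynomial.C D * Polynomial.X + Polynomial.C k, ?_, ?_⟩
    · monicity!
    · simp only [Polynomial.eval₂_add, Polynomial.eval₂_sub, Polynomial.eval₂_mul,
        Polynomial.eval₂_pow, Polynomial.eval₂_X, algebraMap_int_eq]
      rw [Polynomial.eval₂_C, Polynomial.eval₂_C, eq_intCast, eq_intCast]
      linear_combination (1 / 4 : F) * hδ - (1 / 4 : F) * hk'
  obtain ⟨θ, t, n, h⟩ := exists_isQuadBasis F hF
  obtain ⟨x, y, hxy⟩ := h.exists_eq ⟨_, hξ⟩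
  have hxy' : (δ + D) / 2 = x + y * algebraMap (𝓞 F) F θ := by
    have := congrArg (algebraMap (𝓞 F) F) hxy
    simp only [map_add, map_mul, map_intCast] at this
    exact this
  have hδ' : δ = algebraMap (𝓞 F) F (2 * x - D + 2 * y * θ) := by
    simp only [map_add, map_sub, map_mul, map_intCast, map_ofNat]
    linear_combination 2 * hxy'
  have h2 : (2 * x - D + 2 * y * θ : 𝓞 F) ^ 2 = D := by
    rw [hδ'] at hδ
    refine FaithfulSMul.algebraMap_injective (𝓞 F) F ?_
    rw [map_pow, hδ, map_intCast]
  obtain ⟨h3, h4⟩ := (h.ext_iff ((2 * x - D) ^ 2 - 4 * y ^ 2 * n)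
    (4 * (2 * x - D) * y + 4 * y ^ 2 * t)
    D 0).1 (by
      push_cast
      linear_combination h2 - 4 * (y : 𝓞 F) ^ 2 * h.sq)
  have hy : y ≠ 0 := by
    rintro rfl
    exact hsq ⟨2 * x - D, by linear_combination -h3⟩
  have h5 : 2 * x - D = -(y * t) := by
    have : y * (2 * x - D + y * t) = 0 := by linarith
    rcases mul_eq_zero.1 this with h | h
    · exact absurd h hy
    · linarith
  have h6 : D = y ^ 2 * (t ^ 2 - 4 * n) := by
    rw [h5] at h3
    linear_combination -h3
  have hy1 : y.natAbs = 1 := by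
    by_contra hne
    obtain ⟨q, hq, hqy⟩ := Nat.exists_prime_and_dvd hne
    obtain ⟨y', rfl⟩ := Int.natCast_dvd.2 hqy
    exact hD.2 q hq ((y' * t) ^ 2 - 4 * (y' ^ 2 * n)) (by rw [h6]; ring) (sq_sub_four_mul_emod _ _)
  have hy2 : y ^ 2 = 1 := by
    rw [← Int.natAbs_sq, hy1]; norm_num
  rw [h.discr_eq, h6, hy2, one_mul]

/-- Every nonsquare fundamental discriminant is the discriminant of a quadratic field. -/
lemma exists_quadField {D : ℤ} (hD : IsFund D) (hsq : ¬ IsSquare D) :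
    ∃ (F : Type) (_ : Field F) (_ : NumberField F), Module.finrank ℚ F = 2 ∧ discr F = D := by
  have hfact : Fact (∀ r : ℚ, r ^ 2 ≠ (D : ℚ) + 0 * r) := ⟨fun r hr => hsq (by
    rw [← Rat.isSquare_intCast_iff]
    exact ⟨r, by linear_combination -hr⟩)⟩
  let F := QuadraticAlgebra ℚ (D : ℚ) 0
  have hfin : Module.finrank ℚ F = 2 := QuadraticAlgebra.finrank_eq_two _ _
  have hchar : CharZero F := algebraRat.charZero F
  have hfd : FiniteDimensional ℚ F := Module.finite_of_finrank_eq_succ hfin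
  have hNF : NumberField F := { to_charZero := hchar, to_finiteDimensional := by convert hfd }
  have hfin' : Module.finrank ℚ F = 2 := by convert hfin
  refine ⟨F, inferInstance, hNF, hfin', discr_eq_of_sq_eq hfin' hD hsq
    (δ := (QuadraticAlgebra.omega : QuadraticAlgebra ℚ (D : ℚ) 0)) ?_⟩
  rw [pow_two, QuadraticAlgebra.omega_mul_omega_eq_add]
  simp

section signature

variable (F : Type*) [Field F] [NumberField F]

open InfinitePlace Units

lemma places_of_discr_neg (hF : Module.finrank ℚ F = 2) (hD : discr F < 0) :
    nrRealPlaces F = 0 ∧ nrComplexPlaces F = 1 := by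
  have h1 := card_add_two_mul_card_eq_rank F
  have h2 := sign_discr F
  rw [hF] at h1
  rw [Int.sign_eq_neg_one_of_neg hD] at h2
  have : nrComplexPlaces F ≤ 1 := by omega
  interval_cases h : nrComplexPlaces F
  · norm_num at h2
  · omega

lemma places_of_discr_pos (hF : Module.finrank ℚ F = 2) (hD : 0 < discr F) :
    nrRealPlaces F = 2 ∧ nrComplexPlaces F = 0 := by
  have h1 := card_add_two_mul_card_eq_rank F
  have h2 := sign_discr F
  rw [hF] at h1
  rw [Int.sign_eq_one_of_pos hD] at h2
  have : nrComplexPlaces F ≤ 1 := by omega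
  interval_cases h : nrComplexPlaces F
  · omega
  · norm_num at h2

variable {F}

lemma torsionOrder_eq_two (h : ∀ x : (𝓞 F)ˣ, x ∈ torsion F → x = 1 ∨ x = -1) :
    torsionOrder F = 2 := by
  classical
  let := Fintype.ofFinite (torsion F)
  rw [torsionOrder, Nat.card_eq_fintype_card]
  refine (Finset.card_eq_two.2 ⟨1, ⟨-1, neg_one_mem_torsion⟩,
    by simp [← Subtype.coe_ne_coe], Finset.ext fun x ↦ ⟨fun _ ↦ ?_, fun _ ↦ Finset.mem_univ _⟩⟩)
  rw [Finset.mem_insert, Finset.mem_singleton, ← Subtype.val_inj, ← Subtype.val_inj]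
  exact h x x.2

lemma IsQuadBasis.isUnit_eq_one_or {θ : 𝓞 F} {t n : ℤ} (h : IsQuadBasis θ t n)
    (hD : discr F < -4) (x : (𝓞 F)ˣ) : x = 1 ∨ x = -1 := by
  obtain ⟨a, b, hab⟩ := h.exists_eq x
  have h1 := h.absNorm_span a b
  rw [← hab, Ideal.span_singleton_eq_top.2 x.isUnit, Ideal.absNorm_top] at h1
  rw [h.discr_eq] at hD
  have h2 : a ^ 2 + t * a * b + n * b ^ 2 ≤ 1 := by omega
  have hb : b = 0 := by
    by_contra hb
    have : 1 ≤ b ^ 2 := Int.one_le_abs hb |> fun h => by nlinarith [sq_abs b]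
    nlinarith [sq_nonneg (2 * a + t * b)]
  subst hb
  have h3 : a.natAbs = 1 := by
    have : (a ^ 2).natAbs = 1 := by simpa using h1.symm
    rw [Int.natAbs_pow] at this
    exact (Nat.pow_eq_one.1 this).resolve_right two_ne_zero
  rcases Int.natAbs_eq a with h4 | h4 <;> rw [h3] at h4 <;> subst h4
  · left; ext1; simpa using hab
  · right; ext1; simpa using hab

lemma dedekindZeta_residue_of_neg (hF : Module.finrank ℚ F = 2) (hD : discr F < -4) :
    dedekindZeta_residue F = π * classNumber F / √|(discr F : ℝ)| := by
  obtain ⟨θ, t, n, h⟩ := exists_isQuadBasis F hF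
  obtain ⟨h1, h2⟩ := places_of_discr_neg F hF (by omega)
  have hr : Units.rank F = 0 := by
    rw [Units.rank, card_eq_nrRealPlaces_add_nrComplexPlaces, h1, h2]
  have hreg : regulator F = 1 := by
    have hcard : Fintype.card (InfinitePlace F) = 1 := by
      rw [card_eq_nrRealPlaces_add_nrComplexPlaces, h1, h2]
    obtain ⟨w, hw⟩ := Fintype.card_eq_one_iff.1 hcard
    have he : IsEmpty {v : InfinitePlace F // v ≠ w} := ⟨fun v => v.2 (hw v.1)⟩
    have he' : IsEmpty (Fin (Units.rank F)) := by rw [hr]; infer_instance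
    classical
    rw [regulator_eq_det F w (Equiv.equivOfIsEmpty _ _), Matrix.det_isEmpty, abs_one]
  rw [dedekindZeta_residue_def, h1, h2, hreg,
    torsionOrder_eq_two (fun x _ => h.isUnit_eq_one_or hD x)]
  push_cast
  field_simp

lemma dedekindZeta_residue_of_pos (hF : Module.finrank ℚ F = 2) {c m : ℤ} (hc1 : 1 ≤ c)
    (hc2 : c ≤ 16) (hk : c ^ 2 + 4 = m ^ 2 * discr F) (hodd : discr F % 2 = 1)
    (hcm : 2 ∣ c - m) : ∃ (α : ℝ) (t : ℤ), 1 < α ∧ α + α⁻¹ = t ∧ log α ≤ 6 ∧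
      dedekindZeta_residue F = log α * classNumber F / √(discr F : ℝ) := by
  have hD : 0 < discr F := by
    by_contra hcon
    nlinarith [sq_nonneg c, sq_nonneg m]
  obtain ⟨θ, t, n, h⟩ := exists_isQuadBasis F hF
  obtain ⟨h1, h2⟩ := places_of_discr_pos F hF hD
  have hcard : Fintype.card (InfinitePlace F) = 2 := by
    rw [card_eq_nrRealPlaces_add_nrComplexPlaces, h1, h2]
  have hr : Units.rank F = 1 := by rw [Units.rank, hcard]
  have hreal : ∀ w : InfinitePlace F, IsReal w := by
    intro w
    by_contra hw
    rw [not_isReal_iff_isComplex] at hw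
    have h3 : 0 < nrComplexPlaces F := by
      classical
      rw [nrComplexPlaces, Fintype.card_pos_iff]
      exact ⟨⟨w, hw⟩⟩
    omega
  rw [← Nat.card_eq_fintype_card] at hcard
  obtain ⟨w', w, hne, huniv⟩ := Nat.card_eq_two_iff.1 hcard
  have hw : ∀ v : {v : InfinitePlace F // v ≠ w'}, v = ⟨w, hne.symm⟩ := by
    rintro ⟨v, hv⟩
    have : v ∈ ({w', w} : Set (InfinitePlace F)) := huniv ▸ Set.mem_univ v
    exact Subtype.ext (this.resolve_left hv)
  let U : Unique {v : InfinitePlace F // v ≠ w'} := ⟨⟨⟨w, hne.symm⟩⟩, hw⟩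
  let U' : Unique (Fin (Units.rank F)) := by rw [hr]; infer_instance
  let e : {v : InfinitePlace F // v ≠ w'} ≃ Fin (Units.rank F) := Equiv.ofUnique _ _
  have hlog : ∀ u : Fin (Units.rank F) → (𝓞 F)ˣ,
      regOfFamily u = |log (w ((u (e default) : 𝓞 F) : F))| := by
    intro u
    classical
    rw [regOfFamily_eq_det u w' e, Matrix.det_unique, Matrix.of_apply]
    congr 1
    have : ((default : {v : InfinitePlace F // v ≠ w'}) : InfinitePlace F) = w := rfl
    rw [this, mult, if_pos (hreal w), Nat.cast_one, one_mul]
  let σ : F →+* ℝ := embedding_of_isReal (hreal w)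
  have hσ : ∀ x : F, w x = |σ x| := fun x => (norm_embedding_of_isReal (hreal w) x).symm
  have htors : torsionOrder F = 2 := by
    refine torsionOrder_eq_two fun x hx => ?_
    have hx1 := (mem_torsion F).1 hx w
    rw [hσ] at hx1
    rcases (abs_eq zero_le_one).1 hx1 with h3 | h3
    · left
      ext1
      refine FaithfulSMul.algebraMap_injective (𝓞 F) F (σ.injective ?_)
      rw [Units.val_one, map_one, map_one]
      exact h3
    · right
      ext1
      refine FaithfulSMul.algebraMap_injective (𝓞 F) F (σ.injective ?_)
      rw [Units.val_neg, Units.val_one, map_neg, map_neg, map_one, map_one]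
      exact h3
  let ι : 𝓞 F →+* ℝ := σ.comp (algebraMap (𝓞 F) F)
  have hι : ∀ x : 𝓞 F, w (x : F) = |ι x| := fun x => hσ _
  have hreg : regulator F ≤ 3 := by
    rw [h.discr_eq] at hk hodd
    have ht : t % 2 = 1 := by
      rcases Int.emod_two_eq_zero_or_one t with h0 | h0
      · obtain ⟨j, rfl⟩ : ∃ j, t = 2 * j := ⟨t / 2, by omega⟩
        ring_nf at hodd
        omega
      · exact h0
    obtain ⟨g, hg⟩ : ∃ g, c - m * t = 2 * g := by
      obtain ⟨j, rfl⟩ : ∃ j, t = 2 * j + 1 := ⟨t / 2, by omega⟩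
      obtain ⟨l, hl⟩ := hcm
      exact ⟨l - m * j, by linear_combination hl⟩
    have hg2 : g ^ 2 - c * g - m ^ 2 * n = 1 := by
      have : 4 * (g ^ 2 - c * g - m ^ 2 * n) = 4 := by
        linear_combination (-2 * g + c + m * t) * hg - hk
      omega
    have hη : (m * θ + g : 𝓞 F) ^ 2 = c * (m * θ + g) + 1 := by
      have e1 := congrArg (Int.cast : ℤ → 𝓞 F) hg
      have e2 := congrArg (Int.cast : ℤ → 𝓞 F) hg2
      push_cast at e1 e2
      linear_combination (m : 𝓞 F) ^ 2 * h.sq - m * θ * e1 + e2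
    generalize (m * θ + g : 𝓞 F) = η at hη
    let u : (𝓞 F)ˣ := ⟨η, η - c, by linear_combination hη, by linear_combination hη⟩
    have hu := regOfFamily_div_regulator (K := F) fun _ => u
    rw [hlog, hι] at hu
    have hη' : (ι η) ^ 2 = c * ι η + 1 := by
      rw [← map_pow, hη]
      simp
    change abs (log |ι η|) / regulator F = _ at hu
    have hc1' : (1 : ℝ) ≤ c := by exact_mod_cast hc1
    have hc2' : (c : ℝ) ≤ 16 := by exact_mod_cast hc2
    have hx2 : |ι η| ^ 2 ≤ c * |ι η| + 1 := by
      rw [sq_abs, hη']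
      nlinarith [le_abs_self (ι η)]
    have hx3 : 1 ≤ |ι η| ^ 2 + c * |ι η| := by
      rw [sq_abs, hη']
      nlinarith [neg_abs_le (ι η)]
    have hx0 : 0 ≤ |ι η| := abs_nonneg _
    have hx4 : |ι η| ≤ 17 := by
      by_contra hcon
      push Not at hcon
      nlinarith
    have hx5 : 1 / 17 ≤ |ι η| := by
      by_contra hcon
      push Not at hcon
      nlinarith
    have h17 : log 17 ≤ 3 := by
      rw [log_le_iff_le_exp (by norm_num)]
      have := exp_one_gt_d9
      have h3 : exp 3 = exp 1 ^ 3 := by rw [← exp_nat_mul]; norm_num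
      rw [h3]
      calc (17 : ℝ) ≤ 2.7 ^ 3 := by norm_num
        _ ≤ _ := by gcongr; linarith
    have hlog3 : abs (log |ι η|) ≤ 3 := by
      rw [abs_le]
      constructor
      · have := log_le_log (by norm_num) hx5
        rw [one_div, log_inv] at this
        linarith
      · exact (log_le_log (by linarith) hx4).trans h17
    have hne0 : abs (log |ι η|) ≠ 0 := by
      rw [abs_ne_zero]
      refine log_ne_zero_of_pos_of_ne_one (by linarith) fun h1 => ?_
      rcases (abs_eq zero_le_one).1 h1 with h3 | h3 <;> rw [h3] at hη' <;> linarith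
    have hidx : (1 : ℝ) ≤ abs (log |ι η|) / regulator F := by
      have : abs (log |ι η|) / regulator F ≠ 0 := div_ne_zero hne0 (regulator_ne_zero F)
      rw [hu] at this ⊢
      exact_mod_cast Nat.one_le_iff_ne_zero.2 (by exact_mod_cast this)
    rw [le_div_iff₀ (regulator_pos F)] at hidx
    linarith
  have hR := hlog (fundSystem F)
  rw [← regulator_eq_regOfFamily_fundSystem, hι] at hR
  generalize fundSystem F (e default) = ε at hR
  obtain ⟨a, b, hab⟩ := h.exists_eq (ε : 𝓞 F)
  have hN := h.absNorm_span a b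
  rw [← hab, Ideal.span_singleton_eq_top.2 ε.isUnit, Ideal.absNorm_top] at hN
  have hN2 : (a ^ 2 + t * a * b + n * b ^ 2) ^ 2 = 1 := by
    rw [← Int.natAbs_sq, ← hN]; norm_num
  have hquad : (ε : 𝓞 F) ^ 2 = (2 * a + t * b : ℤ) * ε - (a ^ 2 + t * a * b + n * b ^ 2 : ℤ) := by
    rw [hab]
    push_cast
    linear_combination (b : 𝓞 F) ^ 2 * h.sq
  generalize a ^ 2 + t * a * b + n * b ^ 2 = N at hN2 hquad
  generalize 2 * a + t * b = T at hquad
  have hx : (ι ε) ^ 2 = T * ι ε - N := by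
    rw [← map_pow, hquad]; simp
  have hx0 : ι ε ≠ 0 := fun h0 => by
    rw [h0] at hx
    have : N = 0 := by
      have : (N : ℝ) = 0 := by linarith
      exact_mod_cast this
    rw [this] at hN2
    norm_num at hN2
  have hN2' : (N : ℝ) ^ 2 = 1 := by exact_mod_cast hN2
  have hsum : (ι ε) ^ 2 + ((ι ε) ^ 2)⁻¹ = (T ^ 2 - 2 * N : ℤ) := by
    have h3 : ι ε ^ 4 + 1 = (T ^ 2 - 2 * N) * ι ε ^ 2 := by
      linear_combination (ι ε ^ 2 + T * ι ε + N) * hx - hN2'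
    push_cast
    field_simp
    linear_combination h3
  refine ⟨exp (2 * regulator F), T ^ 2 - 2 * N, ?_, ?_, ?_, ?_⟩
  · rw [one_lt_exp_iff]
    have := regulator_pos F
    positivity
  · have hlogsq : log ((ι ε) ^ 2) = 2 * log |ι ε| := by
      rw [← sq_abs, log_pow]; norm_num
    have hpos : 0 < (ι ε) ^ 2 := by positivity
    rcases abs_choice (log |ι ε|) with h3 | h3
    · rw [hR, h3, ← hlogsq, exp_log hpos, hsum]
    · rw [hR, h3, mul_neg, ← hlogsq, exp_neg, exp_log hpos, inv_inv, add_comm, hsum]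
  · rw [log_exp]; linarith
  · rw [dedekindZeta_residue_def, h1, h2, htors, log_exp, abs_of_pos (by exact_mod_cast hD)]
    push_cast
    field_simp

end signature

end TwoClassesPerGenus

namespace TwoClassesPerGenus

open NumberField Ideal

section ambiguous

variable {F : Type*} [Field F] [NumberField F] {θ : 𝓞 F} {t n : ℤ}

namespace IsQuadBasis

lemma exists_dvd_dvd {R : Type*} [CommRing R] {θ : R} (h : IsQuadBasis θ t n)
    {U : ℕ} (hU : Squarefree U)
    (hUd : (U : ℤ) ∣ t ^ 2 - 4 * n) :
    ∃ (θ' : R) (t' n' : ℤ), IsQuadBasis θ' t' n' ∧ (U : ℤ) ∣ t' ∧ (U : ℤ) ∣ n' := by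
  rcases Nat.even_or_odd' U with ⟨V, rfl | rfl⟩
  · have hV : V % 2 = 1 := by
      by_contra hV
      have h2 : 2 * 2 ∣ 2 * V := Nat.mul_dvd_mul_left 2 (Nat.dvd_of_mod_eq_zero (by omega))
      have := hU 2 h2
      norm_num at this
    have ht : t % 2 = 0 := by
      obtain ⟨k, hk⟩ := hUd
      push_cast at hk
      have : Even (t ^ 2) := ⟨2 * n + V * k, by linear_combination hk⟩
      exact Int.even_iff.1 (Int.even_pow.1 this).1
    obtain ⟨s, rfl⟩ : ∃ s, t = 2 * s := ⟨t / 2, by omega⟩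
    have hcop : IsCoprime (2 : ℤ) V := by
      rw [show (2 : ℤ) = (2 : ℕ) by norm_num, Nat.isCoprime_iff_coprime, Nat.coprime_two_left,
        Nat.odd_iff]
      exact hV
    have hVd : (V : ℤ) ∣ s ^ 2 - n := by
      have h1 : (V : ℤ) ∣ 2 * (2 * (s ^ 2 - n)) := by
        refine (Dvd.intro_left (2 : ℤ) ?_).trans (hUd.trans (dvd_of_eq ?_))
        · push_cast; ring
        · ring
      exact hcop.symm.dvd_of_dvd_mul_left (hcop.symm.dvd_of_dvd_mul_left h1)
    refine ⟨_, _, _, h.shift (s + V * (s ^ 2 - n)), ?_, ?_⟩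
    · exact ⟨-(s ^ 2 - n), by push_cast; ring⟩
    · have e1 : (s + V * (s ^ 2 - n)) ^ 2 - 2 * s * (s + V * (s ^ 2 - n)) + n =
          (s ^ 2 - n) * (V ^ 2 * (s ^ 2 - n) - 1) := by ring
      rw [e1]
      push_cast
      refine hcop.mul_dvd ?_ (dvd_mul_of_dvd_left hVd _)
      obtain ⟨w, hw⟩ : ∃ w, V = 2 * w + 1 := ⟨V / 2, by omega⟩
      rcases Int.even_or_odd' (s ^ 2 - n) with ⟨m, hm | hm⟩
      · exact dvd_mul_of_dvd_left ⟨m, hm⟩ _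
      · refine dvd_mul_of_dvd_right ⟨(2 * w ^ 2 + 2 * w) * (2 * m + 1) + m, ?_⟩ _
        rw [hm, hw]; push_cast; ring
  · have hcop : IsCoprime ((2 * V + 1 : ℕ) : ℤ) 4 := by
      have : IsCoprime ((2 * V + 1 : ℕ) : ℤ) ((2 : ℕ) : ℤ) := by
        rw [Nat.isCoprime_iff_coprime, Nat.coprime_two_right]
        exact ⟨V, rfl⟩
      have h2 := this.pow_right (n := 2)
      norm_num at h2 ⊢
      exact h2
    refine ⟨_, _, _, h.shift (t * (V + 1)), ⟨-t, by push_cast; ring⟩, ?_⟩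
    refine hcop.dvd_of_dvd_mul_left ?_
    have e1 : 4 * ((t * (V + 1)) ^ 2 - t * (t * (V + 1)) + n) =
        ((2 * V + 1 : ℕ) : ℤ) * ((2 * V + 1 : ℕ) * t ^ 2) - (t ^ 2 - 4 * n) := by push_cast; ring
    rw [e1]
    exact dvd_sub (dvd_mul_right _ _) hUd

variable {U : ℕ}

lemma quadIdeal_mul_quadIdeal (h : IsQuadBasis θ t n) (hU : Squarefree U) (ht : (U : ℤ) ∣ t)
    (hn : (U : ℤ) ∣ n) {u v : ℕ} (hu : u ∣ U) (hv : v ∣ U) :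
    ∃ g w : ℕ, g ≠ 0 ∧ w ∣ U ∧ u * v = g ^ 2 * w ∧
      quadIdeal θ u * quadIdeal θ v = span {(g : 𝓞 F)} * quadIdeal θ w := by
  have hU0 : U ≠ 0 := hU.ne_zero
  have hu0 : u ≠ 0 := ne_zero_of_dvd_ne_zero hU0 hu
  obtain ⟨g, u', v', hg, hcop, rfl, rfl⟩ := Nat.exists_coprime' (m := u) (n := v)
    (Nat.gcd_pos_of_pos_left _ (Nat.pos_of_ne_zero hu0))
  have hguv : u' * v' * g ∣ U := by
    have := Nat.lcm_dvd hu hv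
    rwa [Nat.lcm_mul_right, hcop.lcm_eq_mul] at this
  refine ⟨g, u' * v', hg.ne', (dvd_mul_right _ _).trans hguv, by ring, ?_⟩
  obtain ⟨m, hm⟩ := (Int.natCast_dvd_natCast.2 hguv).trans hn
  have hgt : (g : ℤ) ∣ t := (Int.natCast_dvd_natCast.2 ((dvd_mul_left _ _).trans hguv)).trans ht
  have hgm : IsCoprime (g : ℤ) m := by
    rw [Int.isCoprime_iff_gcd_eq_one]
    by_contra hne
    obtain ⟨p, hp, hpd⟩ := Nat.exists_prime_and_dvd hne
    have h1 : (p : ℤ) ∣ g := (Int.natCast_dvd_natCast.2 hpd).trans (Int.gcd_dvd_left _ _)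
    have h2 : (p : ℤ) ∣ m := (Int.natCast_dvd_natCast.2 hpd).trans (Int.gcd_dvd_right _ _)
    refine h.not_sq_dvd hp (h1.trans hgt) ?_
    rw [hm, pow_two]
    push_cast
    exact mul_dvd_mul (dvd_mul_of_dvd_right h1 _) h2
  have := h.quadIdeal_mul (g := g) (u := u') (v := v') (m := m)
    (by rw [hm]; push_cast; ring) hgt (Nat.isCoprime_iff_coprime.2 hcop) hgm
  push_cast at this ⊢
  rw [mul_comm (u' : ℤ), mul_comm (v' : ℤ) (g : ℤ)]
  exact this

lemma quadIdeal_mul_self (h : IsQuadBasis θ t n) (hU : Squarefree U) (ht : (U : ℤ) ∣ t)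
    (hn : (U : ℤ) ∣ n) {u : ℕ} (hu : u ∣ U) :
    quadIdeal θ u * quadIdeal θ u = span {(u : 𝓞 F)} := by
  obtain ⟨g, w, hg, hw, he, hI⟩ := h.quadIdeal_mul_quadIdeal hU ht hn hu hu
  have hw1 : w = 1 := by
    have hdvd : g ∣ u := (Nat.pow_dvd_pow_iff two_ne_zero).1 ⟨w, by rw [pow_two, he]⟩
    obtain ⟨k, rfl⟩ := hdvd
    have hk : k * k = w := by
      have hg2 : 0 < g ^ 2 := by positivity
      exact Nat.eq_of_mul_eq_mul_left hg2 (by rw [← he]; ring)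
    have := hU k (hk ▸ hw)
    rw [Nat.isUnit_iff] at this
    rw [← hk, this]
  have hgu : u = g := by
    rw [hw1, mul_one, ← pow_two] at he
    exact Nat.pow_left_injective two_ne_zero he
  rw [hI, hw1, hgu, Nat.cast_one, quadIdeal_one, mul_top]

lemma absNorm_quadIdeal (h : IsQuadBasis θ t n) (hU : Squarefree U) (ht : (U : ℤ) ∣ t)
    (hn : (U : ℤ) ∣ n) {u : ℕ} (hu : u ∣ U) : absNorm (quadIdeal θ u) = u := by
  have h1 := congrArg absNorm (h.quadIdeal_mul_self hU ht hn hu)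
  rw [map_mul, Ideal.absNorm_span_natCast, RingOfIntegers.rank, h.finrank_eq, ← pow_two] at h1
  exact Nat.pow_left_injective two_ne_zero h1

lemma quadIdeal_ne_zero (h : IsQuadBasis θ t n) (hU : Squarefree U) (ht : (U : ℤ) ∣ t)
    (hn : (U : ℤ) ∣ n) {u : ℕ} (hu : u ∣ U) : quadIdeal θ (u : ℤ) ≠ 0 := by
  intro h0
  have h1 := h.absNorm_quadIdeal hU ht hn hu
  rw [h0, Ideal.zero_eq_bot, absNorm_bot] at h1
  exact ne_zero_of_dvd_ne_zero hU.ne_zero hu h1.symm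

end IsQuadBasis

/-- The binary quadratic form attached to `quadIdeal θ u`, where `θ` has trace `t` and norm `n`. -/
def qform (t n : ℤ) (u : ℕ) (x y : ℤ) : ℤ := u * x ^ 2 + t * x * y + n / u * y ^ 2

lemma mul_qform {u : ℕ} (hu : (u : ℤ) ∣ n) (x y : ℤ) :
    u * qform t n u x y = (u * x) ^ 2 + t * (u * x) * y + n * y ^ 2 := by
  obtain ⟨m, rfl⟩ := hu
  rcases Nat.eq_zero_or_pos u with rfl | h0
  · simp
  · rw [qform, Int.mul_ediv_cancel_left _ (by exact_mod_cast h0.ne')]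
    ring

lemma four_mul_qform {u : ℕ} (hu : (u : ℤ) ∣ n) (x y : ℤ) :
    4 * u * qform t n u x y = (2 * u * x + t * y) ^ 2 + -(t ^ 2 - 4 * n) * y ^ 2 := by
  linear_combination 4 * mul_qform (t := t) hu x y

lemma qform_pos {u : ℕ} (hu0 : u ≠ 0) (hu : (u : ℤ) ∣ n) (hd : t ^ 2 - 4 * n < 0) {x y : ℤ}
    (hxy : x ≠ 0 ∨ y ≠ 0) : 0 < qform t n u x y := by
  have h1 := four_mul_qform (t := t) hu x y
  have hu' : (0 : ℤ) < u := by exact_mod_cast Nat.pos_of_ne_zero hu0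
  have h2 : 0 < 4 * u * qform t n u x y := by
    rw [h1]
    rcases eq_or_ne y 0 with rfl | hy
    · have hx : x ≠ 0 := by simpa using hxy
      have : (2 * u * x + t * 0) ^ 2 + -(t ^ 2 - 4 * n) * 0 ^ 2 = (2 * u * x) ^ 2 := by ring
      rw [this]
      positivity
    · have : 0 < -(t ^ 2 - 4 * n) * y ^ 2 := mul_pos (by linarith) (by positivity)
      exact add_pos_of_nonneg_of_pos (sq_nonneg _) this
  exact pos_of_mul_pos_right h2 (by positivity)

namespace IsQuadBasis

variable {U : ℕ}

lemma eq_one_of_isPrincipal (h : IsQuadBasis θ t n) (hU : Squarefree U) (ht : (U : ℤ) ∣ t)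
    (hn : (U : ℤ) ∣ n) (hlt : 4 * (U : ℤ) < -(t ^ 2 - 4 * n)) {w : ℕ} (hw : w ∣ U)
    (hp : (quadIdeal θ (w : ℤ)).IsPrincipal) : w = 1 := by
  have hw0 : w ≠ 0 := ne_zero_of_dvd_ne_zero hU.ne_zero hw
  have hwn : (w : ℤ) ∣ n := (Int.natCast_dvd_natCast.2 hw).trans hn
  obtain ⟨⟨α, hα⟩⟩ := hp
  obtain ⟨a, y, rfl⟩ := h.exists_eq α
  rw [submodule_span_eq] at hα
  obtain ⟨x, rfl⟩ : (w : ℤ) ∣ a := (h.mem_quadIdeal hwn a y).1 (by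
    rw [hα]; exact mem_span_singleton_self _)
  have h1 := h.absNorm_span (w * x) y
  rw [← hα, h.absNorm_quadIdeal hU ht hn hw, ← mul_qform hwn, Int.natAbs_mul,
    Int.natAbs_natCast] at h1
  have h2 : (qform t n w x y).natAbs = 1 :=
    Nat.eq_of_mul_eq_mul_left (Nat.pos_of_ne_zero hw0) (by rw [mul_one, ← h1])
  have h3 := four_mul_qform (t := t) hwn x y
  have h4 : qform t n w x y ≤ 1 := by omega
  have hwU : (w : ℤ) ≤ U := by exact_mod_cast Nat.le_of_dvd (Nat.pos_of_ne_zero hU.ne_zero) hw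
  have hw1 : (1 : ℤ) ≤ w := by exact_mod_cast Nat.one_le_iff_ne_zero.2 hw0
  have hy : y = 0 := by
    by_contra hy
    have hy2 : 0 < y ^ 2 := by positivity
    nlinarith [sq_nonneg (2 * w * x + t * y)]
  rw [hy] at h2
  have : qform t n w x 0 = w * x ^ 2 := by rw [qform]; ring
  rw [this, Int.natAbs_mul, Int.natAbs_natCast] at h2
  exact Nat.eq_one_of_mul_eq_one_right h2

end IsQuadBasis

end ambiguous

end TwoClassesPerGenus

namespace TwoClassesPerGenus

open NumberField Ideal

section ambiguous

variable {F : Type*} [Field F] [NumberField F] {θ : 𝓞 F} {t n : ℤ} {U : ℕ}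

namespace IsQuadBasis

/-- The ideal class of `quadIdeal θ u`. -/
noncomputable def quadClass (h : IsQuadBasis θ t n) (hU : Squarefree U) (ht : (U : ℤ) ∣ t)
    (hn : (U : ℤ) ∣ n) (u : U.divisors) : ClassGroup (𝓞 F) :=
  ClassGroup.mk0 ⟨quadIdeal θ (u : ℕ), mem_nonZeroDivisors_iff_ne_zero.2
    (h.quadIdeal_ne_zero hU ht hn (Nat.dvd_of_mem_divisors u.2))⟩

lemma exists_quadClass_mul (h : IsQuadBasis θ t n) (hU : Squarefree U) (ht : (U : ℤ) ∣ t)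
    (hn : (U : ℤ) ∣ n) (u v : U.divisors) : ∃ (g : ℕ) (w : U.divisors), (u * v : ℕ) = g ^ 2 * w ∧
      h.quadClass hU ht hn u * h.quadClass hU ht hn v = h.quadClass hU ht hn w := by
  obtain ⟨g, w, hg, hw, he, hI⟩ := h.quadIdeal_mul_quadIdeal hU ht hn
    (Nat.dvd_of_mem_divisors u.2) (Nat.dvd_of_mem_divisors v.2)
  refine ⟨g, ⟨w, Nat.mem_divisors.2 ⟨hw, hU.ne_zero⟩⟩, he, ?_⟩
  rw [quadClass, quadClass, quadClass, ← map_mul, ClassGroup.mk0_eq_mk0_iff]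
  refine ⟨1, g, one_ne_zero, by exact_mod_cast hg, ?_⟩
  rw [span_singleton_one, top_mul]
  exact hI

lemma quadClass_mul_self (h : IsQuadBasis θ t n) (hU : Squarefree U) (ht : (U : ℤ) ∣ t)
    (hn : (U : ℤ) ∣ n) (u : U.divisors) :
    h.quadClass hU ht hn u * h.quadClass hU ht hn u = 1 := by
  rw [quadClass, ← map_mul, ClassGroup.mk0_eq_one_iff]
  change (quadIdeal θ ((u : ℕ) : ℤ) * quadIdeal θ ((u : ℕ) : ℤ)).IsPrincipal
  rw [h.quadIdeal_mul_self hU ht hn (Nat.dvd_of_mem_divisors u.2)]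
  exact ⟨⟨_, rfl⟩⟩

lemma quadClass_injective (h : IsQuadBasis θ t n) (hU : Squarefree U) (ht : (U : ℤ) ∣ t)
    (hn : (U : ℤ) ∣ n) (hlt : 4 * (U : ℤ) < -(t ^ 2 - 4 * n)) :
    Function.Injective (h.quadClass hU ht hn) := by
  intro u v huv
  obtain ⟨g, w, he, hw⟩ := h.exists_quadClass_mul hU ht hn u v
  rw [huv, quadClass_mul_self, eq_comm, quadClass, ClassGroup.mk0_eq_one_iff] at hw
  have hw1 := h.eq_one_of_isPrincipal hU ht hn hlt (Nat.dvd_of_mem_divisors w.2) hw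
  rw [hw1, mul_one] at he
  have aux : ∀ {a b c : ℕ}, a ∣ U → a * b = c ^ 2 → a ∣ c := by
    intro a b c ha hab
    exact ((hU.squarefree_of_dvd ha).dvd_pow_iff_dvd two_ne_zero).1 ⟨b, hab.symm⟩
  obtain ⟨k, hk⟩ := aux (Nat.dvd_of_mem_divisors u.2) he
  obtain ⟨l, hl⟩ := aux (Nat.dvd_of_mem_divisors v.2) ((mul_comm _ _).trans he)
  have hu0 : 0 < (u : ℕ) := Nat.pos_of_mem_divisors u.2
  have hv0 : 0 < (v : ℕ) := Nat.pos_of_mem_divisors v.2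
  have hug : (u : ℕ) ≤ g := Nat.le_of_dvd (by
    rcases Nat.eq_zero_or_pos g with rfl | h0
    · rw [zero_pow two_ne_zero] at he
      exact absurd he (by positivity)
    · exact h0) ⟨k, hk⟩
  have hvg : (v : ℕ) ≤ g := Nat.le_of_dvd (by omega) ⟨l, hl⟩
  ext
  nlinarith

lemma quadClass_surjective (h : IsQuadBasis θ t n) (hU : Squarefree U) (ht : (U : ℤ) ∣ t)
    (hn : (U : ℤ) ∣ n) (hlt : 4 * (U : ℤ) < -(t ^ 2 - 4 * n))
    (hh : classNumber F < 2 * U.divisors.card) :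
    Function.Surjective (h.quadClass hU ht hn) := by
  let S : Subgroup (ClassGroup (𝓞 F)) :=
    { carrier := Set.range (h.quadClass hU ht hn)
      mul_mem' := by
        rintro _ _ ⟨u, rfl⟩ ⟨v, rfl⟩
        obtain ⟨g, w, -, hw⟩ := h.exists_quadClass_mul hU ht hn u v
        exact ⟨w, hw.symm⟩
      one_mem' := by
        let u : U.divisors := ⟨1, Nat.one_mem_divisors.2 hU.ne_zero⟩
        obtain ⟨g, w, -, hw⟩ := h.exists_quadClass_mul hU ht hn u u
        exact ⟨w, by rw [← hw, quadClass_mul_self]⟩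
      inv_mem' := by
        rintro _ ⟨u, rfl⟩
        exact ⟨u, eq_inv_of_mul_eq_one_left (h.quadClass_mul_self hU ht hn u)⟩ }
  have hS : Nat.card S = U.divisors.card := by
    have := Nat.card_congr (Equiv.ofInjective _ (h.quadClass_injective hU ht hn hlt))
    rw [Nat.card_eq_fintype_card, Fintype.card_coe] at this
    exact this.symm
  have hi := S.card_mul_index
  rw [hS, Nat.card_eq_fintype_card] at hi
  change _ = classNumber F at hi
  have h1 : S.index = 1 := by
    have h2 : S.index ≠ 0 := fun h0 => by
      rw [h0, mul_zero] at hi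
      exact (classNumber_pos F).ne hi
    have h3 : S.index < 2 := by
      by_contra hcon
      push Not at hcon
      nlinarith
    omega
  rw [Subgroup.index_eq_one] at h1
  intro c
  have : c ∈ S := h1 ▸ Subgroup.mem_top c
  exact this

/-- Every nonzero ideal becomes principal after multiplication by exactly one `quadIdeal θ u`. -/
lemma existsUnique_isPrincipal (h : IsQuadBasis θ t n) (hU : Squarefree U) (ht : (U : ℤ) ∣ t)
    (hn : (U : ℤ) ∣ n) (hlt : 4 * (U : ℤ) < -(t ^ 2 - 4 * n))
    (hh : classNumber F < 2 * U.divisors.card) {J : Ideal (𝓞 F)} (hJ : J ≠ 0) :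
    ∃! u : U.divisors, (J * quadIdeal θ (u : ℕ)).IsPrincipal := by
  have key : ∀ u : U.divisors, (J * quadIdeal θ (u : ℕ)).IsPrincipal ↔
      h.quadClass hU ht hn u = (ClassGroup.mk0 ⟨J, mem_nonZeroDivisors_iff_ne_zero.2 hJ⟩)⁻¹ := by
    intro u
    rw [eq_inv_iff_mul_eq_one, mul_comm, quadClass, ← map_mul, ClassGroup.mk0_eq_one_iff]
    rfl
  simp only [key]
  exact Function.Bijective.existsUnique
    ⟨h.quadClass_injective hU ht hn hlt, h.quadClass_surjective hU ht hn hlt hh⟩ _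

/-- The nonzero vectors of all the forms `qform t n u`, `u ∣ U`. -/
abbrev FormVec (U : ℕ) : Type := U.divisors × {v : ℤ × ℤ // v ≠ 0}

/-- The value taken by the form at a vector. -/
def formVal (t n : ℤ) (x : FormVec U) : ℕ := (qform t n x.1 x.2.1.1 x.2.1.2).natAbs

/-- The algebraic integer attached to a vector. -/
def formElt {R : Type*} [CommRing R] (θ : R) (x : FormVec U) : R :=
  ((x.1 * x.2.1.1 : ℤ) : R) + (x.2.1.2 : ℤ) * θ

lemma exists_mul_quadIdeal (h : IsQuadBasis θ t n) (hU : Squarefree U) (ht : (U : ℤ) ∣ t)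
    (hn : (U : ℤ) ∣ n) (x : FormVec U) : ∃ J : Ideal (𝓞 F), absNorm J = formVal t n x ∧
      J * quadIdeal θ (x.1 : ℕ) = span {formElt θ x} := by
  have hu := Nat.dvd_of_mem_divisors x.1.2
  have hun : ((x.1 : ℕ) : ℤ) ∣ n := (Int.natCast_dvd_natCast.2 hu).trans hn
  have hmem : formElt θ x ∈ quadIdeal θ (x.1 : ℕ) :=
    (h.mem_quadIdeal hun _ _).2 (dvd_mul_right _ _)
  obtain ⟨J, hJ⟩ := Ideal.dvd_iff_le.2 ((span_singleton_le_iff_mem _).2 hmem)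
  rw [mul_comm] at hJ
  refine ⟨J, ?_, hJ.symm⟩
  have h1 := congrArg absNorm hJ
  rw [formElt, h.absNorm_span, ← mul_qform hun, Int.natAbs_mul, Int.natAbs_natCast, map_mul,
    h.absNorm_quadIdeal hU ht hn hu, mul_comm] at h1
  exact (Nat.eq_of_mul_eq_mul_right (Nat.pos_of_mem_divisors x.1.2) h1).symm

lemma formElt_injective {R : Type*} [CommRing R] {θ : R} (h : IsQuadBasis θ t n)
    {x y : FormVec U} (h1 : x.1 = y.1)
    (hxy : formElt θ x = formElt θ y) : x = y := by
  obtain ⟨u, ⟨x, hx⟩⟩ := x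
  obtain ⟨v, ⟨y, hy⟩⟩ := y
  obtain rfl : u = v := h1
  obtain ⟨e1, e2⟩ := (h.ext_iff _ _ _ _).1 hxy
  have hu : ((u : ℕ) : ℤ) ≠ 0 := by exact_mod_cast (Nat.pos_of_mem_divisors u.2).ne'
  simp only [Prod.mk.injEq, Subtype.mk.injEq, true_and]
  exact Prod.ext (mul_left_cancel₀ hu e1) e2

lemma card_formVal_eq (h : IsQuadBasis θ t n) (hU : Squarefree U) (ht : (U : ℤ) ∣ t)
    (hn : (U : ℤ) ∣ n) (hlt : 4 * (U : ℤ) < -(t ^ 2 - 4 * n))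
    (hh : classNumber F < 2 * U.divisors.card) {m : ℕ} (hm : m ≠ 0) :
    Finite {x : FormVec U // formVal t n x = m} ∧
      Nat.card {x : FormVec U // formVal t n x = m} = 2 * idealCount F m := by
  have hD : discr F < -4 := by
    have : 1 ≤ U := Nat.one_le_iff_ne_zero.2 hU.ne_zero
    rw [h.discr_eq]
    omega
  choose Ψ hΨ1 hΨ2 using h.exists_mul_quadIdeal hU ht hn
  let f : {x : FormVec U // formVal t n x = m} → {J : Ideal (𝓞 F) // absNorm J = m} :=
    fun x => ⟨Ψ x, by rw [hΨ1, x.2]⟩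
  have hf : ∀ J, Nat.card {x // f x = J} = 2 := by
    rintro ⟨J, hJ⟩
    have hJ0 : J ≠ 0 := by
      rintro rfl
      rw [Ideal.zero_eq_bot, absNorm_bot] at hJ
      exact hm hJ.symm
    obtain ⟨u, ⟨⟨α, hα⟩⟩, huniq⟩ := h.existsUnique_isPrincipal hU ht hn hlt hh hJ0
    have hu := Nat.dvd_of_mem_divisors u.2
    have hun : ((u : ℕ) : ℤ) ∣ n := (Int.natCast_dvd_natCast.2 hu).trans hn
    rw [submodule_span_eq] at hα
    have hα0 : α ≠ 0 := by
      rintro rfl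
      rw [span_singleton_zero] at hα
      exact mul_ne_zero hJ0 (h.quadIdeal_ne_zero hU ht hn hu) hα
    have hmem : α ∈ quadIdeal θ (u : ℕ) := by
      rw [← span_singleton_le_iff_mem, ← hα]
      exact Ideal.mul_le_right
    obtain ⟨a, b, rfl⟩ := h.exists_eq α
    obtain ⟨c, rfl⟩ := (h.mem_quadIdeal hun a b).1 hmem
    have hcb : (c, b) ≠ 0 := by
      rintro hcb
      rw [Prod.mk_eq_zero] at hcb
      rw [hcb.1, hcb.2] at hα0
      simp at hα0
    let x₀ : FormVec U := (u, ⟨(c, b), hcb⟩)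
    let x₁ : FormVec U := (u, ⟨-(c, b), neg_ne_zero.2 hcb⟩)
    have hx₁ : formElt θ x₁ = -formElt θ x₀ := by
      simp only [formElt, x₁, x₀, Prod.fst_neg, Prod.snd_neg]
      push_cast
      ring
    have hfib : ∀ x : FormVec U, Ψ x = J ↔ x = x₀ ∨ x = x₁ := by
      intro x
      constructor
      · intro hx
        have h1 : x.1 = u := huniq x.1 ⟨⟨_, by rw [submodule_span_eq, ← hx]; exact hΨ2 x⟩⟩
        have h2 : span {formElt θ x₀} = span {formElt θ x} := by
          rw [← hΨ2 x, hx, h1]; exact hα.symm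
        obtain ⟨ε, hε⟩ := span_singleton_eq_span_singleton.1 h2
        rcases h.isUnit_eq_one_or hD ε with rfl | rfl
        · left
          exact h.formElt_injective h1 (by rw [← hε]; simp)
        · right
          exact h.formElt_injective h1 (by rw [← hε, hx₁]; simp)
      · intro hx
        have h1 : x.1 = u := by rcases hx with rfl | rfl <;> rfl
        have h2 : span {formElt θ x} = span {formElt θ x₀} := by
          rcases hx with rfl | rfl
          · rfl
          · rw [hx₁, span_singleton_neg]
        refine mul_right_cancel₀ (h.quadIdeal_ne_zero hU ht hn hu) ?_
        rw [← h1, hΨ2, h2, h1]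
        exact hα.symm
    have hne : x₀ ≠ x₁ := by
      intro he
      have h1 : (c, b) = -(c, b) := congrArg (fun x : FormVec U => x.2.1) he
      exact hcb (self_eq_neg.1 h1)
    have hv : ∀ x, Ψ x = J → formVal t n x = m := fun x hx => by rw [← hΨ1, hx, hJ]
    have e : {x // f x = ⟨J, hJ⟩} ≃ {x : FormVec U // x = x₀ ∨ x = x₁} :=
      { toFun := fun x => ⟨x.1.1, (hfib _).1 (Subtype.ext_iff.1 x.2)⟩
        invFun := fun x => ⟨⟨x.1, hv _ ((hfib _).2 x.2)⟩, Subtype.ext ((hfib _).2 x.2)⟩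
        left_inv := fun x => rfl
        right_inv := fun x => rfl }
    rw [Nat.card_congr e]
    exact (Set.ncard_pair hne)
  have hfin := finite_absNorm_eq (F := F) m
  let _ := Fintype.ofFinite {J : Ideal (𝓞 F) // absNorm J = m}
  have hfin2 : ∀ J, Finite {x // f x = J} := fun J =>
    Nat.finite_of_card_ne_zero (by rw [hf J]; norm_num)
  refine ⟨Finite.of_equiv _ (Equiv.sigmaFiberEquiv f), ?_⟩
  rw [← Nat.card_congr (Equiv.sigmaFiberEquiv f), Nat.card_sigma]
  simp only [hf, Finset.sum_const, smul_eq_mul, Finset.card_univ]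
  rw [idealCount, Nat.card_eq_fintype_card, mul_comm]

lemma formVal_ne_zero (hn : (U : ℤ) ∣ n)
    (hlt : 4 * (U : ℤ) < -(t ^ 2 - 4 * n)) (x : FormVec U) : formVal t n x ≠ 0 := by
  rw [formVal, Int.natAbs_ne_zero]
  have hu := Nat.dvd_of_mem_divisors x.1.2
  refine (qform_pos (Nat.pos_of_mem_divisors x.1.2).ne' ((Int.natCast_dvd_natCast.2 hu).trans hn)
    (by omega) ?_).ne'
  by_contra! hcon
  exact x.2.2 (Prod.ext hcon.1 hcon.2)

lemma summable_formVal (h : IsQuadBasis θ t n) (hU : Squarefree U) (ht : (U : ℤ) ∣ t)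
    (hn : (U : ℤ) ∣ n) (hlt : 4 * (U : ℤ) < -(t ^ 2 - 4 * n))
    (hh : classNumber F < 2 * U.divisors.card) {f : ℕ → ℝ}
    (hf : Summable fun m => (idealFun F m : ℝ) * |f m|) :
    Summable (fun x : FormVec U => f (formVal t n x)) ∧
      ∑' x : FormVec U, f (formVal t n x) = 2 * ∑' m, (idealFun F m : ℝ) * f m := by
  have hcard : ∀ m, (Nat.card {x : FormVec U // formVal t n x = m} : ℝ) = 2 * idealFun F m := by
    intro m
    rcases eq_or_ne m 0 with rfl | hm
    · have : IsEmpty {x : FormVec U // formVal t n x = 0} :=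
        ⟨fun x => formVal_ne_zero hn hlt x.1 x.2⟩
      simp
    · rw [(h.card_formVal_eq hU ht hn hlt hh hm).2, idealFun_apply F hm]
      push_cast; ring
  have hfin : ∀ m, Finite {x : FormVec U // formVal t n x = m} := by
    intro m
    rcases eq_or_ne m 0 with rfl | hm
    · have : IsEmpty {x : FormVec U // formVal t n x = 0} :=
        ⟨fun x => formVal_ne_zero hn hlt x.1 x.2⟩
      infer_instance
    · exact (h.card_formVal_eq hU ht hn hlt hh hm).1
  let e := Equiv.sigmaFiberEquiv (formVal t n : FormVec U → ℕ)
  have hval : ∀ x, formVal t n (e x) = x.1 := fun x => x.2.2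
  have habs : Summable fun x => |f (formVal t n (e x))| := by
    rw [summable_sigma_of_nonneg (fun _ => abs_nonneg _)]
    refine ⟨fun m => Summable.of_finite, ?_⟩
    simp only [hval, tsum_const, nsmul_eq_mul, hcard]
    simpa only [mul_assoc] using hf.mul_left 2
  have hs : Summable fun x => f (formVal t n (e x)) := habs.of_abs
  refine ⟨e.summable_iff.1 hs, ?_⟩
  rw [← e.tsum_eq, hs.tsum_sigma]
  simp only [hval, tsum_const, nsmul_eq_mul, hcard, mul_assoc, tsum_mul_left]

end IsQuadBasis
end ambiguous

end TwoClassesPerGenus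

namespace TwoClassesPerGenus

section genusChar

/-- The genus character attached to the prime discriminant `p` and the discriminant `d`. -/
noncomputable def genusChar (d : ℤ) (p : ℕ) : ℕ → ℤ :=
  cmul (genusPrime p (if (p : ℤ) ∣ d then d / p else p * d))

variable {d : ℤ} {p : ℕ}

lemma kron_eq_jacobiSym (hp : p.Prime) (hp4 : p % 4 = 1) {q : ℕ} (hq : q.Prime) :
    kron p q = jacobiSym q p := by
  rcases eq_or_ne q 2 with rfl | h2
  · have := Fact.mk hp
    rw [kron_two, ← jacobiSym.legendreSym.to_jacobiSym, Nat.cast_ofNat,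
      legendreSym.at_two (by omega : p ≠ 2)]
    simp
  · rw [kron_of_ne_two _ h2]
    exact jacobiSym.quadratic_reciprocity_one_mod_four hp4 (hq.odd_of_ne_two h2)

lemma genusPrime_of_ne (hp : p.Prime) (hp4 : p % 4 = 1) {q : ℕ} (hq : q.Prime) (hqp : q ≠ p)
    (D : ℤ) : genusPrime p D q = jacobiSym q p := by
  rw [genusPrime, if_neg, kron_eq_jacobiSym hp hp4 hq]
  rw [Int.natCast_dvd_natCast, Nat.prime_dvd_prime_iff_eq hq hp]
  exact hqp

lemma genusPrime_self (D : ℤ) : genusPrime p D p = kron D p := by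
  rw [genusPrime, if_pos dvd_rfl]

lemma jacobiSym_eq_zero_of_dvd (hp : p.Prime) {a : ℤ} (h : (p : ℤ) ∣ a) : jacobiSym a p = 0 := by
  have := Fact.mk hp
  rw [← jacobiSym.legendreSym.to_jacobiSym, legendreSym.eq_zero_iff,
    ZMod.intCast_zmod_eq_zero_iff_dvd]
  exact h

lemma jacobiSym_sq (hp : p.Prime) {a : ℤ} (h : ¬ (p : ℤ) ∣ a) : jacobiSym a p ^ 2 = 1 := by
  have := Fact.mk hp
  rw [← jacobiSym.legendreSym.to_jacobiSym]
  refine legendreSym.sq_one p ?_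
  rwa [Ne, ZMod.intCast_zmod_eq_zero_iff_dvd]

lemma cmul_eq_jacobiSym (hp : p.Prime) (hp4 : p % 4 = 1) (D : ℤ) {m : ℕ} (hm : ¬ p ∣ m) :
    cmul (genusPrime p D) m = jacobiSym m p := by
  induction m using Nat.recOnMul with
  | zero => exact absurd (dvd_zero p) hm
  | one => rw [cmul_one, Nat.cast_one, jacobiSym.one_left]
  | prime q hq =>
    rw [cmul_prime _ hq, genusPrime_of_ne hp hp4 hq]
    rintro rfl
    exact hm dvd_rfl
  | mul a b ha hb =>
    rw [cmul_mul, ha fun h => hm (h.mul_right _), hb fun h => hm (h.mul_left _), Nat.cast_mul,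
      jacobiSym.mul_left]

lemma genusChar_of_not_dvd (hp : p.Prime) (hp4 : p % 4 = 1) (hd : ¬ (p : ℤ) ∣ d) {m : ℕ}
    (hm : m ≠ 0) : genusChar d p m = jacobiSym m p := by
  rw [genusChar, if_neg hd]
  by_cases h : p ∣ m
  · obtain ⟨k, rfl⟩ := h
    rw [cmul_mul, cmul_prime _ hp, genusPrime_self, (kron_eq_zero_iff hp).2 (dvd_mul_right _ _),
      zero_mul, jacobiSym_eq_zero_of_dvd hp (by push_cast; exact dvd_mul_right _ _)]
  · exact cmul_eq_jacobiSym hp hp4 _ h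

lemma genusChar_one (d : ℤ) (p : ℕ) : genusChar d p 1 = 1 := cmul_one _

lemma genusChar_mul (d : ℤ) (p m n : ℕ) :
    genusChar d p (m * n) = genusChar d p m * genusChar d p n := cmul_mul _ m n

lemma genusChar_sq (hp : p.Prime) (hp4 : p % 4 = 1) (hpd : (p : ℤ) ∣ d) (hp2 : ¬ (p : ℤ) ^ 2 ∣ d)
    {m : ℕ} (hm : m ≠ 0) : genusChar d p m ^ 2 = 1 := by
  induction m using Nat.recOnMul with
  | zero => exact absurd rfl hm
  | one => rw [genusChar_one, one_pow]
  | prime q hq =>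
    rw [genusChar, if_pos hpd, cmul_prime _ hq]
    rcases eq_or_ne q p with rfl | hqp
    · rw [genusPrime_self, kron_of_ne_two _ (by omega)]
      refine jacobiSym_sq hp fun h => hp2 ?_
      obtain ⟨e, rfl⟩ := hpd
      rw [Int.mul_ediv_cancel_left _ (by exact_mod_cast hp.ne_zero)] at h
      rw [pow_two]
      exact mul_dvd_mul_left _ h
    · rw [genusPrime_of_ne hp hp4 hq hqp]
      refine jacobiSym_sq hp ?_
      rw [Int.natCast_dvd_natCast, Nat.prime_dvd_prime_iff_eq hp hq]
      exact hqp.symm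
  | mul a b ha hb =>
    obtain ⟨h1, h2⟩ := mul_ne_zero_iff.1 hm
    rw [genusChar_mul, mul_pow, ha h1, hb h2, one_mul]

/-- The genus character of a norm from the order of discriminant `4 * d` is trivial. -/
lemma genusChar_sq_sub_mul_sq (hp : p.Prime) (hp4 : p % 4 = 1) (hpd : (p : ℤ) ∣ d)
    (hp2 : ¬ (p : ℤ) ^ 2 ∣ d) (N : ℕ) {X y : ℤ} (hN : N ≠ 0)
    (h : (N : ℤ) = X ^ 2 - d * y ^ 2) : genusChar d p N = 1 := by
  induction N using Nat.strong_induction_on generalizing X y with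
  | _ N ih =>
  have hp0 : (p : ℤ) ≠ 0 := by exact_mod_cast hp.ne_zero
  have hpp : Prime (p : ℤ) := Nat.prime_iff_prime_int.1 hp
  have hd0 := hpd
  obtain ⟨e, rfl⟩ := hpd
  have he : ¬ (p : ℤ) ∣ e := fun he => hp2 (by rw [pow_two]; exact mul_dvd_mul_left _ he)
  by_cases hX : (p : ℤ) ∣ X
  · obtain ⟨X₁, rfl⟩ := hX
    have hN' : (N : ℤ) = p * (p * X₁ ^ 2 - e * y ^ 2) := by rw [h]; ring
    obtain ⟨M, rfl⟩ := Int.natCast_dvd_natCast.1 ⟨_, hN'⟩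
    have hM : (M : ℤ) = p * X₁ ^ 2 - e * y ^ 2 := by
      push_cast at hN'
      exact mul_left_cancel₀ hp0 hN'
    have hGp : genusChar (p * e) p p = jacobiSym e p := by
      rw [genusChar, if_pos hd0, cmul_prime _ hp, genusPrime_self, kron_of_ne_two _ (by omega),
        Int.mul_ediv_cancel_left _ hp0]
    by_cases hy : (p : ℤ) ∣ y
    · obtain ⟨y₁, rfl⟩ := hy
      obtain ⟨M', rfl⟩ : p ∣ M := Int.natCast_dvd_natCast.1
        ⟨X₁ ^ 2 - p * e * y₁ ^ 2, by rw [hM]; ring⟩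
      have hM' : (M' : ℤ) = X₁ ^ 2 - p * e * y₁ ^ 2 := by
        push_cast at hM
        exact mul_left_cancel₀ hp0 (by rw [hM]; ring)
      obtain ⟨-, h1⟩ := mul_ne_zero_iff.1 hN
      obtain ⟨-, h2⟩ := mul_ne_zero_iff.1 h1
      have hlt : M' < p * (p * M') := by
        have := hp.two_le
        have h3 : M' < p * M' := by nlinarith [Nat.pos_of_ne_zero h2]
        nlinarith
      rw [genusChar_mul, genusChar_mul, ih M' hlt h2 hM', hGp, mul_one, ← pow_two,
        jacobiSym_sq hp he]
    · have hpM : ¬ (p : ℤ) ∣ M := by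
        rw [hM]
        intro hdvd
        have h1 : (p : ℤ) ∣ e * y ^ 2 := by
          have := dvd_sub (dvd_mul_right (p : ℤ) (X₁ ^ 2)) hdvd
          rwa [sub_sub_cancel] at this
        rcases hpp.dvd_or_dvd h1 with h2 | h2
        · exact he h2
        · exact hy (hpp.dvd_of_dvd_pow h2)
      have hmod : jacobiSym M p = jacobiSym (-e * y ^ 2) p := by
        rw [jacobiSym.mod_left, jacobiSym.mod_left (-e * y ^ 2), hM]
        congr 1
        refine Int.ModEq.symm (Int.modEq_iff_dvd.2 ⟨X₁ ^ 2, by ring⟩)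
      have hodd : Odd p := Nat.odd_iff.2 (by omega)
      rw [genusChar_mul, hGp, genusChar, if_pos hd0,
        cmul_eq_jacobiSym hp hp4 _ (fun h => hpM (Int.natCast_dvd_natCast.2 h)), hmod,
        jacobiSym.mul_left, jacobiSym.pow_left, jacobiSym_sq hp hy, mul_one, jacobiSym.neg _ hodd,
        ZMod.χ₄_nat_one_mod_four hp4, one_mul, ← pow_two, jacobiSym_sq hp he]
  · have hpN : ¬ p ∣ N := by
      rw [← Int.natCast_dvd_natCast, h]
      intro hdvd
      have h1 := dvd_add hdvd (dvd_mul_of_dvd_left hd0 (y ^ 2))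
      rw [sub_add_cancel] at h1
      exact hX (hpp.dvd_of_dvd_pow h1)
    rw [genusChar, if_pos hd0, cmul_eq_jacobiSym hp hp4 _ hpN, h, jacobiSym.mod_left]
    have : (X ^ 2 - p * e * y ^ 2) % p = X ^ 2 % p :=
      Int.ModEq.symm (Int.modEq_iff_dvd.2 ⟨-(e * y ^ 2), by ring⟩)
    rw [this, ← jacobiSym.mod_left, jacobiSym.pow_left, jacobiSym_sq hp hX]

lemma genusChar_formVal {t n : ℤ} {U : ℕ} (hp : p.Prime) (hp4 : p % 4 = 1)
    (hpd : (p : ℤ) ∣ t ^ 2 - 4 * n) (hp2 : ¬ (p : ℤ) ^ 2 ∣ t ^ 2 - 4 * n) (hn : (U : ℤ) ∣ n)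
    (hd : t ^ 2 - 4 * n < 0) (x : IsQuadBasis.FormVec U) :
    genusChar (t ^ 2 - 4 * n) p (IsQuadBasis.formVal t n x) =
      genusChar (t ^ 2 - 4 * n) p x.1 := by
  have hu := (Int.natCast_dvd_natCast.2 (Nat.dvd_of_mem_divisors x.1.2)).trans hn
  have hu0 := (Nat.pos_of_mem_divisors x.1.2).ne'
  have hpos : 0 < qform t n x.1 x.2.1.1 x.2.1.2 := by
    refine qform_pos hu0 hu hd ?_
    by_contra! hcon
    exact x.2.2 (Prod.ext hcon.1 hcon.2)
  have hval : (IsQuadBasis.formVal t n x : ℤ) = qform t n x.1 x.2.1.1 x.2.1.2 :=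
    Int.natAbs_of_nonneg hpos.le
  have hval0 : IsQuadBasis.formVal t n x ≠ 0 := Int.natAbs_ne_zero.2 hpos.ne'
  have h1 := genusChar_sq_sub_mul_sq hp hp4 hpd hp2
    (2 * 2 * (x.1 * IsQuadBasis.formVal t n x)) (by positivity)
    (X := 2 * x.1 * x.2.1.1 + t * x.2.1.2) (y := x.2.1.2) (by
      push_cast
      rw [hval]
      linear_combination four_mul_qform (t := t) hu x.2.1.1 x.2.1.2)
  rw [genusChar_mul, genusChar_mul, genusChar_mul, ← pow_two,
    genusChar_sq hp hp4 hpd hp2 two_ne_zero, one_mul] at h1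
  have h2 := genusChar_sq hp hp4 hpd hp2 hu0
  linear_combination genusChar (t ^ 2 - 4 * n) p x.1 * h1 -
    genusChar (t ^ 2 - 4 * n) p (IsQuadBasis.formVal t n x) * h2

end genusChar

section product

/-- The product of the genus characters attached to the primes of `s`. -/
noncomputable def totChar (d : ℤ) (s : Finset ℕ) (m : ℕ) : ℤ := ∏ p ∈ s, genusChar d p m

/-- The primes of `s` not dividing `d`. -/
noncomputable def badPrimes (d : ℤ) (s : Finset ℕ) : Finset ℕ := by
  classical exact s.filter fun p => ¬ (p : ℤ) ∣ d

/-- The primes of `s` dividing `d`. -/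
noncomputable def goodPrimes (d : ℤ) (s : Finset ℕ) : Finset ℕ := by
  classical exact s.filter fun p => (p : ℤ) ∣ d

variable {d : ℤ} {s : Finset ℕ}

lemma mem_badPrimes {p : ℕ} : p ∈ badPrimes d s ↔ p ∈ s ∧ ¬ (p : ℤ) ∣ d := by
  simp [badPrimes]

lemma mem_goodPrimes {p : ℕ} : p ∈ goodPrimes d s ↔ p ∈ s ∧ (p : ℤ) ∣ d := by
  simp [goodPrimes]

lemma prod_good_mul_prod_bad {M : Type*} [CommMonoid M] (f : ℕ → M) :
    (∏ p ∈ goodPrimes d s, f p) * ∏ p ∈ badPrimes d s, f p = ∏ p ∈ s, f p := by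
  classical
  convert Finset.prod_filter_mul_prod_filter_not s (fun p : ℕ => (p : ℤ) ∣ d) f using 3 <;>
  simp [goodPrimes, badPrimes]

lemma kron_one (q : ℕ) : kron 1 q = 1 := by
  unfold kron
  split_ifs <;> simp

lemma kron_prod (S : Finset ℕ) (f : ℕ → ℤ) (q : ℕ) :
    kron (∏ p ∈ S, f p) q = ∏ p ∈ S, kron (f p) q := by
  classical
  induction S using Finset.induction_on with
  | empty => simp [kron_one]
  | insert a S ha ih => rw [Finset.prod_insert ha, Finset.prod_insert ha, kron_mul, ih]

lemma totChar_prime (hs : ∀ p ∈ s, p.Prime) {d' : ℤ}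
    (hd' : d = (∏ p ∈ goodPrimes d s, (p : ℤ)) * d') {q : ℕ} (hq : q.Prime) :
    totChar d s q = genusPrime ((∏ p ∈ goodPrimes d s, (p : ℤ)) * ∏ p ∈ badPrimes d s, (p : ℤ))
      ((∏ p ∈ badPrimes d s, (p : ℤ)) * d') q := by
  classical
  have hval : ∀ p ∈ s, genusChar d p q =
      if q = p then kron (if (p : ℤ) ∣ d then d / p else p * d) p else kron p q := by
    intro p hp
    have hiff : ((q : ℤ) ∣ (p : ℤ)) ↔ q = p := by
      rw [Int.natCast_dvd_natCast, Nat.prime_dvd_prime_iff_eq hq (hs p hp)]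
    rw [genusChar, cmul_prime _ hq, genusPrime]
    by_cases h1 : q = p
    · rw [if_pos (hiff.2 h1), if_pos h1, h1]
    · rw [if_neg (mt hiff.1 h1), if_neg h1]
  rw [totChar, prod_good_mul_prod_bad]
  by_cases hqs : q ∈ s
  · rw [genusPrime, if_pos (Finset.dvd_prod_of_mem (fun p : ℕ => (p : ℤ)) hqs),
      ← Finset.mul_prod_erase s _ hqs]
    have herase : ∏ p ∈ s.erase q, genusChar d p q = kron (∏ p ∈ s.erase q, (p : ℤ)) q := by
      rw [kron_prod]
      refine Finset.prod_congr rfl fun p hp => ?_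
      rw [hval p (Finset.mem_of_mem_erase hp), if_neg (Finset.ne_of_mem_erase hp).symm]
    rw [herase, hval q hqs, if_pos rfl]
    by_cases hqd : (q : ℤ) ∣ d
    · rw [if_pos hqd]
      have hqg : q ∈ goodPrimes d s := mem_goodPrimes.2 ⟨hqs, hqd⟩
      have hq0 : (q : ℤ) ≠ 0 := by exact_mod_cast hq.ne_zero
      obtain ⟨m, hm, hqm⟩ : ∃ m : ℤ, ∏ p ∈ goodPrimes d s, (p : ℤ) = q * m ∧ ¬ (q : ℤ) ∣ m := by
        refine ⟨∏ p ∈ (goodPrimes d s).erase q, (p : ℤ),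
          (Finset.mul_prod_erase _ (fun p : ℕ => (p : ℤ)) hqg).symm, fun h => ?_⟩
        obtain ⟨p, hp, hqp⟩ := (Nat.prime_iff_prime_int.1 hq).exists_mem_finset_dvd h
        rw [Int.natCast_dvd_natCast, Nat.prime_dvd_prime_iff_eq hq
          (hs p (mem_goodPrimes.1 (Finset.mem_of_mem_erase hp)).1)] at hqp
        exact Finset.ne_of_mem_erase hp hqp.symm
      have h1 : d / q = m * d' := by
        conv_lhs => rw [hd', hm, mul_assoc]
        rw [Int.mul_ediv_cancel_left _ hq0]
      have h2 : ∏ p ∈ s.erase q, (p : ℤ) = m * ∏ p ∈ badPrimes d s, (p : ℤ) := by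
        refine mul_left_cancel₀ hq0 ?_
        rw [Finset.mul_prod_erase s (fun p : ℕ => (p : ℤ)) hqs, ← prod_good_mul_prod_bad (d := d),
          hm, mul_assoc]
      have h3 : kron m q ^ 2 = 1 := by
        have := mt (kron_eq_zero_iff hq).1 hqm
        rcases kron_trichotomy m hq with h | h | h
        · exact absurd h this
        · rw [h, one_pow]
        · rw [h]; norm_num
      rw [h1, h2, kron_mul, kron_mul, kron_mul]
      linear_combination (kron d' q * kron (∏ p ∈ badPrimes d s, (p : ℤ)) q) * h3
    · rw [if_neg hqd, (kron_eq_zero_iff hq).2 (dvd_mul_right _ _), zero_mul, eq_comm,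
        kron_eq_zero_iff hq]
      exact dvd_mul_of_dvd_left (Finset.dvd_prod_of_mem (fun p : ℕ => (p : ℤ))
        (mem_badPrimes.2 ⟨hqs, hqd⟩)) _
  · rw [genusPrime, if_neg, kron_prod]
    · refine Finset.prod_congr rfl fun p hp => ?_
      rw [hval p hp, if_neg (fun h : q = p => hqs (h.symm ▸ hp))]
    · intro h
      obtain ⟨p, hp, hqp⟩ := (Nat.prime_iff_prime_int.1 hq).exists_mem_finset_dvd h
      rw [Int.natCast_dvd_natCast, Nat.prime_dvd_prime_iff_eq hq (hs p hp)] at hqp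
      exact hqs (hqp ▸ hp)

lemma totChar_one : totChar d s 1 = 1 := Finset.prod_eq_one fun p _ => genusChar_one d p

lemma totChar_mul (m n : ℕ) : totChar d s (m * n) = totChar d s m * totChar d s n := by
  simp only [totChar, genusChar_mul, Finset.prod_mul_distrib]

lemma totChar_eq_cmul (hs : ∀ p ∈ s, p.Prime) {d' : ℤ}
    (hd' : d = (∏ p ∈ goodPrimes d s, (p : ℤ)) * d') {m : ℕ} (hm : m ≠ 0) :
    totChar d s m =
      cmul (genusPrime ((∏ p ∈ goodPrimes d s, (p : ℤ)) * ∏ p ∈ badPrimes d s, (p : ℤ))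
        ((∏ p ∈ badPrimes d s, (p : ℤ)) * d')) m :=
  eq_cmul totChar_one (fun m n _ _ => totChar_mul m n) (fun _ hq => totChar_prime hs hd' hq) hm

lemma exists_eq_prod_goodPrimes_mul (hs : ∀ p ∈ s, p.Prime) :
    ∃ d' : ℤ, d = (∏ p ∈ goodPrimes d s, (p : ℤ)) * d' := by
  have h : (∏ p ∈ goodPrimes d s, (p : ℤ)) ∣ d := by
    refine Finset.prod_dvd_of_coprime (fun p hp q hq hpq => ?_) fun p hp => (mem_goodPrimes.1 hp).2
    exact Nat.isCoprime_iff_coprime.2 ((Nat.coprime_primes (hs p (mem_goodPrimes.1 hp).1)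
      (hs q (mem_goodPrimes.1 hq).1)).2 hpq)
  exact h

lemma prod_emod_four {S : Finset ℕ} (hS : ∀ p ∈ S, p % 4 = 1) : (∏ p ∈ S, p) % 4 = 1 := by
  classical
  induction S using Finset.induction_on with
  | empty => simp
  | insert a S ha ih =>
    rw [Finset.prod_insert ha, Nat.mul_mod, hS a (Finset.mem_insert_self _ _),
      ih fun p hp => hS p (Finset.mem_insert_of_mem hp)]

lemma IsFund.prod_mul {S : Finset ℕ} (hS : ∀ p ∈ S, p.Prime) (hS4 : ∀ p ∈ S, p % 4 = 1) {D : ℤ}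
    (hD : ∀ p ∈ S, ¬ (p : ℤ) ∣ D) (h : IsFund D) : IsFund ((∏ p ∈ S, (p : ℤ)) * D) := by
  classical
  induction S using Finset.induction_on with
  | empty => simpa using h
  | insert a S ha ih =>
    rw [Finset.prod_insert ha, mul_assoc]
    have ha' := Finset.mem_insert_self a S
    refine IsFund.mul (hS a ha') (hS4 a ha') (fun hdvd => ?_)
      (ih (fun p hp => hS p (Finset.mem_insert_of_mem hp))
        (fun p hp => hS4 p (Finset.mem_insert_of_mem hp))
        (fun p hp => hD p (Finset.mem_insert_of_mem hp)))
    rcases (Nat.prime_iff_prime_int.1 (hS a ha')).dvd_or_dvd hdvd with h1 | h1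
    · obtain ⟨p, hp, hqp⟩ := (Nat.prime_iff_prime_int.1 (hS a ha')).exists_mem_finset_dvd h1
      rw [Int.natCast_dvd_natCast, Nat.prime_dvd_prime_iff_eq (hS a ha')
        (hS p (Finset.mem_insert_of_mem hp))] at hqp
      exact ha (hqp ▸ hp)
    · exact hD a ha' h1

lemma isFund_bad_mul (hs : ∀ p ∈ s, p.Prime) (hs4 : ∀ p ∈ s, p % 4 = 1) {d' : ℤ}
    (hd' : d = (∏ p ∈ goodPrimes d s, (p : ℤ)) * d') (hd : IsFund d) :
    IsFund ((∏ p ∈ badPrimes d s, (p : ℤ)) * d') := by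
  refine IsFund.prod_mul (fun p hp => hs p (mem_badPrimes.1 hp).1)
    (fun p hp => hs4 p (mem_badPrimes.1 hp).1)
    (fun p hp hpd => (mem_badPrimes.1 hp).2 (hd' ▸ dvd_mul_of_dvd_right hpd _)) ?_
  refine IsFund.of_mul (p := ∏ p ∈ goodPrimes d s, p)
    (prod_emod_four fun p hp => hs4 p (mem_goodPrimes.1 hp).1) ?_
  push_cast
  rwa [← hd']

end product

end TwoClassesPerGenus

namespace TwoClassesPerGenus

section rows

open Filter Topology

variable {t n : ℤ} {u κ : ℕ}

/-- The horizontal shift of the `y`-th row of a form, along the residue class `x₀` modulo `κ`. -/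
noncomputable def rowShift (t : ℤ) (u κ : ℕ) (x₀ : ℕ) (y : ℝ) : ℝ :=
  (x₀ + t * y / (2 * u)) / κ

/-- The height of the first row of the form of discriminant `-D` and leading coefficient `u`. -/
noncomputable def rowHeight (D : ℝ) (u κ : ℕ) : ℝ := √D / (2 * u * κ)

lemma qform_eq_mul (hu0 : u ≠ 0) (hκ : κ ≠ 0) (hu : (u : ℤ) ∣ n) (hd : t ^ 2 - 4 * n < 0)
    (m : ℤ) (x₀ : ℕ) (y : ℤ) :
    (qform t n u (m * κ + x₀) y : ℝ) = u * κ ^ 2 * ((m + rowShift t u κ x₀ y) ^ 2 +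
      (rowHeight (-(t ^ 2 - 4 * n)) u κ * y) ^ 2) := by
  have h := four_mul_qform (t := t) hu (m * κ + x₀) y
  have h' : 4 * u * (qform t n u (m * κ + x₀) y : ℝ) =
      (2 * u * (m * κ + x₀) + t * y) ^ 2 + -(t ^ 2 - 4 * n) * y ^ 2 := by exact_mod_cast h
  have hD : (0 : ℝ) ≤ -(t ^ 2 - 4 * n) := by
    have : t ^ 2 - 4 * n ≤ 0 := hd.le
    have : ((t ^ 2 - 4 * n : ℤ) : ℝ) ≤ 0 := by exact_mod_cast this
    push_cast at this
    linarith
  have hu' : (u : ℝ) ≠ 0 := by exact_mod_cast hu0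
  have hκ' : (κ : ℝ) ≠ 0 := by exact_mod_cast hκ
  have h4 : (4 * u : ℝ) ≠ 0 := by positivity
  refine mul_left_cancel₀ h4 ?_
  rw [h', rowShift, rowHeight, mul_pow, div_pow, sq_sqrt hD]
  field_simp
  ring

lemma qform_rpow_eq (hu0 : u ≠ 0) (hκ : κ ≠ 0) (hu : (u : ℤ) ∣ n) (hd : t ^ 2 - 4 * n < 0)
    (m : ℤ) (x₀ : ℕ) (y : ℤ) (s : ℝ) :
    (qform t n u (m * κ + x₀) y : ℝ) ^ (-s) = (u * κ ^ 2 : ℝ) ^ (-s) *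
      kern s (rowHeight (-(t ^ 2 - 4 * n)) u κ * y) (m + rowShift t u κ x₀ y) := by
  rw [qform_eq_mul hu0 hκ hu hd, mul_rpow (by positivity) (by positivity), kern]

lemma qform_periodic {χ : ℤ → ℝ} (hχ : ∀ a b : ℤ, χ (a + κ * b) = χ a) (m x y : ℤ) :
    χ (qform t n u (m * κ + x) y) = χ (qform t n u x y) := by
  rw [← hχ (qform t n u x y) (u * (m ^ 2 * κ + 2 * m * x) + t * m * y)]
  congr 1
  rw [qform, qform]
  ring

/-- The contribution of the `y`-th row of a form to a twisted Epstein zeta function. -/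
lemma tsum_row (hu0 : u ≠ 0) (hκ : κ ≠ 0) (hu : (u : ℤ) ∣ n) (hd : t ^ 2 - 4 * n < 0)
    {χ : ℤ → ℝ} (hχ : ∀ a b : ℤ, χ (a + κ * b) = χ a)
    (hτ : 1 ≤ rowHeight (-(t ^ 2 - 4 * n)) u κ) {s : ℝ} (hs : 1 ≤ s) (y : ℕ+) :
    ∑' x : ℤ, χ (qform t n u x (y : ℕ)) * (qform t n u x (y : ℕ) : ℝ) ^ (-s) =
      (u * κ ^ 2 : ℝ) ^ (-s) * ((rowHeight (-(t ^ 2 - 4 * n)) u κ * (y : ℕ)) ^ (1 - 2 * s) *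
        (∫ x, kern s 1 x) * ∑ x ∈ Finset.range κ, χ (qform t n u x (y : ℕ)) +
        ∑ x ∈ Finset.range κ, χ (qform t n u x (y : ℕ)) *
          kernErr s (rowShift t u κ x (y : ℕ)) (rowHeight (-(t ^ 2 - 4 * n)) u κ * (y : ℕ))) := by
  have : NeZero κ := ⟨hκ⟩
  set τ := rowHeight (-(t ^ 2 - 4 * n)) u κ * (y : ℕ) with hτdef
  have hy1 : (1 : ℝ) ≤ (y : ℕ) := by exact_mod_cast y.pos
  have hτ1 : 1 ≤ τ := by nlinarith
  set e : Fin κ × ℤ ≃ ℤ := (Equiv.prodComm _ _).trans (Int.divModEquiv κ).symm with he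
  have hterm : ∀ p : Fin κ × ℤ, χ (qform t n u (e p) (y : ℕ)) *
      (qform t n u (e p) (y : ℕ) : ℝ) ^ (-s) =
      χ (qform t n u (p.1 : ℕ) (y : ℕ)) * (u * κ ^ 2 : ℝ) ^ (-s) *
        kern s τ (p.2 + rowShift t u κ (p.1 : ℕ) (y : ℕ)) := by
    rintro ⟨x, m⟩
    have h1 : e (x, m) = m * κ + ((x : ℕ) : ℤ) := rfl
    rw [h1, qform_periodic hχ, qform_rpow_eq hu0 hκ hu hd]
    push_cast
    ring
  have hsum1 : ∀ x : Fin κ, Summable fun m : ℤ => χ (qform t n u (x : ℕ) (y : ℕ)) *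
      (u * κ ^ 2 : ℝ) ^ (-s) * kern s τ (m + rowShift t u κ (x : ℕ) (y : ℕ)) := fun x =>
    (summable_kern hs hτ1 _).mul_left _
  have hsum2 : Summable fun p : Fin κ × ℤ => χ (qform t n u (p.1 : ℕ) (y : ℕ)) *
      (u * κ ^ 2 : ℝ) ^ (-s) * kern s τ (p.2 + rowShift t u κ (p.1 : ℕ) (y : ℕ)) := by
    rw [← summable_abs_iff, summable_prod_of_nonneg fun _ => abs_nonneg _]
    exact ⟨fun x => (hsum1 x).abs, (hasSum_fintype _).summable⟩
  rw [← e.tsum_eq, tsum_congr hterm, hsum2.tsum_prod, tsum_fintype, ← integral_kern hτ1,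
    Finset.mul_sum, ← Finset.sum_add_distrib, Finset.mul_sum, Finset.sum_range]
  refine Finset.sum_congr rfl fun x _ => ?_
  dsimp only
  rw [tsum_mul_left, kernErr]
  ring

/-- The total error made when the rows of a twisted form are replaced by integrals. -/
noncomputable def rowErr (t n : ℤ) (u κ : ℕ) (χ : ℤ → ℝ) (s : ℝ) : ℝ :=
  ∑' y : ℕ+, ∑ x ∈ Finset.range κ, χ (qform t n u x (y : ℕ)) *
    kernErr s (rowShift t u κ x (y : ℕ)) (rowHeight (-(t ^ 2 - 4 * n)) u κ * (y : ℕ))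

lemma summable_pnat_rpow {r : ℝ} (hr : r < -1) : Summable fun y : ℕ+ => ((y : ℕ) : ℝ) ^ r :=
  (Real.summable_nat_rpow.2 hr).comp_injective PNat.coe_injective

lemma abs_sum_range_mul_le {f g : ℕ → ℝ} {B : ℝ} (hf : ∀ x, |f x| ≤ 1) (hg : ∀ x, |g x| ≤ B) :
    |∑ x ∈ Finset.range κ, f x * g x| ≤ κ * B := by
  refine (Finset.abs_sum_le_sum_abs _ _).trans ?_
  refine (Finset.sum_le_card_nsmul _ _ B fun x _ => ?_).trans (by simp)
  rw [abs_mul]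
  exact (mul_le_of_le_one_left (abs_nonneg _) (hf x)).trans (hg x)

lemma exists_abs_rowErr_le {τ : ℝ} (hτ : 1 ≤ τ) :
    ∃ C : ℝ, ∀ (χ : ℕ → ℕ → ℝ) (β : ℕ → ℕ → ℝ), (∀ x y, |χ x y| ≤ 1) → ∀ s : ℝ, 1 ≤ s → s ≤ 2 →
      ∀ y : ℕ+, |∑ x ∈ Finset.range κ, χ x y * kernErr s (β x y) (τ * (y : ℕ))| ≤
        C * ((y : ℕ) : ℝ) ^ (-(3 / 2) : ℝ) := by
  obtain ⟨C, hC0, hC⟩ := exists_abs_kernErr_le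
  refine ⟨κ * C, fun χ β hχ s hs hs2 y => ?_⟩
  have hy1 : (1 : ℝ) ≤ (y : ℕ) := by exact_mod_cast y.pos
  rw [mul_assoc]
  refine abs_sum_range_mul_le (fun x => hχ x y) fun x => (hC _ _ _ hs hs2 (by nlinarith)).trans ?_
  refine mul_le_mul_of_nonneg_left ?_ hC0
  exact rpow_le_rpow_of_nonpos (by linarith) (by nlinarith) (by norm_num)

lemma tendsto_rowErr {χ : ℤ → ℝ} (hχ1 : ∀ a, |χ a| ≤ 1)
    (hτ : 1 ≤ rowHeight (-(t ^ 2 - 4 * n)) u κ) :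
    Tendsto (rowErr t n u κ χ) (𝓝[>] 1) (𝓝 (rowErr t n u κ χ 1)) := by
  obtain ⟨C, hC⟩ := exists_abs_rowErr_le (κ := κ) hτ
  refine tendsto_tsum_of_dominated_convergence
    (bound := fun y : ℕ+ => C * ((y : ℕ) : ℝ) ^ (-(3 / 2) : ℝ))
    ((summable_pnat_rpow (by norm_num)).mul_left _) (fun y => ?_) ?_
  · have hy1 : (1 : ℝ) ≤ (y : ℕ) := by exact_mod_cast y.pos
    exact tendsto_finsetSum _ fun x _ => (tendsto_kernErr (by nlinarith) _).const_mul _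
  · filter_upwards [Ioc_mem_nhdsGT (show (1 : ℝ) < 2 by norm_num)] with s hs y
    exact hC (fun x y => χ (qform t n u x y)) (fun x y => rowShift t u κ x y)
      (fun x y => hχ1 _) s hs.1.le hs.2 y

lemma abs_rowErr_one_le {χ : ℤ → ℝ} (hχ1 : ∀ a, |χ a| ≤ 1)
    (hτ : 1 ≤ rowHeight (-(t ^ 2 - 4 * n)) u κ) :
    |rowErr t n u κ χ 1| ≤ κ * (8 * π * exp (-(2 * π * rowHeight (-(t ^ 2 - 4 * n)) u κ))) := by
  set τ := rowHeight (-(t ^ 2 - 4 * n)) u κ with hτdef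
  set r := exp (-(2 * π * τ)) with hr
  have hr0 : 0 < r := exp_pos _
  have hr2 : r ≤ 1 / 2 := by
    have h1 : 1 ≤ 2 * π * τ := by nlinarith [pi_gt_three]
    have h2 : exp (-(2 * π * τ)) ≤ exp (-1) := exp_le_exp.2 (by linarith)
    have h3 := exp_one_gt_d9
    rw [exp_neg 1] at h2
    refine h2.trans ?_
    rw [inv_le_comm₀ (exp_pos _) (by norm_num)]
    linarith
  have hgeo : HasSum (fun y : ℕ+ => κ * (4 * π * r ^ (y : ℕ))) (κ * (4 * π * (r * (1 - r)⁻¹))) := by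
    refine (HasSum.mul_left _ ?_).mul_left _
    have h1 : HasSum (fun k : ℕ => r * r ^ k) (r * (1 - r)⁻¹) :=
      (hasSum_geometric_of_lt_one hr0.le (by linarith)).mul_left _
    rw [← Equiv.pnatEquivNat.symm.hasSum_iff]
    refine h1.congr_fun fun k => ?_
    simp [pow_succ, mul_comm]
  have hle : |rowErr t n u κ χ 1| ≤ κ * (4 * π * (r * (1 - r)⁻¹)) := by
    rw [rowErr, ← Real.norm_eq_abs]
    refine tsum_of_norm_bounded hgeo fun y => ?_
    have hy1 : (1 : ℝ) ≤ (y : ℕ) := by exact_mod_cast y.pos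
    refine abs_sum_range_mul_le (fun x => hχ1 _) fun x =>
      (abs_kernErr_one_le (by nlinarith) _).trans ?_
    have h1 : exp (-(2 * π * (τ * (y : ℕ)))) = r ^ (y : ℕ) := by
      rw [hr, ← exp_nat_mul]
      congr 1
      ring
    rw [h1]
    refine mul_le_mul_of_nonneg_right (div_le_self (by positivity) (by nlinarith)) (by positivity)
  refine hle.trans (mul_le_mul_of_nonneg_left ?_ (Nat.cast_nonneg _))
  have h2 : (1 - r)⁻¹ ≤ 2 := by
    rw [inv_le_comm₀ (by linarith) (by norm_num)]
    linarith
  nlinarith [mul_le_mul_of_nonneg_left h2 (mul_pos pi_pos hr0).le]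

lemma tsum_form (hu0 : u ≠ 0) (hκ : κ ≠ 0) (hu : (u : ℤ) ∣ n) (hd : t ^ 2 - 4 * n < 0)
    {χ : ℤ → ℝ} (hχ : ∀ a b : ℤ, χ (a + κ * b) = χ a) (hχ1 : ∀ a, |χ a| ≤ 1)
    (hτ : 1 ≤ rowHeight (-(t ^ 2 - 4 * n)) u κ) {s : ℝ} (hs : 1 < s) (hs2 : s ≤ 2)
    (hsum : Summable fun v : ℤ × ℤ => χ (qform t n u v.1 v.2) * (qform t n u v.1 v.2 : ℝ) ^ (-s)) :
    ∑' v : ℤ × ℤ, χ (qform t n u v.1 v.2) * (qform t n u v.1 v.2 : ℝ) ^ (-s) =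
      ∑' x : ℤ, χ (u * x ^ 2) * (u * x ^ 2 : ℝ) ^ (-s) +
      2 * ((u * κ ^ 2 : ℝ) ^ (-s) * (rowHeight (-(t ^ 2 - 4 * n)) u κ ^ (1 - 2 * s) *
        (∫ x, kern s 1 x) * ∑' y : ℕ+, ((y : ℕ) : ℝ) ^ (1 - 2 * s) *
          ∑ x ∈ Finset.range κ, χ (qform t n u x (y : ℕ)) + rowErr t n u κ χ s)) := by
  set τ := rowHeight (-(t ^ 2 - 4 * n)) u κ with hτdef
  obtain ⟨C, hC⟩ := exists_abs_rowErr_le (κ := κ) hτ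
  have hsum' : Summable fun v : ℤ × ℤ =>
      χ (qform t n u v.2 v.1) * (qform t n u v.2 v.1 : ℝ) ^ (-s) :=
    (Equiv.prodComm ℤ ℤ).summable_iff.2 hsum
  have hswap : ∑' v : ℤ × ℤ, χ (qform t n u v.1 v.2) * (qform t n u v.1 v.2 : ℝ) ^ (-s) =
      ∑' v : ℤ × ℤ, χ (qform t n u v.2 v.1) * (qform t n u v.2 v.1 : ℝ) ^ (-s) :=
    ((Equiv.prodComm ℤ ℤ).tsum_eq _).symm
  have hneg : ∀ x y : ℤ, qform t n u (-x) (-y) = qform t n u x y := fun x y => by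
    rw [qform, qform]; ring
  have heven : Function.Even fun y : ℤ =>
      ∑' x : ℤ, χ (qform t n u x y) * (qform t n u x y : ℝ) ^ (-s) := by
    intro y
    dsimp only
    rw [← (Equiv.neg ℤ).tsum_eq]
    simp only [Equiv.neg_apply, hneg]
  rw [hswap, hsum'.tsum_prod, tsum_int_eq_zero_add_two_mul_tsum_pnat heven hsum'.prod]
  have hzero : ∀ x : ℤ, qform t n u x 0 = u * x ^ 2 := fun x => by rw [qform]; ring
  have hs1 : Summable fun y : ℕ+ => ((y : ℕ) : ℝ) ^ (1 - 2 * s) *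
      ∑ x ∈ Finset.range κ, χ (qform t n u x (y : ℕ)) := by
    refine Summable.of_norm_bounded
      ((summable_pnat_rpow (r := 1 - 2 * s) (by linarith)).mul_right (κ * 1 : ℝ)) fun y => ?_
    rw [norm_mul, norm_of_nonneg (by positivity)]
    refine mul_le_mul_of_nonneg_left ?_ (by positivity)
    simpa using abs_sum_range_mul_le (κ := κ) (f := fun x => χ (qform t n u x (y : ℕ)))
      (g := fun _ => 1) (B := 1) (fun x => hχ1 _) (by simp)
  have hs3 : Summable fun y : ℕ+ => ∑ x ∈ Finset.range κ, χ (qform t n u x (y : ℕ)) *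
      kernErr s (rowShift t u κ x (y : ℕ)) (τ * (y : ℕ)) :=
    Summable.of_norm_bounded
      ((summable_pnat_rpow (r := -(3 / 2)) (by norm_num)).mul_left C) fun y =>
      hC (fun x y => χ (qform t n u x y)) (fun x y => rowShift t u κ x y)
        (fun x y => hχ1 _) s hs.le hs2 y
  have hmain : ∑' y : ℕ+, ∑' x : ℤ, χ (qform t n u x (y : ℕ)) * (qform t n u x (y : ℕ) : ℝ) ^ (-s) =
      (u * κ ^ 2 : ℝ) ^ (-s) * (τ ^ (1 - 2 * s) *
        (∫ x, kern s 1 x) * ∑' y : ℕ+, ((y : ℕ) : ℝ) ^ (1 - 2 * s) *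
          ∑ x ∈ Finset.range κ, χ (qform t n u x (y : ℕ)) + rowErr t n u κ χ s) := by
    rw [rowErr, ← tsum_mul_left, ← (hs1.mul_left _).tsum_add hs3, ← tsum_mul_left]
    refine tsum_congr fun y => ?_
    have hm : (τ * (y : ℕ)) ^ (1 - 2 * s) = τ ^ (1 - 2 * s) * ((y : ℕ) : ℝ) ^ (1 - 2 * s) :=
      mul_rpow (by linarith) (by positivity)
    rw [tsum_row hu0 hκ hu hd hχ hτ hs.le y, ← hτdef, hm]
    ring
  rw [← hmain, two_nsmul, two_mul]
  simp only [hzero]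
  push_cast
  rfl

end rows

end TwoClassesPerGenus

namespace TwoClassesPerGenus

section sums

lemma tsum_pnat_dvd {f : ℕ → ℝ} {p : ℕ} (hp : p ≠ 0) :
    ∑' y : ℕ+, (if p ∣ (y : ℕ) then f y else 0) = ∑' y : ℕ+, f (p * y) := by
  let P : ℕ+ := ⟨p, Nat.pos_of_ne_zero hp⟩
  have hinj : Function.Injective fun y : ℕ+ => P * y := fun a b h => mul_left_cancel h
  rw [← hinj.tsum_eq]
  · refine tsum_congr fun y => ?_
    have hP : ((P * y : ℕ+) : ℕ) = p * y := rfl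
    rw [hP, if_pos (dvd_mul_right _ _)]
  · intro y hy
    rw [Function.mem_support] at hy
    obtain ⟨k, hk⟩ : p ∣ (y : ℕ) := by
      by_contra h
      exact hy (if_neg h)
    have hk0 : 0 < k := Nat.pos_of_ne_zero fun h => y.ne_zero (by rw [hk, h, mul_zero])
    exact ⟨⟨k, hk0⟩, PNat.eq (hk.symm)⟩

/-- The zeta function on the real half-line `1 < σ`. -/
noncomputable def zsum (σ : ℝ) : ℝ := ∑' y : ℕ+, ((y : ℕ) : ℝ) ^ (-σ)

lemma hasSum_prod_dvd {B : Finset ℕ} (hB : ∀ p ∈ B, p.Prime) (α β : ℕ → ℝ) {σ : ℝ} (hσ : 1 < σ) :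
    HasSum (fun y : ℕ+ => (∏ p ∈ B, (α p + if p ∣ (y : ℕ) then β p else 0)) * ((y : ℕ) : ℝ) ^ (-σ))
      (zsum σ * ∏ p ∈ B, (α p + β p * (p : ℝ) ^ (-σ))) := by
  classical
  induction B using Finset.induction_on with
  | empty =>
    simp only [Finset.prod_empty, one_mul, mul_one]
    exact (summable_pnat_rpow (by linarith)).hasSum
  | insert p B hpB ih =>
    have hp := hB p (Finset.mem_insert_self _ _)
    have hB' : ∀ q ∈ B, q.Prime := fun q hq => hB q (Finset.mem_insert_of_mem hq)
    have h0 := ih hB'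
    set f : ℕ → ℝ := fun y => (∏ q ∈ B, (α q + if q ∣ y then β q else 0)) * (y : ℝ) ^ (-σ) with hf
    have hmul : ∀ y : ℕ, f (p * y) = (p : ℝ) ^ (-σ) * f y := by
      intro y
      simp only [hf]
      have : ∀ q ∈ B, (q ∣ p * y ↔ q ∣ y) := fun q hq => by
        refine ⟨fun h => ?_, fun h => h.mul_left _⟩
        refine Nat.Coprime.dvd_of_dvd_mul_left ((Nat.coprime_primes (hB' q hq) hp).2 ?_) h
        rintro rfl
        exact hpB hq
      rw [Finset.prod_congr rfl fun q hq => by rw [if_congr (this q hq) rfl rfl], Nat.cast_mul,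
        mul_rpow (by positivity) (by positivity)]
      ring
    have h1 : HasSum (fun y : ℕ+ => if p ∣ (y : ℕ) then f y else 0)
        ((p : ℝ) ^ (-σ) * (zsum σ * ∏ q ∈ B, (α q + β q * (q : ℝ) ^ (-σ)))) := by
      have hs : Summable fun y : ℕ+ => if p ∣ (y : ℕ) then f y else 0 := by
        refine Summable.of_norm_bounded h0.summable.norm fun y => ?_
        split_ifs
        · exact le_rfl
        · rw [norm_zero]
          exact norm_nonneg _
      have hval : (p : ℝ) ^ (-σ) * (zsum σ * ∏ q ∈ B, (α q + β q * (q : ℝ) ^ (-σ))) =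
          ∑' y : ℕ+, if p ∣ (y : ℕ) then f y else 0 := by
        rw [tsum_pnat_dvd hp.ne_zero, ← h0.tsum_eq, ← tsum_mul_left]
        exact tsum_congr fun y => (hmul y).symm
      rw [hval]
      exact hs.hasSum
    have h2 := (h0.mul_left (α p)).add (h1.mul_left (β p))
    have hval : zsum σ * ∏ q ∈ insert p B, (α q + β q * (q : ℝ) ^ (-σ)) =
        α p * (zsum σ * ∏ q ∈ B, (α q + β q * (q : ℝ) ^ (-σ))) +
          β p * ((p : ℝ) ^ (-σ) * (zsum σ * ∏ q ∈ B, (α q + β q * (q : ℝ) ^ (-σ)))) := by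
      rw [Finset.prod_insert hpB]
      ring
    rw [hval]
    refine h2.congr_fun fun y => ?_
    simp only [hf]
    rw [Finset.prod_insert hpB]
    split_ifs <;> ring

lemma sum_range_mul_of_coprime {m n : ℕ} (hmn : m.Coprime n) (hm : m ≠ 0) (hn : n ≠ 0)
    {f g : ℤ → ℤ} (hf : ∀ a b : ℤ, f (a + m * b) = f a) (hg : ∀ a b : ℤ, g (a + n * b) = g a) :
    ∑ x ∈ Finset.range (m * n), f x * g x =
      (∑ x ∈ Finset.range m, f x) * ∑ x ∈ Finset.range n, g x := by
  rw [Finset.sum_mul_sum, ← Finset.sum_product']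
  have hf' : ∀ x : ℕ, f (x % m : ℕ) = f x := fun x => by
    rw [← hf (x % m : ℕ) (x / m : ℕ)]
    congr 1
    exact_mod_cast Nat.mod_add_div x m
  have hg' : ∀ x : ℕ, g (x % n : ℕ) = g x := fun x => by
    rw [← hg (x % n : ℕ) (x / n : ℕ)]
    congr 1
    exact_mod_cast Nat.mod_add_div x n
  refine Finset.sum_nbij (fun x => (x % m, x % n)) ?_ ?_ ?_ ?_
  · intro x _
    simp [Nat.mod_lt, Nat.pos_of_ne_zero hm, Nat.pos_of_ne_zero hn]
  · intro x hx y hy hxy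
    rw [Finset.coe_range, Set.mem_Iio] at hx hy
    obtain ⟨h1, h2⟩ := Prod.ext_iff.1 hxy
    exact Nat.ModEq.eq_of_lt_of_lt ((Nat.modEq_and_modEq_iff_modEq_mul hmn).1 ⟨h1, h2⟩) hx hy
  · rintro ⟨a, b⟩ hab
    simp only [Finset.coe_product, Finset.coe_range, Set.mem_prod, Set.mem_Iio] at hab
    refine ⟨Nat.chineseRemainder hmn a b, ?_, ?_⟩
    · rw [Finset.coe_range, Set.mem_Iio]
      exact Nat.chineseRemainder_lt_mul hmn a b hm hn
    · obtain ⟨h1, h2⟩ := (Nat.chineseRemainder hmn a b).2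
      exact Prod.ext (Eq.trans h1 (Nat.mod_eq_of_lt hab.1)) (Eq.trans h2 (Nat.mod_eq_of_lt hab.2))
  · intro x _
    rw [hf', hg']

lemma prod_periodic {B : Finset ℕ} {f : ℕ → ℤ → ℤ}
    (hf : ∀ p ∈ B, ∀ a b : ℤ, f p (a + p * b) = f p a) (a b : ℤ) :
    ∏ p ∈ B, f p (a + (∏ p ∈ B, p : ℕ) * b) = ∏ p ∈ B, f p a := by
  refine Finset.prod_congr rfl fun p hp => ?_
  obtain ⟨k, hk⟩ := Finset.dvd_prod_of_mem (fun p : ℕ => p) hp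
  rw [hk]
  push_cast
  rw [mul_assoc, hf p hp]

lemma sum_range_prod {B : Finset ℕ} (hB : ∀ p ∈ B, p.Prime) {f : ℕ → ℤ → ℤ}
    (hf : ∀ p ∈ B, ∀ a b : ℤ, f p (a + p * b) = f p a) :
    ∑ x ∈ Finset.range (∏ p ∈ B, p), ∏ p ∈ B, f p x = ∏ p ∈ B, ∑ x ∈ Finset.range p, f p x := by
  classical
  induction B using Finset.induction_on with
  | empty => simp
  | insert p B hpB ih =>
    have hp := hB p (Finset.mem_insert_self _ _)
    have hB' : ∀ q ∈ B, q.Prime := fun q hq => hB q (Finset.mem_insert_of_mem hq)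
    have hf' : ∀ q ∈ B, ∀ a b : ℤ, f q (a + q * b) = f q a :=
      fun q hq => hf q (Finset.mem_insert_of_mem hq)
    rw [Finset.prod_insert hpB, Finset.prod_insert hpB, ← ih hB' hf']
    simp only [Finset.prod_insert hpB]
    refine sum_range_mul_of_coprime (f := f p) (g := fun x => ∏ q ∈ B, f q x)
      (Nat.Coprime.prod_right fun q hq => ?_) hp.ne_zero
      (Finset.prod_ne_zero_iff.2 fun q hq => (hB' q hq).ne_zero)
      (hf p (Finset.mem_insert_self _ _)) (prod_periodic hf')
    refine (Nat.coprime_primes hp (hB' q hq)).2 ?_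
    rintro rfl
    exact hpB hq

lemma sum_quadraticChar_sq_add_five : letI := Fact.mk (by norm_num : Nat.Prime 5)
    ∀ δ : ZMod 5, ∑ X : ZMod 5, quadraticChar (ZMod 5) (X ^ 2 + δ) =
      (if δ = 0 then 5 else 0) - 1 := by
  decide

lemma sum_quadraticChar_sq_add_thirteen : letI := Fact.mk (by norm_num : Nat.Prime 13)
    ∀ δ : ZMod 13, ∑ X : ZMod 13, quadraticChar (ZMod 13) (X ^ 2 + δ) =
      (if δ = 0 then 13 else 0) - 1 := by
  decide

lemma sum_quadraticChar_sq_add {p : ℕ} [Fact p.Prime] (hp : p = 5 ∨ p = 13) (δ : ZMod p) :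
    ∑ X : ZMod p, quadraticChar (ZMod p) (X ^ 2 + δ) = (if δ = 0 then (p : ℤ) else 0) - 1 := by
  rcases hp with rfl | rfl
  · exact sum_quadraticChar_sq_add_five δ
  · exact sum_quadraticChar_sq_add_thirteen δ

lemma sum_range_eq_sum_zmod {p : ℕ} [NeZero p] (f : ZMod p → ℤ) :
    ∑ x ∈ Finset.range p, f x = ∑ x : ZMod p, f x := by
  refine Finset.sum_nbij (fun x : ℕ => (x : ZMod p)) (fun _ _ => Finset.mem_univ _) ?_ ?_
    fun _ _ => rfl
  · intro x hx y hy hxy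
    rw [Finset.coe_range, Set.mem_Iio] at hx hy
    exact ((ZMod.natCast_eq_natCast_iff _ _ _).1 hxy).eq_of_lt_of_lt hx hy
  · intro z _
    exact ⟨z.val, by simpa using z.val_lt, ZMod.natCast_zmod_val z⟩

lemma sum_jacobiSym_qform {t n : ℤ} {u p : ℕ} (hp : p = 5 ∨ p = 13) (hu : (u : ℤ) ∣ n)
    (hpu : ¬ p ∣ u) (hpd : ¬ (p : ℤ) ∣ t ^ 2 - 4 * n) (y : ℤ) :
    ∑ x ∈ Finset.range p, jacobiSym (qform t n u x y) p =
      jacobiSym u p * (-1 + if (p : ℤ) ∣ y then (p : ℤ) else 0) := by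
  have hpp : p.Prime := by rcases hp with rfl | rfl <;> norm_num
  have hfact := Fact.mk hpp
  have hu0 : (u : ZMod p) ≠ 0 := by rwa [Ne, ZMod.natCast_eq_zero_iff]
  have h2 : (2 : ZMod p) ≠ 0 := by
    rw [← Nat.cast_two, Ne, ZMod.natCast_eq_zero_iff]
    rcases hp with rfl | rfl <;> decide
  have hJ : ∀ a : ℤ, jacobiSym a p = quadraticChar (ZMod p) (a : ZMod p) := fun a => by
    rw [← jacobiSym.legendreSym.to_jacobiSym, legendreSym]
  set c : ZMod p := ((n / u : ℤ) : ZMod p) with hc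
  have hq : ∀ x : ℕ, jacobiSym (qform t n u x y) p =
      quadraticChar (ZMod p) (u * (x : ZMod p) ^ 2 + t * x * y + c * y ^ 2) := fun x => by
    rw [hJ, qform]
    push_cast
    rfl
  have hnc : (n : ZMod p) = u * c := by
    rw [hc, ← Int.cast_natCast u, ← Int.cast_mul, Int.mul_ediv_cancel' hu]
  have hJu : quadraticChar (ZMod p) (u : ZMod p) ^ 2 = 1 := quadraticChar_sq_one hu0
  have h4 : quadraticChar (ZMod p) (2 ^ 2) = 1 := by
    rw [map_pow]
    exact quadraticChar_sq_one h2
  rw [Finset.sum_congr rfl fun x _ => hq x,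
    sum_range_eq_sum_zmod fun x : ZMod p =>
      quadraticChar (ZMod p) (u * x ^ 2 + t * x * y + c * y ^ 2),
    hJ u, Int.cast_natCast]
  have hbij : Function.Bijective fun x : ZMod p => 2 * u * x + t * y := by
    refine (Finite.injective_iff_bijective).1 fun a b hab => ?_
    exact mul_left_cancel₀ (mul_ne_zero h2 hu0) (add_right_cancel hab)
  have hkey := hbij.sum_comp fun X => quadraticChar (ZMod p) (X ^ 2 + -(t ^ 2 - 4 * n) * y ^ 2)
  rw [sum_quadraticChar_sq_add hp] at hkey
  have hδ : (-(t ^ 2 - 4 * n) * y ^ 2 : ZMod p) = 0 ↔ (p : ℤ) ∣ y := by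
    rw [← ZMod.intCast_zmod_eq_zero_iff_dvd] at hpd ⊢
    push_cast at hpd
    rw [mul_eq_zero, neg_eq_zero, or_iff_right hpd, pow_eq_zero_iff two_ne_zero]
  rw [if_congr hδ rfl rfl] at hkey
  have hterm : ∀ x : ZMod p, quadraticChar (ZMod p)
      ((2 * u * x + t * y) ^ 2 + -(t ^ 2 - 4 * n) * y ^ 2) =
      quadraticChar (ZMod p) u * quadraticChar (ZMod p) (u * x ^ 2 + t * x * y + c * y ^ 2) := by
    intro x
    rw [← one_mul (quadraticChar (ZMod p) u * _), ← h4, ← map_mul, ← map_mul, hnc]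
    congr 1
    ring
  rw [Finset.sum_congr rfl fun x _ => hterm x, ← Finset.mul_sum] at hkey
  linear_combination quadraticChar (ZMod p) u * hkey -
    (∑ x : ZMod p, quadraticChar (ZMod p) (u * x ^ 2 + t * x * y + c * y ^ 2)) * hJu

end sums

end TwoClassesPerGenus

namespace TwoClassesPerGenus

section forms

open Filter Topology

lemma tsum_pnat_eq_tsum {f : ℕ → ℝ} (h0 : f 0 = 0) : ∑' y : ℕ+, f y = ∑' n, f n :=
  PNat.coe_injective.tsum_eq fun n hn =>
    ⟨⟨n, Nat.pos_of_ne_zero fun h => hn (by rw [h, h0])⟩, rfl⟩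

lemma tendsto_zsum_two_mul : Tendsto (fun s : ℝ => zsum (2 * s)) (𝓝[>] 1) (𝓝 (π ^ 2 / 6)) := by
  have h2 : zsum 2 = π ^ 2 / 6 := by
    rw [← hasSum_zeta_two.tsum_eq, zsum, ← tsum_pnat_eq_tsum (by simp)]
    refine tsum_congr fun y => ?_
    rw [rpow_neg (by positivity), one_div]
    norm_cast
  rw [← h2]
  refine tendsto_tsum_of_dominated_convergence
    (bound := fun y : ℕ+ => ((y : ℕ) : ℝ) ^ (-2 : ℝ)) (summable_pnat_rpow (by norm_num))
    (fun y => ?_) ?_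
  · have hy : ((y : ℕ) : ℝ) ≠ 0 := by exact_mod_cast y.ne_zero
    have hc : Continuous fun s : ℝ => ((y : ℕ) : ℝ) ^ (-(2 * s)) :=
      Continuous.rpow continuous_const (by fun_prop) fun s => Or.inl hy
    simpa using (hc.tendsto 1).mono_left nhdsWithin_le_nhds
  · filter_upwards [self_mem_nhdsWithin] with s hs y
    have hs' : (1 : ℝ) < s := hs
    have hy : (1 : ℝ) ≤ (y : ℕ) := by exact_mod_cast y.pos
    rw [norm_of_nonneg (by positivity)]
    exact rpow_le_rpow_of_exponent_le hy (by linarith)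

lemma tendsto_mul_zsum :
    Tendsto (fun s : ℝ => (s - 1) * zsum (2 * s - 1)) (𝓝[>] 1) (𝓝 (1 / 2)) := by
  have hlim : Tendsto (fun s : ℝ => 2 * s - 1) (𝓝[>] 1) (𝓝[>] 1) := by
    refine tendsto_nhdsWithin_iff.2 ⟨?_, ?_⟩
    · have hc : Continuous fun s : ℝ => 2 * s - 1 := by fun_prop
      have := (hc.tendsto 1).mono_left (nhdsWithin_le_nhds (s := Set.Ioi 1))
      norm_num at this
      exact this
    · filter_upwards [self_mem_nhdsWithin] with s hs
      have hs' : (1 : ℝ) < s := hs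
      exact Set.mem_Ioi.2 (by linarith)
  have h := (tendsto_sub_mul_tsum_nat_rpow.comp hlim).div_const 2
  refine h.congr' ?_
  filter_upwards [self_mem_nhdsWithin] with s hs
  have hs' : (1 : ℝ) < s := hs
  have hz : ∑' n : ℕ, 1 / (n : ℝ) ^ (2 * s - 1) = zsum (2 * s - 1) := by
    have h0 : (2 * s - 1) ≠ 0 := by linarith
    rw [zsum, ← tsum_pnat_eq_tsum (f := fun n : ℕ => 1 / (n : ℝ) ^ (2 * s - 1))
      (by simp [zero_rpow h0])]
    refine tsum_congr fun y => ?_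
    rw [rpow_neg (by positivity), one_div]
  simp only [Function.comp_apply]
  rw [hz]
  ring

/-- The product of the quadratic characters modulo the primes of `B`. -/
def jacProd (B : Finset ℕ) (a : ℤ) : ℤ := ∏ p ∈ B, jacobiSym a p

variable {B : Finset ℕ}

lemma abs_jacProd_le (a : ℤ) : |(jacProd B a : ℝ)| ≤ 1 := by
  have h : |jacProd B a| ≤ 1 := by
    rw [jacProd, Finset.abs_prod]
    refine Finset.prod_le_one (fun _ _ => abs_nonneg _) fun p _ => ?_
    rcases jacobiSym.trichotomy a p with h | h | h <;> simp [h]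
  exact_mod_cast h

lemma jacobiSym_add_mul (p : ℕ) (a b : ℤ) : jacobiSym (a + p * b) p = jacobiSym a p := by
  rw [jacobiSym.mod_left, Int.add_mul_emod_self_left, ← jacobiSym.mod_left]

lemma jacProd_add_mul (a b : ℤ) : jacProd B (a + (∏ p ∈ B, p : ℕ) * b) = jacProd B a :=
  prod_periodic (f := fun p a => jacobiSym a p) (fun p _ => jacobiSym_add_mul p) a b

lemma jacProd_mul (a b : ℤ) : jacProd B (a * b) = jacProd B a * jacProd B b := by
  simp only [jacProd, jacobiSym.mul_left, Finset.prod_mul_distrib]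

lemma jacProd_sq (hB : ∀ p ∈ B, p.Prime) (x : ℕ) :
    (jacProd B (x ^ 2) : ℝ) = ∏ p ∈ B, ((1 : ℝ) + if p ∣ x then -1 else 0) := by
  rw [jacProd]
  push_cast
  refine Finset.prod_congr rfl fun p hp => ?_
  split_ifs with h
  · rw [jacobiSym_eq_zero_of_dvd (hB p hp)]
    · simp
    · exact dvd_pow (Int.natCast_dvd_natCast.2 h) two_ne_zero
  · rw [jacobiSym.pow_left, jacobiSym_sq (hB p hp) (mt Int.natCast_dvd_natCast.1 h)]
    simp

lemma sum_range_jacProd {t n : ℤ} {u : ℕ} (hB : ∀ p ∈ B, p = 5 ∨ p = 13) (hu : (u : ℤ) ∣ n)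
    (hBu : ∀ p ∈ B, ¬ p ∣ u) (hBd : ∀ p ∈ B, ¬ (p : ℤ) ∣ t ^ 2 - 4 * n) (y : ℕ) :
    ∑ x ∈ Finset.range (∏ p ∈ B, p), (jacProd B (qform t n u x y) : ℝ) =
      jacProd B u * ∏ p ∈ B, ((-1 : ℝ) + if p ∣ y then (p : ℝ) else 0) := by
  have hBp : ∀ p ∈ B, p.Prime := fun p hp => by rcases hB p hp with rfl | rfl <;> norm_num
  have hper : ∀ p ∈ B, ∀ a b : ℤ, jacobiSym (qform t n u (a + p * b) y) p =
      jacobiSym (qform t n u a y) p := fun p _ a b => by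
    rw [← jacobiSym_add_mul p (qform t n u a y) (u * (b ^ 2 * p + 2 * b * a) + t * b * y)]
    congr 1
    rw [qform, qform]
    ring
  have h := sum_range_prod hBp (f := fun p x => jacobiSym (qform t n u x y) p) hper
  rw [Finset.prod_congr rfl fun p hp =>
    sum_jacobiSym_qform (hB p hp) hu (hBu p hp) (hBd p hp) y, Finset.prod_mul_distrib] at h
  have h' : ((∑ x ∈ Finset.range (∏ p ∈ B, p), jacProd B (qform t n u x y) : ℤ) : ℝ) =
      ((jacProd B u * ∏ p ∈ B, (-1 + if (p : ℤ) ∣ y then (p : ℤ) else 0) : ℤ) : ℝ) :=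
    congrArg _ h
  push_cast [Int.natCast_dvd_natCast] at h'
  exact h'

/-- The secondary term of the Epstein zeta functions of discriminant `-D`, twisted modulo the
primes of `B`. -/
noncomputable def secTerm (D : ℝ) (B : Finset ℕ) (s : ℝ) : ℝ :=
  (√D / 2) ^ (1 - 2 * s) / (∏ p ∈ B, p : ℕ) * (∫ x, kern s 1 x) *
    (zsum (2 * s - 1) * ∏ p ∈ B, (-1 + p * (p : ℝ) ^ (-(2 * s - 1))))

lemma tsum_qform_twisted {t n : ℤ} {u : ℕ} (hu0 : u ≠ 0) (hu : (u : ℤ) ∣ n)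
    (hd : t ^ 2 - 4 * n < 0) (hB : ∀ p ∈ B, p = 5 ∨ p = 13) (hBu : ∀ p ∈ B, ¬ p ∣ u)
    (hBd : ∀ p ∈ B, ¬ (p : ℤ) ∣ t ^ 2 - 4 * n)
    (hτ : 1 ≤ rowHeight (-(t ^ 2 - 4 * n)) u (∏ p ∈ B, p)) {s : ℝ} (hs : 1 < s) (hs2 : s ≤ 2)
    (hsum : Summable fun v : ℤ × ℤ =>
      (jacProd B (qform t n u v.1 v.2) : ℝ) * (qform t n u v.1 v.2 : ℝ) ^ (-s)) :
    ∑' v : ℤ × ℤ, (jacProd B (qform t n u v.1 v.2) : ℝ) * (qform t n u v.1 v.2 : ℝ) ^ (-s) =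
      2 * (jacProd B u * ((u : ℝ) ^ (-s) * (zsum (2 * s) * ∏ p ∈ B, (1 + -1 * (p : ℝ) ^ (-(2 * s))))
        + (u : ℝ) ^ (s - 1) * secTerm (-(t ^ 2 - 4 * n)) B s) +
        (u * (∏ p ∈ B, p : ℕ) ^ 2 : ℝ) ^ (-s) *
          rowErr t n u (∏ p ∈ B, p) (fun a => (jacProd B a : ℝ)) s) := by
  have hBp : ∀ p ∈ B, p.Prime := fun p hp => by rcases hB p hp with rfl | rfl <;> norm_num
  set κ := ∏ p ∈ B, p with hκdef
  have hκ : κ ≠ 0 := Finset.prod_ne_zero_iff.2 fun p hp => (hBp p hp).ne_zero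
  rw [tsum_form hu0 hκ hu hd (χ := fun a => (jacProd B a : ℝ))
    (fun a b => by rw [hκdef, jacProd_add_mul]) abs_jacProd_le hτ hs hs2 hsum]
  have hrow : ∑' x : ℤ, (jacProd B (u * x ^ 2) : ℝ) * (u * x ^ 2 : ℝ) ^ (-s) =
      2 * (jacProd B u * ((u : ℝ) ^ (-s) *
        (zsum (2 * s) * ∏ p ∈ B, (1 + -1 * (p : ℝ) ^ (-(2 * s)))))) := by
    have hinj : Function.Injective fun x : ℤ => (x, (0 : ℤ)) := fun a b h => (Prod.ext_iff.1 h).1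
    have hs0 : Summable fun x : ℤ => (jacProd B (u * x ^ 2) : ℝ) * (u * x ^ 2 : ℝ) ^ (-s) := by
      refine (hsum.comp_injective hinj).congr fun x => ?_
      have : qform t n u x 0 = u * x ^ 2 := by rw [qform]; ring
      simp [this]
    have heven : Function.Even fun x : ℤ =>
        (jacProd B (u * x ^ 2) : ℝ) * (u * x ^ 2 : ℝ) ^ (-s) := fun x => by simp
    rw [tsum_int_eq_zero_add_two_mul_tsum_pnat heven hs0]
    have h1 := (hasSum_prod_dvd hBp (fun _ => 1) (fun _ => -1)
      (show 1 < 2 * s by linarith)).tsum_eq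
    rw [← h1, ← tsum_mul_left, ← tsum_mul_left, two_nsmul, two_mul]
    have h0 : -s ≠ 0 := by linarith
    simp only [Int.cast_zero, ne_eq, OfNat.ofNat_ne_zero, not_false_eq_true, zero_pow, mul_zero,
      zero_rpow h0, zero_add]
    have hterm : ∀ y : ℕ+, (jacProd B (u * ((y : ℕ) : ℤ) ^ 2) : ℝ) *
        (u * (((y : ℕ) : ℤ) : ℝ) ^ 2 : ℝ) ^ (-s) = jacProd B u * ((u : ℝ) ^ (-s) *
          ((∏ p ∈ B, ((1 : ℝ) + if p ∣ (y : ℕ) then -1 else 0)) * ((y : ℕ) : ℝ) ^ (-(2 * s)))) := by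
      intro y
      rw [jacProd_mul, Int.cast_mul, jacProd_sq hBp, mul_rpow (by positivity) (by positivity),
        Int.cast_natCast, ← rpow_natCast, ← rpow_mul (by positivity)]
      push_cast
      rw [show (2 : ℝ) * -s = -(2 * s) by ring]
      ring
    rw [tsum_congr hterm]
  have hmain : ∑' y : ℕ+, ((y : ℕ) : ℝ) ^ (1 - 2 * s) *
      ∑ x ∈ Finset.range κ, (jacProd B (qform t n u x (y : ℕ)) : ℝ) =
      jacProd B u * (zsum (2 * s - 1) * ∏ p ∈ B, (-1 + p * (p : ℝ) ^ (-(2 * s - 1)))) := by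
    rw [← (hasSum_prod_dvd hBp (fun _ => -1) (fun p => (p : ℝ))
      (show 1 < 2 * s - 1 by linarith)).tsum_eq, ← tsum_mul_left]
    refine tsum_congr fun y => ?_
    rw [sum_range_jacProd hB hu hBu hBd, show 1 - 2 * s = -(2 * s - 1) by ring]
    ring
  have hpow : (u * (κ : ℝ) ^ 2) ^ (-s) * rowHeight (-(t ^ 2 - 4 * n)) u κ ^ (1 - 2 * s) =
      (u : ℝ) ^ (s - 1) * ((√(-(t ^ 2 - 4 * n) : ℝ) / 2) ^ (1 - 2 * s) / κ) := by
    have hu' : (0 : ℝ) < u := by exact_mod_cast Nat.pos_of_ne_zero hu0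
    have hκ' : (0 : ℝ) < κ := by exact_mod_cast Nat.pos_of_ne_zero hκ
    have h1 : rowHeight (-(t ^ 2 - 4 * n)) u κ = √(-(t ^ 2 - 4 * n) : ℝ) / 2 * (u * κ : ℝ)⁻¹ := by
      rw [rowHeight]
      field_simp
    rw [h1, mul_rpow hu'.le (sq_nonneg _),
      mul_rpow (by positivity) (by positivity : (0 : ℝ) ≤ (u * κ : ℝ)⁻¹),
      inv_rpow (by positivity), mul_rpow hu'.le hκ'.le, ← rpow_natCast, ← rpow_mul hκ'.le,
      ← rpow_neg_one ((u : ℝ) ^ (1 - 2 * s) * _),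
      mul_rpow (by positivity) (by positivity), ← rpow_mul hu'.le, ← rpow_mul hκ'.le,
      div_eq_mul_inv (_ ^ _) (κ : ℝ), ← rpow_neg_one (κ : ℝ)]
    have h2 : (u : ℝ) ^ (s - 1) = (u : ℝ) ^ (-s) * (u : ℝ) ^ ((1 - 2 * s) * -1) := by
      rw [← rpow_add hu']
      congr 1
      ring
    have h3 : (κ : ℝ) ^ (-1 : ℝ) =
        (κ : ℝ) ^ (((2 : ℕ) : ℝ) * -s) * (κ : ℝ) ^ ((1 - 2 * s) * -1) := by
      rw [← rpow_add hκ']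
      congr 1
      push_cast
      ring
    rw [h2, h3]
    ring
  rw [hrow, hmain, secTerm, ← hκdef]
  linear_combination (2 * (∫ x, kern s 1 x) * jacProd B u * (zsum (2 * s - 1) *
    ∏ p ∈ B, (-1 + p * (p : ℝ) ^ (-(2 * s - 1))))) * hpow

end forms

end TwoClassesPerGenus

namespace TwoClassesPerGenus

section expansion

open Filter Topology NumberField IsQuadBasis

variable {d : ℤ} {S : Finset ℕ}

/-- The part of the genus character coming from the primes that divide the discriminant. -/
noncomputable def goodChar (d : ℤ) (S : Finset ℕ) (m : ℕ) : ℤ :=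
  ∏ p ∈ goodPrimes d S, genusChar d p m

lemma goodChar_sq (hS : ∀ p ∈ S, p = 5 ∨ p = 13) (hd2 : ∀ p ∈ S, ¬ (p : ℤ) ^ 2 ∣ d) {m : ℕ}
    (hm : m ≠ 0) : goodChar d S m ^ 2 = 1 := by
  rw [goodChar, ← Finset.prod_pow]
  refine Finset.prod_eq_one fun p hp => ?_
  obtain ⟨hpS, hpd⟩ := mem_goodPrimes.1 hp
  exact genusChar_sq (by rcases hS p hpS with rfl | rfl <;> norm_num)
    (by rcases hS p hpS with rfl | rfl <;> norm_num) hpd (hd2 p hpS) hm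

lemma totChar_eq_goodChar_mul (hS : ∀ p ∈ S, p = 5 ∨ p = 13) {m : ℕ} (hm : m ≠ 0) :
    totChar d S m = goodChar d S m * jacProd (badPrimes d S) m := by
  rw [totChar, ← prod_good_mul_prod_bad (d := d), goodChar, jacProd]
  congr 1
  refine Finset.prod_congr rfl fun p hp => ?_
  obtain ⟨hpS, hpd⟩ := mem_badPrimes.1 hp
  exact genusChar_of_not_dvd (by rcases hS p hpS with rfl | rfl <;> norm_num)
    (by rcases hS p hpS with rfl | rfl <;> norm_num) hpd hm

variable {t n : ℤ} {U : ℕ}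

lemma goodChar_formVal (hS : ∀ p ∈ S, p = 5 ∨ p = 13)
    (hd2 : ∀ p ∈ S, ¬ (p : ℤ) ^ 2 ∣ t ^ 2 - 4 * n) (hn : (U : ℤ) ∣ n)
    (hd : t ^ 2 - 4 * n < 0) (x : FormVec U) :
    goodChar (t ^ 2 - 4 * n) S (formVal t n x) = goodChar (t ^ 2 - 4 * n) S x.1 := by
  refine Finset.prod_congr rfl fun p hp => ?_
  obtain ⟨hpS, hpd⟩ := mem_goodPrimes.1 hp
  exact genusChar_formVal (by rcases hS p hpS with rfl | rfl <;> norm_num)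
    (by rcases hS p hpS with rfl | rfl <;> norm_num) hpd (hd2 p hpS) hn hd x

lemma abs_totChar_le (hS : ∀ p ∈ S, p.Prime) {m : ℕ} (hm : m ≠ 0) :
    |(totChar d S m : ℝ)| ≤ 1 := by
  obtain ⟨d', hd'⟩ := exists_eq_prod_goodPrimes_mul (d := d) hS
  rw [totChar_eq_cmul hS hd' hm]
  exact_mod_cast abs_cmul_le (fun p hp => abs_genusPrime_le _ _ hp) m

/-- The series over integral ideals twisted by the genus character, as a sum over the forms of the
ambiguous classes, expanded by the trapezoidal rule. -/
lemma tsum_totChar_eq {F : Type*} [Field F] [NumberField F] {θ : 𝓞 F} (h : IsQuadBasis θ t n)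
    (hF : Module.finrank ℚ F = 2)
    (hU : Squarefree U) (ht : (U : ℤ) ∣ t) (hn : (U : ℤ) ∣ n)
    (hlt : 4 * (U : ℤ) < -(t ^ 2 - 4 * n)) (hh : classNumber F < 2 * U.divisors.card)
    (hS : ∀ p ∈ S, p = 5 ∨ p = 13) (hd2 : ∀ p ∈ S, ¬ (p : ℤ) ^ 2 ∣ t ^ 2 - 4 * n)
    (hτ : ∀ u ∈ U.divisors,
      1 ≤ rowHeight (-(t ^ 2 - 4 * n)) u (∏ p ∈ badPrimes (t ^ 2 - 4 * n) S, p))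
    {s : ℝ} (hs : 1 < s) (hs2 : s ≤ 2) :
    ∑' m : ℕ, (idealFun F m : ℝ) * (totChar (t ^ 2 - 4 * n) S m * (m : ℝ) ^ (-s)) =
      zsum (2 * s) * (∏ p ∈ badPrimes (t ^ 2 - 4 * n) S, (1 + -1 * (p : ℝ) ^ (-(2 * s)))) *
        (∑ u ∈ U.divisors, totChar (t ^ 2 - 4 * n) S u * (u : ℝ) ^ (-s)) +
      secTerm (-(t ^ 2 - 4 * n)) (badPrimes (t ^ 2 - 4 * n) S) s *
        (∑ u ∈ U.divisors, totChar (t ^ 2 - 4 * n) S u * (u : ℝ) ^ (s - 1)) +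
      ∑ u ∈ U.divisors, goodChar (t ^ 2 - 4 * n) S u *
        ((u * (∏ p ∈ badPrimes (t ^ 2 - 4 * n) S, p : ℕ) ^ 2 : ℝ) ^ (-s) *
          rowErr t n u (∏ p ∈ badPrimes (t ^ 2 - 4 * n) S, p)
            (fun a => (jacProd (badPrimes (t ^ 2 - 4 * n) S) a : ℝ)) s) := by
  set d := t ^ 2 - 4 * n with hddef
  set B := badPrimes d S with hB
  have hU0 : U ≠ 0 := hU.ne_zero
  have hd : d < 0 := by omega
  have hSp : ∀ p ∈ S, p.Prime := fun p hp => by rcases hS p hp with rfl | rfl <;> norm_num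
  have h0s : -s ≠ 0 := by linarith
  have hf : Summable fun m : ℕ => (idealFun F m : ℝ) * |totChar d S m * (m : ℝ) ^ (-s)| := by
    refine (summable_idealFun F hF hs).of_norm_bounded fun m => ?_
    rcases eq_or_ne m 0 with rfl | hm
    · simp [zero_rpow h0s]
    have h0 : (0 : ℝ) ≤ idealFun F m := by
      rw [idealFun_apply F hm]
      positivity
    rw [norm_mul, norm_of_nonneg h0, norm_of_nonneg (abs_nonneg _), abs_mul,
      abs_of_nonneg (by positivity : (0 : ℝ) ≤ (m : ℝ) ^ (-s))]
    exact mul_le_mul_of_nonneg_left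
      (mul_le_of_le_one_left (by positivity) (abs_totChar_le hSp hm)) h0
  obtain ⟨hsum, htsum⟩ := h.summable_formVal hU ht hn hlt hh hf
  have hterm : ∀ x : FormVec U,
      (totChar d S (formVal t n x) : ℝ) * ((formVal t n x : ℕ) : ℝ) ^ (-s) =
        goodChar d S x.1 * ((jacProd B (qform t n x.1 x.2.1.1 x.2.1.2) : ℝ) *
          (qform t n x.1 x.2.1.1 x.2.1.2 : ℝ) ^ (-s)) := by
    intro x
    have hne := formVal_ne_zero hn hlt x
    have hpos : 0 < qform t n x.1 x.2.1.1 x.2.1.2 := by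
      refine qform_pos (Nat.pos_of_mem_divisors x.1.2).ne'
        ((Int.natCast_dvd_natCast.2 (Nat.dvd_of_mem_divisors x.1.2)).trans hn) hd ?_
      by_contra! hcon
      exact x.2.2 (Prod.ext hcon.1 hcon.2)
    have hcast : ((formVal t n x : ℕ) : ℤ) = qform t n x.1 x.2.1.1 x.2.1.2 := by
      rw [formVal, Int.natAbs_of_nonneg hpos.le]
    have hcast' : ((formVal t n x : ℕ) : ℝ) = (qform t n x.1 x.2.1.1 x.2.1.2 : ℝ) := by
      exact_mod_cast hcast
    rw [totChar_eq_goodChar_mul hS hne, goodChar_formVal hS hd2 hn hd, hcast, hcast']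
    push_cast
    ring
  have hslice : ∀ u : U.divisors,
      ∑' v : {v : ℤ × ℤ // v ≠ 0}, (totChar d S (formVal t n (u, v)) : ℝ) *
        ((formVal t n (u, v) : ℕ) : ℝ) ^ (-s) = 2 * (totChar d S u * ((u : ℝ) ^ (-s) *
          (zsum (2 * s) * ∏ p ∈ B, (1 + -1 * (p : ℝ) ^ (-(2 * s))))
        + (u : ℝ) ^ (s - 1) * secTerm (-(t ^ 2 - 4 * n)) B s) +
        goodChar d S u * ((u * (∏ p ∈ B, p : ℕ) ^ 2 : ℝ) ^ (-s) *
          rowErr t n u (∏ p ∈ B, p) (fun a => (jacProd B a : ℝ)) s)) := by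
    intro u
    have hu0 : (u : ℕ) ≠ 0 := (Nat.pos_of_mem_divisors u.2).ne'
    have hun : ((u : ℕ) : ℤ) ∣ n :=
      (Int.natCast_dvd_natCast.2 (Nat.dvd_of_mem_divisors u.2)).trans hn
    have hut : ((u : ℕ) : ℤ) ∣ t :=
      (Int.natCast_dvd_natCast.2 (Nat.dvd_of_mem_divisors u.2)).trans ht
    have hud : ((u : ℕ) : ℤ) ∣ d :=
      dvd_sub (dvd_pow hut two_ne_zero) (dvd_mul_of_dvd_right hun _)
    have hBd : ∀ p ∈ B, ¬ (p : ℤ) ∣ d := fun p hp => (mem_badPrimes.1 hp).2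
    have hγ : (goodChar d S u : ℝ) ≠ 0 := by
      have := goodChar_sq hS hd2 hu0
      intro h0
      rw [Int.cast_eq_zero.1 h0] at this
      norm_num at this
    set g : ℤ × ℤ → ℝ := fun v =>
      (jacProd B (qform t n u v.1 v.2) : ℝ) * (qform t n u v.1 v.2 : ℝ) ^ (-s) with hg
    have hg0 : g 0 = 0 := by
      have : qform t n u 0 0 = 0 := by rw [qform]; ring
      simp [hg, this, zero_rpow h0s]
    have hgs : Summable g := by
      have h1 : Summable fun v : {v : ℤ × ℤ // v ≠ 0} => (goodChar d S u : ℝ) * g v :=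
        (hsum.prod_factor u).congr fun v => hterm (u, v)
      have h2 : Summable (g ∘ (Subtype.val : {v : ℤ × ℤ // v ≠ 0} → ℤ × ℤ)) :=
        (summable_mul_left_iff hγ).1 h1
      refine (Subtype.val_injective.summable_iff fun v hv => ?_).1 h2
      by_contra hne
      exact hv ⟨⟨v, fun h0 => hne (h0 ▸ hg0)⟩, rfl⟩
    have hgt : ∑' v : {v : ℤ × ℤ // v ≠ 0}, g v = ∑' v, g v :=
      Subtype.val_injective.tsum_eq fun v hv => ⟨⟨v, fun h0 => hv (h0 ▸ hg0)⟩, rfl⟩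
    rw [tsum_congr fun v => hterm (u, v)]
    dsimp only
    rw [tsum_mul_left]
    have htw := tsum_qform_twisted (B := B) hu0 hun hd
      (fun p hp => hS p (mem_badPrimes.1 hp).1)
      (fun p hp hpu => hBd p hp ((Int.natCast_dvd_natCast.2 hpu).trans hud)) hBd
      (hτ u u.2) hs hs2 hgs
    rw [show (∑' v : {v : ℤ × ℤ // v ≠ 0}, (jacProd B (qform t n u v.1.1 v.1.2) : ℝ) *
      (qform t n u v.1.1 v.1.2 : ℝ) ^ (-s)) = ∑' v, g v from hgt, htw,
      totChar_eq_goodChar_mul hS hu0]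
    push_cast
    ring
  have h2 : (2 : ℝ) ≠ 0 := two_ne_zero
  refine mul_left_cancel₀ h2 ?_
  rw [← htsum, hsum.tsum_prod, tsum_congr hslice, tsum_fintype,
    Finset.sum_coe_sort U.divisors fun u => 2 * (totChar d S u * ((u : ℝ) ^ (-s) *
          (zsum (2 * s) * ∏ p ∈ B, (1 + -1 * (p : ℝ) ^ (-(2 * s))))
        + (u : ℝ) ^ (s - 1) * secTerm (-(t ^ 2 - 4 * n)) B s) +
        goodChar d S u * ((u * (∏ p ∈ B, p : ℕ) ^ 2 : ℝ) ^ (-s) *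
          rowErr t n u (∏ p ∈ B, p) (fun a => (jacProd B a : ℝ)) s)), ← Finset.mul_sum]
  congr 1
  rw [Finset.mul_sum, Finset.mul_sum, ← Finset.sum_add_distrib, ← Finset.sum_add_distrib]
  refine Finset.sum_congr rfl fun u _ => ?_
  ring

end expansion

end TwoClassesPerGenus

namespace TwoClassesPerGenus

section limit

open Filter Topology NumberField IsQuadBasis

lemma forall_eq_one_or_exists_pair {V : Finset ℕ} {σ : ℕ → ℤ} (hσ : ∀ p ∈ V, σ p = 1 ∨ σ p = -1)
    (hprod : ∏ p ∈ V, σ p = 1) :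
    (∀ p ∈ V, σ p = 1) ∨ ∃ a ∈ V, ∃ b ∈ V, a ≠ b ∧ σ a = -1 ∧ σ b = -1 := by
  by_cases hall : ∀ p ∈ V, σ p = 1
  · exact Or.inl hall
  push Not at hall
  obtain ⟨a, ha, ha1⟩ := hall
  have ha' : σ a = -1 := (hσ a ha).resolve_left ha1
  rw [← Finset.mul_prod_erase V σ ha, ha'] at hprod
  have : ∃ b ∈ V.erase a, σ b ≠ 1 := by
    by_contra! hcon
    rw [Finset.prod_eq_one hcon] at hprod
    norm_num at hprod
  obtain ⟨b, hb, hb1⟩ := this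
  obtain ⟨hba, hbV⟩ := Finset.mem_erase.1 hb
  exact Or.inr ⟨a, ha, b, hbV, hba.symm, ha', (hσ b hbV).resolve_left hb1⟩

lemma tendsto_prod_of_differentiableAt {V : Finset ℕ} {φ : ℕ → ℝ → ℝ}
    (hφ : ∀ p ∈ V, DifferentiableAt ℝ (φ p) 1) :
    Tendsto (fun s => ∏ p ∈ V, φ p s) (𝓝[>] 1) (𝓝 (∏ p ∈ V, φ p 1)) :=
  tendsto_finsetProd _ fun p hp => (hφ p hp).continuousAt.tendsto.mono_left nhdsWithin_le_nhds

lemma tendsto_prod_div {V : Finset ℕ} {φ : ℕ → ℝ → ℝ} (hφ : ∀ p ∈ V, DifferentiableAt ℝ (φ p) 1)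
    {a b : ℕ} (ha : a ∈ V) (hb : b ∈ V) (hab : a ≠ b) (ha0 : φ a 1 = 0) (hb0 : φ b 1 = 0) :
    Tendsto (fun s => (∏ p ∈ V, φ p s) / (s - 1)) (𝓝[>] 1) (𝓝 0) := by
  have h1 := (hasDerivAt_iff_tendsto_slope.1 (hφ a ha).hasDerivAt).mono_left
    (nhdsWithin_mono (1 : ℝ) (fun s (hs : 1 < s) => hs.ne'))
  have h2 := tendsto_prod_of_differentiableAt
    (V := V.erase a) fun p hp => hφ p (Finset.mem_of_mem_erase hp)
  rw [Finset.prod_eq_zero (Finset.mem_erase.2 ⟨hab.symm, hb⟩) hb0] at h2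
  have h3 := h1.mul h2
  rw [mul_zero] at h3
  refine h3.congr fun s => ?_
  rw [slope_def_field, ha0, sub_zero, ← Finset.mul_prod_erase V _ ha]
  ring

variable {d : ℤ} {S : Finset ℕ} {U : ℕ}

lemma sum_divisors_totChar (d : ℤ) (S : Finset ℕ) (hU : Squarefree U) (r : ℝ) :
    ∑ u ∈ U.divisors, totChar d S u * (u : ℝ) ^ r =
      ∏ q ∈ U.primeFactors, (1 + totChar d S q * (q : ℝ) ^ r) := by
  let f : ArithmeticFunction ℝ :=
    ⟨fun m => if m = 0 then 0 else totChar d S m * (m : ℝ) ^ r, if_pos rfl⟩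
  have hf : ∀ {m : ℕ}, m ≠ 0 → f m = totChar d S m * (m : ℝ) ^ r := fun hm => if_neg hm
  have hmul : f.IsMultiplicative := by
    rw [ArithmeticFunction.IsMultiplicative.iff_ne_zero]
    refine ⟨by rw [hf one_ne_zero, totChar_one]; simp, fun {m n} hm hn _ => ?_⟩
    rw [hf hm, hf hn, hf (mul_ne_zero hm hn), totChar_mul, Nat.cast_mul,
      mul_rpow (by positivity) (by positivity)]
    push_cast
    ring
  rw [Finset.sum_congr rfl fun u hu => (hf (Nat.pos_of_mem_divisors hu).ne').symm,
    ← hmul.prodPrimeFactors_one_add_of_squarefree hU]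
  exact Finset.prod_congr rfl fun q hq => by rw [hf (Nat.prime_of_mem_primeFactors hq).ne_zero]

/-- The primes that contribute a possibly vanishing factor to the polar term. -/
noncomputable def polarPrimes (d : ℤ) (U : ℕ) : Finset ℕ :=
  U.primeFactors ∪ badPrimes d {5, 13}

/-- The sign deciding whether the factor of the polar term at `p` vanishes. -/
noncomputable def polarSign (d : ℤ) (U : ℕ) (S : Finset ℕ) (p : ℕ) : ℤ :=
  if p ∈ U.primeFactors then totChar d S p else if p ∈ S then -1 else 1

/-- The factor of the polar term at `p`. -/
noncomputable def polarFactor (d : ℤ) (U : ℕ) (S : Finset ℕ) (p : ℕ) (s : ℝ) : ℝ :=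
  if p ∈ U.primeFactors then 1 + totChar d S p * (p : ℝ) ^ (s - 1)
  else if p ∈ S then -1 + p * (p : ℝ) ^ (-(2 * s - 1)) else 1

lemma totChar_sq (hS : ∀ p ∈ S, p = 5 ∨ p = 13) (hd2 : ∀ p ∈ S, ¬ (p : ℤ) ^ 2 ∣ d) {q : ℕ}
    (hq : q.Prime) (hqd : (q : ℤ) ∣ d) : totChar d S q ^ 2 = 1 := by
  rw [totChar_eq_goodChar_mul hS hq.ne_zero, mul_pow, goodChar_sq hS hd2 hq.ne_zero, jacProd,
    ← Finset.prod_pow, one_mul]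
  refine Finset.prod_eq_one fun p hp => ?_
  obtain ⟨hpS, hpd⟩ := mem_badPrimes.1 hp
  exact jacobiSym_sq (by rcases hS p hpS with rfl | rfl <;> norm_num)
    fun hpq => hpd (hpq.trans hqd)

lemma polarSign_eq (hS : ∀ p ∈ S, p = 5 ∨ p = 13) (hd2 : ∀ p ∈ S, ¬ (p : ℤ) ^ 2 ∣ d)
    (hUd : (U : ℤ) ∣ d) (p : ℕ) : polarSign d U S p = 1 ∨ polarSign d U S p = -1 := by
  unfold polarSign
  split_ifs with h1 h2
  · refine sq_eq_sq_iff_eq_or_eq_neg.1 ((totChar_sq hS hd2 (Nat.prime_of_mem_primeFactors h1)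
      ((Int.natCast_dvd_natCast.2 (Nat.dvd_of_mem_primeFactors h1)).trans hUd)).trans
        (one_pow 2).symm)
  · exact Or.inr rfl
  · exact Or.inl rfl

lemma disjoint_primeFactors_badPrimes (hUd : (U : ℤ) ∣ d) :
    Disjoint U.primeFactors (badPrimes d {5, 13}) :=
  Finset.disjoint_left.2 fun _ hp hb => (mem_badPrimes.1 hb).2
    ((Int.natCast_dvd_natCast.2 (Nat.dvd_of_mem_primeFactors hp)).trans hUd)

lemma prod_polarFactor (hS : S ⊆ {5, 13}) (hUd : (U : ℤ) ∣ d) (s : ℝ) :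
    ∏ p ∈ polarPrimes d U, polarFactor d U S p s =
      (∏ p ∈ badPrimes d S, (-1 + p * (p : ℝ) ^ (-(2 * s - 1)))) *
        ∏ q ∈ U.primeFactors, (1 + totChar d S q * (q : ℝ) ^ (s - 1)) := by
  have hdis := disjoint_primeFactors_badPrimes hUd
  rw [polarPrimes, Finset.prod_union hdis, mul_comm]
  congr 1
  · have hsub : badPrimes d S ⊆ badPrimes d {5, 13} := fun p hp =>
      mem_badPrimes.2 ⟨hS (mem_badPrimes.1 hp).1, (mem_badPrimes.1 hp).2⟩
    rw [← Finset.prod_subset_one_on_sdiff hsub (g := fun p => polarFactor d U S p s)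
      (fun p hp => ?_) fun p hp => ?_]
    · obtain ⟨h1, h2⟩ := Finset.mem_sdiff.1 hp
      have h3 : p ∉ S := fun h => h2 (mem_badPrimes.2 ⟨h, (mem_badPrimes.1 h1).2⟩)
      rw [polarFactor, if_neg (Finset.disjoint_right.1 hdis h1), if_neg h3]
    · rw [polarFactor, if_neg (Finset.disjoint_right.1 hdis (hsub hp)),
        if_pos (mem_badPrimes.1 hp).1]
  · exact Finset.prod_congr rfl fun q hq => by rw [polarFactor, if_pos hq]

lemma differentiableAt_polarFactor {p : ℕ} (hp : p ≠ 0) :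
    DifferentiableAt ℝ (polarFactor d U S p) 1 := by
  have hp' : (0 : ℝ) < p := by exact_mod_cast Nat.pos_of_ne_zero hp
  unfold polarFactor
  simp only [rpow_def_of_pos hp']
  split_ifs <;> fun_prop

lemma polarFactor_one_eq_zero {p : ℕ} (hp : p ≠ 0) (h : polarSign d U S p = -1) :
    polarFactor d U S p 1 = 0 := by
  have hp' : (p : ℝ) ≠ 0 := by exact_mod_cast hp
  unfold polarSign at h
  unfold polarFactor
  split_ifs at h ⊢ with h1 h2
  · simp [h]
  · rw [show -(2 * 1 - 1 : ℝ) = -1 by norm_num, rpow_neg_one, mul_inv_cancel₀ hp']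
    norm_num

lemma polarFactor_one_ne_zero {p : ℕ} (h : polarSign d U S p = 1) :
    polarFactor d U S p 1 ≠ 0 := by
  unfold polarSign at h
  unfold polarFactor
  split_ifs at h ⊢ with h1 h2
  · simp [h]
  · norm_num

lemma ne_zero_of_mem_polarPrimes {p : ℕ} (hp : p ∈ polarPrimes d U) : p ≠ 0 := by
  rcases Finset.mem_union.1 hp with h | h
  · exact (Nat.prime_of_mem_primeFactors h).ne_zero
  · have := (mem_badPrimes.1 h).1
    rcases Finset.mem_insert.1 this with rfl | h'
    · norm_num
    · rw [Finset.mem_singleton.1 h']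
      norm_num

lemma exists_prod_polarSign_eq_one (hd2 : ∀ p ∈ ({5, 13} : Finset ℕ), ¬ (p : ℤ) ^ 2 ∣ d)
    (hUd : (U : ℤ) ∣ d) : ∃ S : Finset ℕ, (S = {5} ∨ S = {13} ∨ S = {5, 13}) ∧
      ∏ p ∈ polarPrimes d U, polarSign d U S p = 1 := by
  have hsgn : ∀ S ⊆ ({5, 13} : Finset ℕ), ∏ p ∈ polarPrimes d U, polarSign d U S p = 1 ∨
      ∏ p ∈ polarPrimes d U, polarSign d U S p = -1 := by
    intro S hS
    refine Finset.prod_induction _ (fun x => x = 1 ∨ x = -1) ?_ (Or.inl rfl) fun p _ =>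
      polarSign_eq (fun p hp => by simpa using hS hp) (fun p hp => hd2 p (hS hp)) hUd p
    rintro a b (rfl | rfl) (rfl | rfl) <;> simp
  have hmul : ∏ p ∈ polarPrimes d U, polarSign d U {5, 13} p =
      (∏ p ∈ polarPrimes d U, polarSign d U {5} p) *
        ∏ p ∈ polarPrimes d U, polarSign d U {13} p := by
    rw [← Finset.prod_mul_distrib]
    refine Finset.prod_congr rfl fun p _ => ?_
    unfold polarSign
    split_ifs with h1 h2 h3 h4 <;> simp_all [totChar]
  rcases hsgn {5} (by simp) with h5 | h5
  · exact ⟨{5}, Or.inl rfl, h5⟩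
  rcases hsgn {13} (by simp) with h13 | h13
  · exact ⟨{13}, Or.inr (Or.inl rfl), h13⟩
  · exact ⟨{5, 13}, Or.inr (Or.inr rfl), by rw [hmul, h5, h13]; norm_num⟩

end limit

end TwoClassesPerGenus

namespace TwoClassesPerGenus

section limit

open Filter Topology NumberField IsQuadBasis

variable {S : Finset ℕ} {U : ℕ} {t n : ℤ}

lemma rowHeight_le_rowHeight {D : ℝ} {u U κ K : ℕ} (hu : 0 < u) (huU : u ≤ U) (hκ : 0 < κ)
    (hκK : κ ≤ K) : rowHeight D U K ≤ rowHeight D u κ := by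
  unfold rowHeight
  gcongr

lemma eventually_le_two : ∀ᶠ s : ℝ in 𝓝[>] 1, 1 < s ∧ s ≤ 2 := by
  filter_upwards [Ioc_mem_nhdsGT (by norm_num : (1 : ℝ) < 2)] with s hs using hs

lemma tendsto_rpow_nhdsGT {a : ℝ} (ha : 0 < a) {f : ℝ → ℝ} (hf : Continuous f) :
    Tendsto (fun s => a ^ f s) (𝓝[>] 1) (𝓝 (a ^ f 1)) :=
  ((Continuous.rpow continuous_const hf fun _ => Or.inl ha.ne').tendsto 1).mono_left
    nhdsWithin_le_nhds

/-- The polar term either vanishes in the limit or is unbounded. -/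
lemma polar_limit_eq_zero {d : ℤ} {D : ℝ} (hD : 0 < D) (hS : S ⊆ {5, 13})
    (hd2 : ∀ p ∈ S, ¬ (p : ℤ) ^ 2 ∣ d) (hU : Squarefree U) (hUd : (U : ℤ) ∣ d)
    (hprod : ∏ p ∈ polarPrimes d U, polarSign d U S p = 1) {W : ℝ}
    (hW : Tendsto (fun s => secTerm D (badPrimes d S) s *
      ∑ u ∈ U.divisors, totChar d S u * (u : ℝ) ^ (s - 1)) (𝓝[>] 1) (𝓝 W)) : W = 0 := by
  set C : ℝ → ℝ := fun s =>
    (√D / 2) ^ (1 - 2 * s) / (∏ p ∈ badPrimes d S, p : ℕ) * (∫ x, kern s 1 x) with hCdef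
  have hκ : (0 : ℝ) < (∏ p ∈ badPrimes d S, p : ℕ) := by
    refine Nat.cast_pos.2 (Finset.prod_pos fun p hp => ?_)
    have := hS (mem_badPrimes.1 hp).1
    simp only [Finset.mem_insert, Finset.mem_singleton] at this
    omega
  have hD2 : 0 < √D / 2 := by positivity
  have hC : Tendsto C (𝓝[>] 1)
      (𝓝 ((√D / 2) ^ (1 - 2 * 1 : ℝ) / (∏ p ∈ badPrimes d S, p : ℕ) * π)) :=
    ((tendsto_rpow_nhdsGT hD2 (f := fun s => 1 - 2 * s) (by fun_prop)).div_const _).mul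
      tendsto_integral_kern_one
  have hz := tendsto_mul_zsum
  have hdiff : ∀ p ∈ polarPrimes d U, DifferentiableAt ℝ (polarFactor d U S p) 1 :=
    fun p hp => differentiableAt_polarFactor (ne_zero_of_mem_polarPrimes hp)
  have hform : ∀ s, secTerm D (badPrimes d S) s *
      ∑ u ∈ U.divisors, totChar d S u * (u : ℝ) ^ (s - 1) =
        C s * zsum (2 * s - 1) * ∏ p ∈ polarPrimes d U, polarFactor d U S p s := by
    intro s
    rw [secTerm, sum_divisors_totChar d S hU, prod_polarFactor hS hUd]
    ring
  rcases forall_eq_one_or_exists_pair (fun p _ => polarSign_eq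
    (fun p hp => by simpa using hS hp) hd2 hUd p) hprod with hall | ⟨a, ha, b, hb, hab, ha1, hb1⟩
  · exfalso
    have h1 := (hC.mul hz).mul (tendsto_prod_of_differentiableAt hdiff)
    have hs1 : Tendsto (fun s : ℝ => s - 1) (𝓝[>] 1) (𝓝 0) := by
      have hc : Continuous fun s : ℝ => s - 1 := by fun_prop
      have := (hc.tendsto 1).mono_left (nhdsWithin_le_nhds (s := Set.Ioi 1))
      rwa [sub_self] at this
    have h2 := hs1.mul hW
    rw [zero_mul] at h2
    have h3 := tendsto_nhds_unique (h1.congr fun s => ?_) h2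
    · refine mul_ne_zero (mul_ne_zero (mul_ne_zero (div_ne_zero ?_ hκ.ne') pi_ne_zero)
        (by norm_num))
        (Finset.prod_ne_zero_iff.2 fun p hp => polarFactor_one_ne_zero (hall p hp)) h3
      exact (rpow_pos_of_pos hD2 _).ne'
    · rw [hform]
      ring
  · have h1 := (hC.mul hz).mul (tendsto_prod_div hdiff ha hb hab
      (polarFactor_one_eq_zero (ne_zero_of_mem_polarPrimes ha) ha1)
      (polarFactor_one_eq_zero (ne_zero_of_mem_polarPrimes hb) hb1))
    rw [mul_zero] at h1
    refine tendsto_nhds_unique hW (h1.congr' ?_)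
    filter_upwards [self_mem_nhdsWithin] with s hs
    have hs' : s - 1 ≠ 0 := sub_ne_zero.2 (ne_of_gt hs)
    rw [hform]
    field_simp

lemma abs_limit_sub_le {F : Type*} [Field F] [NumberField F] {θ : 𝓞 F} (h : IsQuadBasis θ t n)
    (hF : Module.finrank ℚ F = 2)
    (hU : Squarefree U) (ht : (U : ℤ) ∣ t) (hn : (U : ℤ) ∣ n)
    (hlt : 4 * (U : ℤ) < -(t ^ 2 - 4 * n)) (hh : classNumber F < 2 * U.divisors.card)
    (hS : S ⊆ {5, 13}) (hd2 : ∀ p ∈ S, ¬ (p : ℤ) ^ 2 ∣ t ^ 2 - 4 * n)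
    (hτ : 1 ≤ rowHeight (-(t ^ 2 - 4 * n)) U (∏ p ∈ badPrimes (t ^ 2 - 4 * n) S, p))
    (hprod : ∏ p ∈ polarPrimes (t ^ 2 - 4 * n) U, polarSign (t ^ 2 - 4 * n) U S p = 1) {L : ℝ}
    (hL : Tendsto (fun s : ℝ => ∑' m : ℕ, (idealFun F m : ℝ) *
      (totChar (t ^ 2 - 4 * n) S m * (m : ℝ) ^ (-s))) (𝓝[>] 1) (𝓝 L)) :
    |L - π ^ 2 / 6 * (∏ p ∈ badPrimes (t ^ 2 - 4 * n) S, (1 - ((p : ℝ) ^ 2)⁻¹)) *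
        ∏ q ∈ U.primeFactors, (1 + totChar (t ^ 2 - 4 * n) S q * (q : ℝ)⁻¹)| ≤
      U.divisors.card * (8 * π * exp (-(2 * π *
        rowHeight (-(t ^ 2 - 4 * n)) U (∏ p ∈ badPrimes (t ^ 2 - 4 * n) S, p)))) := by
  have hS' : ∀ p ∈ S, p = 5 ∨ p = 13 := fun p hp => by simpa using hS hp
  have hUd : (U : ℤ) ∣ t ^ 2 - 4 * n :=
    dvd_sub (dvd_pow ht two_ne_zero) (dvd_mul_of_dvd_right hn _)
  have hD : (0 : ℝ) < -((t : ℝ) ^ 2 - 4 * n) := by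
    have : 0 < -(t ^ 2 - 4 * n) := by omega
    exact_mod_cast this
  set d := t ^ 2 - 4 * n with hddef
  set B := badPrimes d S with hB
  set κ := ∏ p ∈ B, p with hκdef
  have hBp : ∀ p ∈ B, 0 < p := fun p hp => by
    have := hS' p (mem_badPrimes.1 hp).1
    omega
  have hκ : 0 < κ := Finset.prod_pos hBp
  have hτ' : ∀ u ∈ U.divisors, rowHeight (-((t : ℝ) ^ 2 - 4 * n)) U κ ≤
      rowHeight (-((t : ℝ) ^ 2 - 4 * n)) u κ := fun u hu =>
    rowHeight_le_rowHeight (Nat.pos_of_mem_divisors hu) (Nat.divisor_le hu) hκ le_rfl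
  set R : ℝ → ℝ := fun s => ∑ u ∈ U.divisors, goodChar d S u * ((u * (κ : ℕ) ^ 2 : ℝ) ^ (-s) *
    rowErr t n u κ (fun a => (jacProd B a : ℝ)) s) with hR
  have hexp : ∀ᶠ s : ℝ in 𝓝[>] 1, ∑' m : ℕ, (idealFun F m : ℝ) *
      (totChar d S m * (m : ℝ) ^ (-s)) =
      zsum (2 * s) * (∏ p ∈ B, (1 + -1 * (p : ℝ) ^ (-(2 * s)))) *
        (∑ u ∈ U.divisors, totChar d S u * (u : ℝ) ^ (-s)) +
      secTerm (-(t ^ 2 - 4 * n)) B s * (∑ u ∈ U.divisors, totChar d S u * (u : ℝ) ^ (s - 1)) +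
      R s := by
    filter_upwards [eventually_le_two] with s hs
    exact tsum_totChar_eq h hF hU ht hn hlt hh hS' hd2 (fun u hu => hτ.trans (hτ' u hu)) hs.1 hs.2
  have hRlim : Tendsto R (𝓝[>] 1) (𝓝 (R 1)) := by
    refine tendsto_finsetSum _ fun u hu => (Tendsto.const_mul _ (Tendsto.mul ?_ ?_))
    · have hu' : (0 : ℝ) < u := by exact_mod_cast Nat.pos_of_mem_divisors hu
      have hκ' : (0 : ℝ) < κ := by exact_mod_cast hκ
      exact tendsto_rpow_nhdsGT (by positivity) (f := fun s => -s) continuous_neg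
    · exact tendsto_rowErr abs_jacProd_le (hτ.trans (hτ' u hu))
  have hmain : Tendsto (fun s : ℝ => zsum (2 * s) *
      (∏ p ∈ B, (1 + -1 * (p : ℝ) ^ (-(2 * s)))) *
      (∑ u ∈ U.divisors, totChar d S u * (u : ℝ) ^ (-s))) (𝓝[>] 1)
      (𝓝 (π ^ 2 / 6 * (∏ p ∈ B, (1 - ((p : ℝ) ^ 2)⁻¹)) *
        ∏ q ∈ U.primeFactors, (1 + totChar d S q * (q : ℝ)⁻¹))) := by
    simp only [sum_divisors_totChar d S hU]
    refine (tendsto_zsum_two_mul.mul (tendsto_finsetProd _ fun p hp => ?_)).mul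
      (tendsto_finsetProd _ fun q hq => ?_)
    · have hp' : (0 : ℝ) < p := by exact_mod_cast hBp p hp
      have h1 := (tendsto_rpow_nhdsGT hp' (f := fun s => -(2 * s)) (by fun_prop)).const_mul (-1)
      have h2 := h1.const_add 1
      have h3 : (p : ℝ) ^ (-(2 * 1) : ℝ) = ((p : ℝ) ^ 2)⁻¹ := by
        rw [rpow_neg hp'.le]
        norm_num
      simp only [h3] at h2
      rwa [show (1 : ℝ) + -1 * ((p : ℝ) ^ 2)⁻¹ = 1 - ((p : ℝ) ^ 2)⁻¹ by ring] at h2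
    · have hq' : (0 : ℝ) < q := by
        exact_mod_cast (Nat.prime_of_mem_primeFactors hq).pos
      have h1 := ((tendsto_rpow_nhdsGT hq' (f := fun s => -s) continuous_neg).const_mul
        (totChar d S q : ℝ)).const_add 1
      simpa only [rpow_neg_one] using h1
  have hsec : Tendsto (fun s : ℝ => secTerm (-(t ^ 2 - 4 * n)) B s *
      ∑ u ∈ U.divisors, totChar d S u * (u : ℝ) ^ (s - 1)) (𝓝[>] 1)
      (𝓝 (L - π ^ 2 / 6 * (∏ p ∈ B, (1 - ((p : ℝ) ^ 2)⁻¹)) *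
        (∏ q ∈ U.primeFactors, (1 + totChar d S q * (q : ℝ)⁻¹)) - R 1)) := by
    refine ((hL.sub hmain).sub hRlim).congr' ?_
    filter_upwards [hexp] with s hs
    rw [hs]
    ring
  have h0 := polar_limit_eq_zero hD hS hd2 hU hUd hprod hsec
  rw [sub_eq_zero.1 h0, ← nsmul_eq_mul]
  refine (Finset.abs_sum_le_sum_abs _ _).trans (Finset.sum_le_card_nsmul _ _ _ fun u hu => ?_)
  have hu1 : (1 : ℝ) ≤ u := by exact_mod_cast Nat.pos_of_mem_divisors hu
  have hκ1 : (1 : ℝ) ≤ κ := by exact_mod_cast hκ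
  have hγ : |(goodChar d S u : ℝ)| = 1 := by
    have := goodChar_sq hS' hd2 (Nat.pos_of_mem_divisors hu).ne'
    have h2 : (goodChar d S u : ℝ) ^ 2 = 1 := by exact_mod_cast this
    rwa [← sq_abs, pow_eq_one_iff_of_nonneg (abs_nonneg _) two_ne_zero] at h2
  rw [abs_mul, hγ, one_mul, abs_mul, abs_of_nonneg (by positivity), rpow_neg_one]
  have hE := abs_rowErr_one_le (χ := fun a => (jacProd B a : ℝ)) abs_jacProd_le
    (hτ.trans (hτ' u hu))
  calc (u * (κ : ℝ) ^ 2)⁻¹ * |rowErr t n u κ (fun a => (jacProd B a : ℝ)) 1|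
      ≤ (u * (κ : ℝ) ^ 2)⁻¹ * (κ * (8 * π * exp (-(2 * π *
          rowHeight (-(t ^ 2 - 4 * n)) u κ)))) := by gcongr
    _ = ((u * (κ : ℝ) ^ 2)⁻¹ * κ) * (8 * π * exp (-(2 * π *
          rowHeight (-(t ^ 2 - 4 * n)) u κ))) := by ring
    _ ≤ 1 * (8 * π * exp (-(2 * π * rowHeight (-(t ^ 2 - 4 * n)) U κ))) := by
        have h1 : (u * (κ : ℝ) ^ 2)⁻¹ * κ ≤ 1 := by
          rw [inv_mul_le_iff₀ (by positivity)]
          nlinarith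
        have h2 := hτ' u hu
        gcongr
    _ = _ := one_mul _

end limit

end TwoClassesPerGenus

namespace TwoClassesPerGenus

section linearForm

open Filter Topology NumberField IsQuadBasis

variable {S : Finset ℕ}

lemma IsFund.not_sq_dvd_of_mem {d : ℤ} (hd : IsFund d) :
    ∀ p ∈ ({5, 13} : Finset ℕ), ¬ (p : ℤ) ^ 2 ∣ d := by
  rintro p hp ⟨m, hm⟩
  have h1 := hd.1
  simp only [Finset.mem_insert, Finset.mem_singleton] at hp
  rcases hp with rfl | rfl
  · have h2 := hd.2 5 (by norm_num) m hm
    push_cast at hm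
    omega
  · have h2 := hd.2 13 (by norm_num) m hm
    push_cast at hm
    omega

lemma exists_realField (hS : S = {5} ∨ S = {13} ∨ S = {5, 13}) :
    ∃ (F : Type) (_ : Field F) (_ : NumberField F), Module.finrank ℚ F = 2 ∧
      discr F = ∏ p ∈ S, (p : ℤ) ∧ ∃ (α : ℝ) (t : ℤ), 1 < α ∧ α + α⁻¹ = t ∧ log α ≤ 6 ∧
      dedekindZeta_residue F = log α * classNumber F / √(∏ p ∈ S, (p : ℝ)) := by
  have hmem : ∀ p ∈ S, p = 5 ∨ p = 13 := by
    rcases hS with rfl | rfl | rfl <;> simp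
  have hfund : IsFund (∏ p ∈ S, (p : ℤ)) := by
    have := IsFund.prod_mul (S := S) (fun p hp => by rcases hmem p hp with rfl | rfl <;> norm_num)
      (fun p hp => by rcases hmem p hp with rfl | rfl <;> norm_num)
      (fun p hp => by rcases hmem p hp with rfl | rfl <;> norm_num) isFund_one
    rwa [mul_one] at this
  have hval : ∃ c m : ℤ, 1 ≤ c ∧ c ≤ 16 ∧ c ^ 2 + 4 = m ^ 2 * ∏ p ∈ S, (p : ℤ) ∧
      (∏ p ∈ S, (p : ℤ)) % 2 = 1 ∧ 2 ∣ c - m ∧ ¬ IsSquare (∏ p ∈ S, (p : ℤ)) := by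
    rcases hS with rfl | rfl | rfl
    · exact ⟨4, 2, by norm_num, by norm_num, by norm_num, by norm_num, by norm_num, by
        rintro ⟨r, hr⟩
        have hr' : (5 : ℤ) = r * r := by simpa using hr
        have h1 : r < 3 := by nlinarith
        have h2 : -3 < r := by nlinarith
        interval_cases r <;> omega⟩
    · exact ⟨3, 1, by norm_num, by norm_num, by norm_num, by norm_num, by norm_num, by
        rintro ⟨r, hr⟩
        have hr' : (13 : ℤ) = r * r := by simpa using hr
        have h1 : r < 4 := by nlinarith
        have h2 : -4 < r := by nlinarith
        interval_cases r <;> omega⟩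
    · exact ⟨16, 2, by norm_num, by norm_num, by norm_num, by norm_num, by norm_num, by
        rintro ⟨r, hr⟩
        have hr' : (65 : ℤ) = r * r := by simpa using hr
        have h1 : r < 9 := by nlinarith
        have h2 : -9 < r := by nlinarith
        interval_cases r <;> omega⟩
  obtain ⟨c, m, hc1, hc2, hcm, hodd, h2, hsq⟩ := hval
  obtain ⟨F, iF, iN, hF, hdF⟩ := exists_quadField hfund hsq
  refine ⟨F, iF, iN, hF, hdF, ?_⟩
  obtain ⟨α, t, h1, h2, h3, h4⟩ := dedekindZeta_residue_of_pos hF hc1 hc2 (by rw [hdF, hcm])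
    (by rw [hdF, hodd]) h2
  refine ⟨α, t, h1, h2, h3, ?_⟩
  rw [h4, hdF]
  push_cast
  rfl

lemma exists_tendsto_tsum_totChar {K : Type*} [Field K] [NumberField K]
    (hK : Module.finrank ℚ K = 2) {d : ℤ} (hdK : discr K = d) (hd : d < -260)
    (hS : S = {5} ∨ S = {13} ∨ S = {5, 13}) :
    ∃ (α : ℝ) (t : ℤ) (H : ℕ), 1 < α ∧ α + α⁻¹ = t ∧ log α ≤ 6 ∧ 0 < H ∧
      Tendsto (fun s : ℝ => ∑' m : ℕ, (idealFun K m : ℝ) * (totChar d S m * (m : ℝ) ^ (-s)))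
        (𝓝[>] 1) (𝓝 (π * (log α * H) / ((∏ p ∈ badPrimes d S, p : ℕ) * √(-d : ℝ)))) := by
  have hmem : ∀ p ∈ S, p = 5 ∨ p = 13 := by
    rcases hS with rfl | rfl | rfl <;> simp
  have hSp : ∀ p ∈ S, p.Prime := fun p hp => by rcases hmem p hp with rfl | rfl <;> norm_num
  have hS4 : ∀ p ∈ S, p % 4 = 1 := fun p hp => by rcases hmem p hp with rfl | rfl <;> norm_num
  have hfund : IsFund d := by
    obtain ⟨θ, t, n, h⟩ := exists_isQuadBasis K hK
    rw [← hdK, h.discr_eq]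
    exact h.isFund
  obtain ⟨d', hd'⟩ := exists_eq_prod_goodPrimes_mul (d := d) hSp
  obtain ⟨F₁, _, _, hF₁, hdF₁, α, t, h1, h2, h3, hres₁⟩ := exists_realField hS
  set κ := ∏ p ∈ badPrimes d S, p with hκdef
  set g := ∏ p ∈ goodPrimes d S, p with hgdef
  have hgκ : g * κ = ∏ p ∈ S, p := prod_good_mul_prod_bad _
  have hg' : ∏ p ∈ goodPrimes d S, (p : ℤ) = (g : ℤ) := by push_cast [hgdef]; rfl
  have hκ' : ∏ p ∈ badPrimes d S, (p : ℤ) = (κ : ℤ) := by push_cast [hκdef]; rfl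
  have hg0 : 0 < g := Finset.prod_pos fun p hp => (hSp p (mem_goodPrimes.1 hp).1).pos
  have hκ0 : 0 < κ := Finset.prod_pos fun p hp => (hSp p (mem_badPrimes.1 hp).1).pos
  have h65 : g * κ ≤ 65 := by rw [hgκ]; rcases hS with rfl | rfl | rfl <;> simp
  have hg65 : g ≤ 65 := le_trans (Nat.le_mul_of_pos_right g hκ0) h65
  rw [hg'] at hd'
  have hd'neg : d' < -4 := by
    have hg65' : (g : ℤ) ≤ 65 := by exact_mod_cast hg65
    have hg0' : (0 : ℤ) < g := by exact_mod_cast hg0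
    nlinarith
  have hκ1 : (1 : ℤ) ≤ κ := by exact_mod_cast hκ0
  have hneg : (κ : ℤ) * d' < -4 := by nlinarith
  have hfund₂ : IsFund ((κ : ℤ) * d') := by
    rw [← hκ']
    exact isFund_bad_mul hSp hS4 (by rw [hg']; exact hd') hfund
  obtain ⟨F₂, _, _, hF₂, hdF₂⟩ := exists_quadField hfund₂ fun ⟨r, hr⟩ => by
    nlinarith [mul_self_nonneg r]
  have hres₂ := dedekindZeta_residue_of_neg hF₂ (by rw [hdF₂]; exact hneg)
  have hlim := tendsto_genusSeries K F₁ F₂ hK hF₁ hF₂ (k₀ := g) (k₁ := κ) (d' := d')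
    (by rw [hdK]; exact hd') (by rw [hdF₁, ← Nat.cast_mul, hgκ, Nat.cast_prod]) hdF₂
  refine ⟨α, t, classNumber F₁ * classNumber F₂, h1, h2, h3,
    Nat.mul_pos (classNumber_pos F₁) (classNumber_pos F₂), ?_⟩
  have hval : dedekindZeta_residue F₁ * dedekindZeta_residue F₂ =
      π * (log α * (classNumber F₁ * classNumber F₂ : ℕ)) / (κ * √(-d : ℝ)) := by
    have hk : ∏ p ∈ S, (p : ℝ) = g * κ := by rw [← Nat.cast_mul, hgκ, Nat.cast_prod]
    have hsqrt : √(g * κ : ℝ) * √|((κ * d' : ℤ) : ℝ)| = κ * √(-d : ℝ) := by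
      have habs : |((κ * d' : ℤ) : ℝ)| = -((κ * d' : ℤ) : ℝ) :=
        abs_of_neg (by exact_mod_cast hneg.trans (by norm_num))
      rw [habs, ← sqrt_mul (by positivity), hd']
      push_cast
      rw [show (g * κ * -(κ * d') : ℝ) = κ ^ 2 * -(g * d') by ring,
        sqrt_mul (by positivity), sqrt_sq (by positivity)]
    rw [hres₁, hres₂, hdF₂, hk, div_mul_div_comm, hsqrt]
    push_cast
    ring
  rw [hval] at hlim
  refine hlim.congr fun s => tsum_congr fun m => ?_
  rcases eq_or_ne m 0 with rfl | hm
  · simp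
  rw [totChar_eq_cmul hSp (by rw [hg']; exact hd') hm, hg', hκ']
  push_cast
  ring

end linearForm

end TwoClassesPerGenus

namespace TwoClassesPerGenus

section linearForm

open Filter Topology NumberField IsQuadBasis

variable {U : ℕ} {t n : ℤ}

lemma exists_nat_prod_eq {S : Finset ℕ} {d : ℤ} (hS : ∀ p ∈ S, p = 5 ∨ p = 13)
    (hd2 : ∀ p ∈ S, ¬ (p : ℤ) ^ 2 ∣ d) (hU : Squarefree U) (hUd : (U : ℤ) ∣ d) :
    ∃ B : ℕ, 0 < B ∧ B ≤ (∏ p ∈ badPrimes d S, p) ^ 2 * U ^ 2 ∧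
      (B : ℝ) = ((∏ p ∈ badPrimes d S, p : ℕ) : ℝ) ^ 2 *
        (∏ p ∈ badPrimes d S, (1 - ((p : ℝ) ^ 2)⁻¹)) *
        (U * ∏ q ∈ U.primeFactors, (1 + totChar d S q * (q : ℝ)⁻¹)) := by
  have hp2 : ∀ p ∈ badPrimes d S, 2 ≤ p := fun p hp => by
    have := hS p (mem_badPrimes.1 hp).1
    omega
  have hq2 : ∀ q ∈ U.primeFactors, 2 ≤ q := fun q hq => (Nat.prime_of_mem_primeFactors hq).two_le
  have hG : ∀ q ∈ U.primeFactors, totChar d S q = 1 ∨ totChar d S q = -1 := fun q hq =>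
    sq_eq_sq_iff_eq_or_eq_neg.1 ((totChar_sq hS hd2 (Nat.prime_of_mem_primeFactors hq)
      ((Int.natCast_dvd_natCast.2 (Nat.dvd_of_mem_primeFactors hq)).trans hUd)).trans
      (one_pow 2).symm)
  have hUprod : ∏ q ∈ U.primeFactors, q = U := Nat.prod_primeFactors_of_squarefree hU
  refine ⟨(∏ p ∈ badPrimes d S, (p ^ 2 - 1)) * ∏ q ∈ U.primeFactors, (q + totChar d S q).toNat,
    Nat.mul_pos (Finset.prod_pos fun p hp => ?_) (Finset.prod_pos fun q hq => ?_),
    Nat.mul_le_mul ?_ ?_, ?_⟩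
  · have := Nat.pow_le_pow_left (hp2 p hp) 2
    omega
  · have := hq2 q hq
    have := hG q hq
    omega
  · rw [← Finset.prod_pow]
    exact Finset.prod_le_prod' fun p _ => Nat.sub_le _ _
  · calc ∏ q ∈ U.primeFactors, (q + totChar d S q).toNat ≤ ∏ q ∈ U.primeFactors, q ^ 2 :=
          Finset.prod_le_prod' fun q hq => by
            have h1 := hq2 q hq
            have h2 := hG q hq
            have h3 : (q + totChar d S q).toNat ≤ q + 1 := by omega
            nlinarith
      _ = U ^ 2 := by rw [Finset.prod_pow, hUprod]
  · have hUr : (U : ℝ) = ∏ q ∈ U.primeFactors, (q : ℝ) := by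
      rw [← Nat.cast_prod, hUprod]
    rw [Nat.cast_mul, Nat.cast_prod, Nat.cast_prod, Nat.cast_prod, ← Finset.prod_pow,
      ← Finset.prod_mul_distrib, hUr, ← Finset.prod_mul_distrib]
    congr 1
    · refine Finset.prod_congr rfl fun p hp => ?_
      have h2 := hp2 p hp
      have hp0 : (p : ℝ) ≠ 0 := by
        have : p ≠ 0 := by omega
        exact_mod_cast this
      rw [Nat.cast_sub (Nat.one_le_pow _ _ (by omega))]
      push_cast
      field_simp
    · refine Finset.prod_congr rfl fun q hq => ?_
      have h1 := hq2 q hq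
      have h2 := hG q hq
      have hq0 : (q : ℝ) ≠ 0 := by
        have : q ≠ 0 := by omega
        exact_mod_cast this
      have h3 : ((q + totChar d S q).toNat : ℤ) = q + totChar d S q :=
        Int.toNat_of_nonneg (by omega)
      have h4 : ((q + totChar d S q).toNat : ℝ) = q + totChar d S q := by exact_mod_cast h3
      rw [h4]
      field_simp

/-- A class number below the bound produces an extremely small linear form in two logarithms. -/
lemma exists_small_linear_form {F : Type*} [Field F] [NumberField F] {θ : 𝓞 F}
    (h : IsQuadBasis θ t n) (hF : Module.finrank ℚ F = 2)
    (hU : Squarefree U) (ht : (U : ℤ) ∣ t) (hn : (U : ℤ) ∣ n)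
    (hlt : 4 * (U : ℤ) < -(t ^ 2 - 4 * n)) (hh : classNumber F < 2 * U.divisors.card)
    (hd : t ^ 2 - 4 * n < -260) (hτ : 1 ≤ rowHeight (-(t ^ 2 - 4 * n)) U 65) :
    ∃ (α : ℝ) (t' : ℤ) (A B : ℕ), 1 < α ∧ α + α⁻¹ = t' ∧ log α ≤ 6 ∧ 0 < A ∧ 0 < B ∧
      B ≤ 4225 * U ^ 2 ∧
      |A * log α - B * √(-(t ^ 2 - 4 * n) : ℝ) * π| ≤ 202800 * U ^ 2 * √(-(t ^ 2 - 4 * n) : ℝ) *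
        exp (-(2 * π * rowHeight (-(t ^ 2 - 4 * n)) U 65)) := by
  have hUd : (U : ℤ) ∣ t ^ 2 - 4 * n :=
    dvd_sub (dvd_pow ht two_ne_zero) (dvd_mul_of_dvd_right hn _)
  have hd2 := h.isFund.not_sq_dvd_of_mem
  obtain ⟨S, hS, hprod⟩ := exists_prod_polarSign_eq_one hd2 hUd
  have hsub : S ⊆ {5, 13} := by rcases hS with rfl | rfl | rfl <;> simp
  have hmem : ∀ p ∈ S, p = 5 ∨ p = 13 := fun p hp => by simpa using hsub hp
  obtain ⟨α, t', H, hα, ht', hlog, hH, hlim⟩ :=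
    exists_tendsto_tsum_totChar hF h.discr_eq hd hS
  obtain ⟨B, hB0, hBle, hBeq⟩ := exists_nat_prod_eq hmem (fun p hp => hd2 p (hsub hp)) hU hUd
  have hprodS : ∏ p ∈ S, p ≤ 65 := by rcases hS with rfl | rfl | rfl <;> simp
  have hD : (0 : ℝ) < -((t : ℝ) ^ 2 - 4 * n) := by
    have : 0 < -(t ^ 2 - 4 * n) := by omega
    exact_mod_cast this
  have hDcast : (-((t ^ 2 - 4 * n : ℤ) : ℝ)) = -((t : ℝ) ^ 2 - 4 * n) := by push_cast; ring
  rw [hDcast] at hlim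
  set d := t ^ 2 - 4 * n with hddef
  set D : ℝ := -((t : ℝ) ^ 2 - 4 * n) with hDdef
  set κ := ∏ p ∈ badPrimes d S, p with hκdef
  have hκ0 : 0 < κ := Finset.prod_pos fun p hp => by
    have := hmem p (mem_badPrimes.1 hp).1
    omega
  have hg0 : 0 < ∏ p ∈ goodPrimes d S, p := Finset.prod_pos fun p hp => by
    have := hmem p (mem_goodPrimes.1 hp).1
    omega
  have hκ65 : κ ≤ 65 := by
    refine le_trans ?_ hprodS
    rw [← prod_good_mul_prod_bad (d := d) (s := S) fun p => p]
    exact Nat.le_mul_of_pos_left _ hg0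
  have hU0 : 0 < U := Nat.pos_of_ne_zero hU.ne_zero
  have hτκ : rowHeight D U 65 ≤ rowHeight D U κ := rowHeight_le_rowHeight hU0 le_rfl hκ0 hκ65
  have hbound := abs_limit_sub_le h hF hU ht hn hlt hh hsub (fun p hp => hd2 p (hsub hp))
    (hτ.trans hτκ) hprod hlim
  set M₁ := ∏ p ∈ badPrimes d S, (1 - ((p : ℝ) ^ 2)⁻¹) with hM₁
  set M₂ := ∏ q ∈ U.primeFactors, (1 + totChar d S q * (q : ℝ)⁻¹) with hM₂
  have hκr : (0 : ℝ) < κ := by exact_mod_cast hκ0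
  have hUr : (0 : ℝ) < U := by exact_mod_cast hU0
  have hsq : 0 < √D := sqrt_pos.2 hD
  refine ⟨α, t', 6 * κ * U * H, B, hα, ht', hlog, by positivity, hB0, ?_, ?_⟩
  · exact hBle.trans (Nat.mul_le_mul_right _ (by nlinarith))
  have hid : ((6 * κ * U * H : ℕ) : ℝ) * log α - B * √D * π =
      6 * κ ^ 2 * U * √D / π * (π * (log α * H) / (κ * √D) - π ^ 2 / 6 * M₁ * M₂) := by
    rw [hBeq]
    push_cast
    field_simp
  have hcard : (U.divisors.card : ℝ) ≤ U := by exact_mod_cast Nat.card_divisors_le_self U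
  have hκ2 : (κ : ℝ) ^ 2 ≤ 4225 := by
    have : (κ : ℝ) ≤ 65 := by exact_mod_cast hκ65
    nlinarith
  rw [hid, abs_mul, abs_of_nonneg (by positivity)]
  calc 6 * (κ : ℝ) ^ 2 * U * √D / π * |π * (log α * H) / (κ * √D) - π ^ 2 / 6 * M₁ * M₂|
      ≤ 6 * (κ : ℝ) ^ 2 * U * √D / π * (U.divisors.card *
        (8 * π * exp (-(2 * π * rowHeight D U κ)))) := by gcongr
    _ ≤ 6 * 4225 * U * √D / π * (U * (8 * π * exp (-(2 * π * rowHeight D U 65)))) := by gcongr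
    _ = 202800 * U ^ 2 * √D * exp (-(2 * π * rowHeight D U 65)) := by
        field_simp
        norm_num

/-- Numerical incompatibility of the upper and lower bounds for the linear form. -/
lemma classNumber_lower_bound {F : Type*} [Field F] [NumberField F] {θ : 𝓞 F}
    (h : IsQuadBasis θ t n) (hF : Module.finrank ℚ F = 2)
    (hU : Squarefree U) (ht : (U : ℤ) ∣ t) (hn : (U : ℤ) ∣ n)
    (hd : t ^ 2 - 4 * n < 0) (hlog : 100 ≤ log (-(t ^ 2 - 4 * n) : ℝ))
    (hX : 2e16 * log (-(t ^ 2 - 4 * n) : ℝ) ^ 5 ≤ √(-(t ^ 2 - 4 * n) : ℝ) / U) :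
    2 * U.divisors.card ≤ classNumber F := by
  by_contra! hh
  have hU0 : 0 < U := Nat.pos_of_ne_zero hU.ne_zero
  have hUr : (1 : ℝ) ≤ U := by exact_mod_cast hU0
  have hD : (0 : ℝ) < -((t : ℝ) ^ 2 - 4 * n) := by
    have : 0 < -(t ^ 2 - 4 * n) := by omega
    exact_mod_cast this
  have hDcast : (-((t ^ 2 - 4 * n : ℤ) : ℝ)) = -((t : ℝ) ^ 2 - 4 * n) := by push_cast; ring
  set D : ℝ := -((t : ℝ) ^ 2 - 4 * n) with hDdef
  set l := log D with hl
  have hl5 : (100 : ℝ) ^ 5 ≤ l ^ 5 := by gcongr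
  have hsq1 : 2e26 ≤ √D / U := by linarith
  have hsqU : 2e26 * U ≤ √D := by rwa [le_div_iff₀ (by positivity)] at hsq1
  have hDD : √D * √D = D := mul_self_sqrt hD.le
  have hDbig : 4 * (U : ℝ) + 260 < D := by nlinarith
  have hlt : 4 * (U : ℤ) + 260 < -(t ^ 2 - 4 * n) := by
    have : 4 * (U : ℝ) + 260 < ((-(t ^ 2 - 4 * n) : ℤ) : ℝ) := by push_cast; linarith
    exact_mod_cast this
  have hrow : rowHeight D U 65 = √D / U / 130 := by
    rw [rowHeight]
    field_simp
    norm_num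
  obtain ⟨α, t', A, B, hα, ht', hlogα, hA, hB, hBle, hsmall⟩ :=
    exists_small_linear_form h hF hU ht hn (by omega) hh (by omega)
      (by rw [← hDdef, hrow]; linarith)
  have hB1 : (1 : ℝ) ≤ B := by exact_mod_cast hB
  have hB2 : (B : ℝ) ≤ 4225 * U ^ 2 := by exact_mod_cast hBle
  have hUD : (U : ℝ) ^ 2 ≤ D := by nlinarith
  have hsqD : √D ≤ D := by nlinarith
  have hDexp : D = exp l := (exp_log hD).symm
  have hexp1 : (2.7 : ℝ) ≤ exp 1 := by linarith [exp_one_gt_d9]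
  have hexp10 : (4225 : ℝ) ≤ exp 10 := by
    calc (4225 : ℝ) ≤ 2.7 ^ 10 := by norm_num
      _ ≤ exp 1 ^ 10 := by gcongr
      _ = exp 10 := by rw [← exp_nat_mul]; norm_num
  have hexp13 : (202800 : ℝ) ≤ exp 13 := by
    calc (202800 : ℝ) ≤ 2.7 ^ 13 := by norm_num
      _ ≤ exp 1 ^ 13 := by gcongr
      _ = exp 13 := by rw [← exp_nat_mul]; norm_num
  have hb : log (B * √D) ≤ 2 * l + 10 := by
    rw [log_le_iff_le_exp (by positivity)]
    calc B * √D ≤ 4225 * U ^ 2 * D := by gcongr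
      _ ≤ exp 10 * D * D := by gcongr
      _ = exp (2 * l + 10) := by
          rw [hDexp, ← exp_add, ← exp_add]
          congr 1
          ring
  have hceil : (⌈l⌉₊ : ℝ) < l + 1 := Nat.ceil_lt_add_one (by linarith)
  have hceil' : l ≤ ⌈l⌉₊ := Nat.le_ceil l
  have hlow := linear_form_lower_bound (t ^ 2 - 4 * n) hd hα ht' hlogα hA
    (b := B * √D) (B := B) (n := ⌈l⌉₊ + 10) (by rw [hDcast]) (by nlinarith)
    (by have : (100 : ℝ) ≤ ⌈l⌉₊ := hlog.trans hceil'
        have : 100 ≤ ⌈l⌉₊ := by exact_mod_cast this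
        omega)
    (by push_cast; linarith)
  have hchain : exp (-(10 ^ 16 * ((⌈l⌉₊ + 10 : ℕ) : ℝ) ^ 4)) ≤
      exp (13 + 2 * l - 2 * π * rowHeight D U 65) := by
    refine (hlow.trans hsmall).trans ?_
    calc 202800 * (U : ℝ) ^ 2 * √D * exp (-(2 * π * rowHeight D U 65))
        ≤ exp 13 * D * D * exp (-(2 * π * rowHeight D U 65)) := by gcongr
      _ = exp (13 + 2 * l - 2 * π * rowHeight D U 65) := by
          rw [hDexp, ← exp_add, ← exp_add, ← exp_add]
          congr 1
          ring
  rw [exp_le_exp, hrow] at hchain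
  have hn4 : ((⌈l⌉₊ + 10 : ℕ) : ℝ) ^ 4 ≤ (1.11 * l) ^ 4 := by
    gcongr
    push_cast
    linarith
  have hX' : 2 * π * (√D / U / 130) ≥ 6 * (2e16 * l ^ 5 / 130) := by
    have h3 : (6 : ℝ) ≤ 2 * π := by linarith [pi_gt_three]
    have h5 : (0 : ℝ) ≤ 2e16 * l ^ 5 := by positivity
    gcongr
  have hl4 : (100 : ℝ) * l ^ 4 ≤ l ^ 5 := by
    rw [pow_succ' l 4]
    gcongr
  have hll : l ≤ l ^ 4 := by
    calc l = l ^ 1 := (pow_one l).symm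
      _ ≤ l ^ 4 := pow_le_pow_right₀ (by linarith) (by norm_num)
  rw [mul_pow] at hn4
  norm_num at hn4 hX' hchain
  linarith

end linearForm

end TwoClassesPerGenus

namespace TwoClassesPerGenus

lemma two_mul_log_sqrt_ge {x : ℝ} (k : ℕ) (hx : (2 : ℝ) ^ k ≤ √x) : 1.38 * k ≤ log x := by
  have h := log_le_log (by positivity) hx
  rw [log_pow, log_sqrt (sqrt_pos.1 (lt_of_lt_of_le (by positivity) hx)).le] at h
  nlinarith [log_two_gt_d9, Nat.cast_nonneg (α := ℝ) k]

/-- A large factor `P` of `D` leaves a cofactor that is small compared with `√D`. -/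
lemma bounds_of_large_factor {D U P : ℝ} (hD : 64 ≤ D) (hU : 32 ≤ U) (hUP : U * P ≤ D)
    (hP : 5e15 * √D * log D ^ 5 * log (log D) ≤ P) :
    100 ≤ log D ∧ 2e16 * log D ^ 5 ≤ √D / U := by
  have hs : 0 < √D := sqrt_pos.2 (by linarith)
  have hkey : U * (5e15 * log D ^ 5 * log (log D)) ≤ √D := by
    refine le_of_mul_le_mul_left ?_ hs
    rw [mul_self_sqrt (by linarith)]
    refine le_trans ?_ hUP
    have := mul_le_mul_of_nonneg_left hP (show 0 ≤ U by linarith)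
    linarith
  have hl4 : 4 ≤ log D := by
    have := two_mul_log_sqrt_ge 3 (x := D) (by
      rw [show (2 : ℝ) ^ 3 = √64 by rw [show (64 : ℝ) = 8 ^ 2 by norm_num]; norm_num]
      exact sqrt_le_sqrt hD)
    norm_num at this
    linarith
  have hloglog : ∀ k : ℕ, (2.7182818286 : ℝ) ^ k ≤ log D → (k : ℝ) ≤ log (log D) := fun k hk => by
    rw [le_log_iff_exp_le (by linarith)]
    refine le_trans ?_ hk
    rw [← mul_one (k : ℝ), exp_nat_mul]
    exact pow_le_pow_left₀ (exp_pos 1).le exp_one_lt_d9.le k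
  have hll1 : 1 ≤ log (log D) := by simpa using hloglog 1 (by linarith)
  have hboot : ∀ c : ℝ, 0 ≤ c → c ≤ log D → 32 * (5e15 * c ^ 5 * 1) ≤ √D := fun c hc hcl =>
    hkey.trans' (by gcongr)
  have hl91 : 91 ≤ log D := by
    have := two_mul_log_sqrt_ge 66 ((hboot 4 (by norm_num) hl4).trans' (by norm_num))
    norm_num at this
    linarith
  have hl100 : 100 ≤ log D := by
    have := two_mul_log_sqrt_ge 80 ((hboot 91 (by norm_num) hl91).trans' (by norm_num))
    norm_num at this
    linarith
  refine ⟨hl100, ?_⟩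
  have hll4 : 4 ≤ log (log D) := by exact_mod_cast hloglog 4 (hl100.trans' (by norm_num))
  rw [le_div_iff₀ (by linarith), mul_comm]
  refine le_trans ?_ hkey
  have : 0 ≤ log D ^ 5 := by positivity
  exact mul_le_mul_of_nonneg_left (by nlinarith) (by linarith)

lemma squarefree_prod_primes {s : Finset ℕ} (hs : ∀ p ∈ s, p.Prime) : Squarefree (∏ p ∈ s, p) := by
  refine Finset.squarefree_prod_of_pairwise_isCoprime (fun p hp q hq hpq => ?_)
    fun p hp => (hs p hp).squarefree
  exact Nat.coprime_iff_isRelPrime.1 ((Nat.coprime_primes (hs p hp) (hs q hq)).2 hpq)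

lemma card_divisors_prod_primes {s : Finset ℕ} (hs : ∀ p ∈ s, p.Prime) :
    (∏ p ∈ s, p).divisors.card = 2 ^ s.card := by
  have hsq := squarefree_prod_primes hs
  rw [Nat.card_divisors hsq.ne_zero, Nat.primeFactors_prod hs]
  refine Finset.prod_eq_pow_card fun p hp => ?_
  rw [Nat.factorization_eq_one_of_squarefree hsq (hs p hp) (Finset.dvd_prod_of_mem _ hp)]

end TwoClassesPerGenus

open TwoClassesPerGenus

/-- **Theorem 1.** If `d < 0` is a fundamental discriminant (the discriminant of an
imaginary quadratic number field `K = ℚ(√d)`) with at least 32 genera (`ω(|d|) ≥ 6`),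
and its largest prime factor `P` satisfies
`P ≥ 5·10^15 · |d|^{1/2} · (log |d|)^5 · log log |d|`,
then `d` has at least two classes of binary quadratic forms in each genus,
i.e. `h(d) ≥ 2 ^ ω(|d|)`. -/
theorem largePrimeFactor_two_classes_per_genus
    (d : ℤ) (hd : d < 0)
    (K : Type*) [Field K] [NumberField K]
    (hdeg : Module.finrank ℚ K = 2)
    (hdisc : NumberField.discr K = d)
    (hgenera : 6 ≤ d.natAbs.primeFactors.card)
    (P : ℕ) (hP : P.Prime) (hPdvd : (P : ℤ) ∣ d)
    (hPmax : ∀ q : ℕ, q.Prime → (q : ℤ) ∣ d → q ≤ P)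
    (hPbig : (P : ℝ) ≥ 5e15 * Real.sqrt |(d : ℝ)| * (Real.log |(d : ℝ)|) ^ 5 *
      Real.log (Real.log |(d : ℝ)|)) :
    2 ^ d.natAbs.primeFactors.card ≤ NumberField.classNumber K := by
  set s := d.natAbs.primeFactors with hs
  have hPs : P ∈ s := Nat.mem_primeFactors.2
    ⟨hP, Int.natCast_dvd.1 hPdvd, Int.natAbs_ne_zero.2 hd.ne⟩
  have hprime : ∀ q ∈ s, q.Prime := fun q hq => Nat.prime_of_mem_primeFactors hq
  have hprime' : ∀ q ∈ s.erase P, q.Prime := fun q hq => hprime q (Finset.mem_of_mem_erase hq)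
  have hcard : (s.erase P).card + 1 = s.card := Finset.card_erase_add_one hPs
  set U := ∏ q ∈ s.erase P, q with hU
  have hUP : U * P ∣ d.natAbs := by
    rw [hU, Finset.prod_erase_mul _ _ hPs]
    exact Nat.prod_primeFactors_dvd _
  have hUP_le : U * P ≤ d.natAbs := Nat.le_of_dvd (Int.natAbs_pos.2 hd.ne) hUP
  have hU32 : 32 ≤ U := by
    calc 32 = 2 ^ 5 := by norm_num
      _ ≤ 2 ^ (s.erase P).card := Nat.pow_le_pow_right (by norm_num) (by omega)
      _ ≤ U := Finset.pow_card_le_prod _ _ _ fun q hq => (hprime' q hq).two_le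
  have hD64 : 64 ≤ d.natAbs := by nlinarith [hP.two_le]
  have habs : |(d : ℝ)| = (d.natAbs : ℝ) := by rw [Nat.cast_natAbs, Int.cast_abs]
  rw [habs] at hPbig
  obtain ⟨hlog, hX⟩ := bounds_of_large_factor (D := d.natAbs) (U := U) (P := P)
    (by exact_mod_cast hD64) (by exact_mod_cast hU32) (by exact_mod_cast hUP_le) hPbig
  obtain ⟨θ, t, n, h⟩ := exists_isQuadBasis K hdeg
  have hsq := squarefree_prod_primes hprime'
  obtain ⟨θ, t, n, h, ht, hn⟩ := h.exists_dvd_dvd hsq (by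
    rw [← h.discr_eq, hdisc]
    exact Int.natCast_dvd.2 ((dvd_mul_right U P).trans hUP))
  have hdtn : t ^ 2 - 4 * n = d := by rw [← h.discr_eq, hdisc]
  have hcast : (-(t ^ 2 - 4 * n) : ℝ) = d.natAbs := by
    rw [← habs, abs_of_neg (by exact_mod_cast hd), ← hdtn]
    push_cast
    ring
  have hmain := classNumber_lower_bound h hdeg hsq ht hn (by omega) (by rwa [hcast])
    (by rwa [hcast])
  rw [card_divisors_prod_primes hprime', ← pow_succ', hcard] at hmain
  exact hmain
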